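/- arXiv:2302.09811 — 2 statements merged into one kernel-verified Lean document; each statement's English description precedes it below -/
import Mathlib

section
/- Let H = A∗_C be the HNN extension associated to injections i_P, i_N : C → A with images C_P, C_N. Suppose both pairs (A, C_P) and (A, C_N) are ∞-RF. Let w ∈ H with p(w) = 1 or p(w) = −1, and suppose w is not conjugate in H to a·t or to a·t⁻¹ for any a ∈ A. Then the natural homomorphism A → H/⟪w⟫ is injective. -/
/-- An element `a ∈ A \ C` is *length-`n` relatively free* (`n`-RF) relative to the subgroup `C`
if every product `a^{e 0} * c 0 * a^{e 1} * c 1 * ⋯` of length `k ≥ 1` with `e i = ±1`, `c i ∈ C`,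
`c i ≠ 1` whenever `e i = -e (i+1)` (indices cyclic), and with fewer than `n` of the `e i`
equal to `+1` and fewer than `n` equal to `-1`, is nontrivial. -/
def IsRF {A : Type} [Group A] (C : Subgroup A) (n : ℕ∞) (a : A) : Prop :=
  ∀ (k : ℕ) (e : Fin (k + 1) → ℤ) (c : Fin (k + 1) → A),
    (∀ i, e i = 1 ∨ e i = -1) → (∀ i, c i ∈ C) →
    (∀ i, e i = -(e (i + 1)) → c i ≠ 1) →
    ((Finset.univ.filter (fun i => e i = 1)).card : ℕ∞) < n →
    ((Finset.univ.filter (fun i => e i = -1)).card : ℕ∞) < n →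
    (List.ofFn fun i => a ^ e i * c i).prod ≠ 1

section HNNSetup

variable {C A : Type} [Group C] [Group A] (iP iN : C →* A)
  (hiP : Function.Injective iP) (hiN : Function.Injective iN)

/-- The isomorphism `i_P(C) ≃* i_N(C)` sending `i_P c` to `i_N c`; the associated HNN extension
`HNNExtension A iP.range iN.range (hnnφ iP iN hiP hiN)` is `⟨A, t ∣ i_N c = t (i_P c) t⁻¹⟩`. -/
noncomputable def hnnφ : (iP.range : Subgroup A) ≃* (iN.range : Subgroup A) :=
  (MonoidHom.ofInjective hiP).symm.trans (MonoidHom.ofInjective hiN)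

/-- The projection `p : A ∗_C → ℤ` with `p t = 1` and `p a = 0` for `a ∈ A`. -/
noncomputable def hnnProj :
    HNNExtension A iP.range iN.range (hnnφ iP iN hiP hiN) →* Multiplicative ℤ :=
  HNNExtension.lift 1 (Multiplicative.ofAdd 1) (fun a => by simp)

end HNNSetup

namespace Kly

/-- `sg t true = t`, `sg t false = t⁻¹`. -/
def sg {H : Type*} [Group H] (t : H) (b : Bool) : H := if b then t else t⁻¹

@[simp] lemma sg_true {H : Type*} [Group H] (t : H) : sg t true = t := rfl
@[simp] lemma sg_false {H : Type*} [Group H] (t : H) : sg t false = t⁻¹ := rfl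

lemma sg_not {H : Type*} [Group H] (t : H) (b : Bool) : sg t (!b) = (sg t b)⁻¹ := by
  cases b <;> simp

/-- The product of a word in `t` with coefficients. -/
def wprod {H : Type*} [Group H] (t : H) (L : List (Bool × H)) : H :=
  (L.map fun x => sg t x.1 * x.2).prod

section
variable {H : Type*} [Group H] (t : H)
@[simp] lemma wprod_nil : wprod t [] = 1 := rfl
@[simp] lemma wprod_cons (x : Bool × H) (L) : wprod t (x :: L) = sg t x.1 * x.2 * wprod t L := by
  simp [wprod]
@[simp] lemma wprod_append (L M : List (Bool × H)) :
    wprod t (L ++ M) = wprod t L * wprod t M := by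
  simp [wprod]
end

/-- Linear version of relative freeness. -/
def LRF {H : Type*} [Group H] (C : Subgroup H) (x : H) : Prop :=
  ∀ L : List (Bool × H), L ≠ [] → (∀ y ∈ L, y.2 ∈ C) →
    L.IsChain (fun y z => y.1 ≠ z.1 → y.2 ≠ 1) → wprod x L ≠ 1

lemma lrf_of_isRF {A : Type} [Group A] (C : Subgroup A) (a : A) (h : IsRF C ⊤ a) : LRF C a := by
  intro L
  induction hn : L.length using Nat.strong_induction_on generalizing L with
  | _ n ih =>
  intro hne hC hch
  by_cases hcyc : (L.getLast hne).1 ≠ (L.head hne).1 → (L.getLast hne).2 ≠ 1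
  · obtain ⟨k, hk⟩ : ∃ k, L.length = k + 1 :=
      ⟨L.length - 1, by have := List.length_pos_iff.2 hne; omega⟩
    have h1 := h k (fun i => if (L[i.1]'(by omega)).1 then 1 else -1) (fun i => (L[i.1]'(by omega)).2)
      (fun i => by split_ifs <;> simp) (fun i => hC _ (List.getElem_mem _)) ?_
      (by simp) (by simp)
    · intro h2
      apply h1
      rw [← h2, wprod]
      congr 1
      apply List.ext_getElem
      · simp [hk]
      · intro i hi1 hi2
        simp only [List.getElem_ofFn, List.getElem_map]
        split_ifs with hb <;> simp [hb]
    · intro i hi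
      by_cases hil : i.1 + 1 < k + 1
      · have hv : ((i + 1 : Fin (k+1))).1 = i.1 + 1 := by
          rw [Fin.val_add_one_of_lt']; exact hil
        have := List.isChain_iff_getElem.1 hch i.1 (by omega)
        apply this
        simp only [hv] at hi
        intro he
        rw [he] at hi
        split_ifs at hi <;> simp at hi
      · have hil' : i = Fin.last k := by ext; simp; omega
        subst hil'
        simp only [Fin.last_add_one] at hi
        rw [List.getLast_eq_getElem, List.head_eq_getElem] at hcyc
        simp only [hk] at hcyc
        apply hcyc
        intro he
        simp only [Fin.val_last, Fin.val_zero] at hi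
        simp only [Nat.add_sub_cancel] at he
        simp only [he] at hi
        exact (by decide : ∀ b : Bool, (if b = true then (1:ℤ) else -1) ≠ -(if b = true then (1:ℤ) else -1)) _ hi
  · push Not at hcyc
    obtain ⟨hs, h1⟩ := hcyc
    obtain ⟨y, L', rfl⟩ := List.exists_cons_of_ne_nil hne
    rcases List.eq_nil_or_concat L' with rfl | ⟨M, z, rfl⟩
    · simp at hs
    · simp only [List.concat_eq_append] at *
      simp only [List.head_cons] at hs
      rw [List.getLast_cons (by simp), List.getLast_append_singleton] at hs h1
      have hsg : sg a z.1 = (sg a y.1)⁻¹ := by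
        rw [← sg_not]; congr 1; revert hs; cases z.1 <;> cases y.1 <;> simp
      intro hp
      rcases List.eq_nil_or_concat M with rfl | ⟨M', m, rfl⟩
      · simp only [List.nil_append, wprod_cons, wprod_nil, mul_one, h1, hsg] at hp
        have : y.2 = 1 := by
          have := hp
          rw [mul_inv_eq_one] at this
          exact mul_eq_left.1 this
        simp at hch
        exact hch (Ne.symm hs) this
      · simp only [List.concat_eq_append] at *
        refine ih (M' ++ [(m.1, m.2 * y.2)]).length ?_ _ rfl (by simp) ?_ ?_ ?_
        · simp at hn ⊢; omega
        · intro x hx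
          simp at hx
          rcases hx with hx | rfl
          · exact hC _ (by simp [hx])
          · exact C.mul_mem (hC _ (by simp)) (hC _ (by simp))
        · have h3 : (M' ++ [m]).IsChain (fun y z => y.1 ≠ z.1 → y.2 ≠ (1:A)) :=
            (List.isChain_append.1 (List.IsChain.tail hch)).1
          rw [List.isChain_append] at h3 ⊢
          refine ⟨h3.1, by simp, ?_⟩
          intro x hx u hu
          simp at hu
          subst hu
          exact h3.2.2 x hx m (by simp)
        · simp only [wprod_cons, wprod_append, wprod_nil, mul_one, h1, hsg] at hp ⊢
          have : sg a y.1 * (y.2 * (wprod a M' * (sg a m.1 * m.2))) * (sg a y.1)⁻¹ = 1 := by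
            rw [← hp]; group
          rw [mul_inv_eq_one, mul_eq_left] at this
          have h5 := mul_eq_one_iff_eq_inv'.1 this
          rw [← mul_assoc, ← mul_assoc, mul_assoc (wprod a M'), h5]; simp

lemma LRF.map {G H : Type*} [Group G] [Group H] {C : Subgroup G} {x : G} (h : LRF C x)
    (f : G →* H) (hf : Function.Injective f) : LRF (C.map f) (f x) := by
  intro L hne hC hch hp
  choose! g hg using fun (y : Bool × H) (hy : y ∈ L) => Subgroup.mem_map.1 (hC y hy)
  refine h (L.map fun y => (y.1, g y)) (by simpa using hne) ?_ ?_ ?_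
  · intro y hy
    obtain ⟨z, hz, rfl⟩ := List.mem_map.1 hy
    exact (hg z hz).1
  · rw [List.isChain_map]
    rw [List.isChain_iff_getElem] at hch ⊢
    intro i hi hne1 h1
    apply hch i hi hne1
    rw [← (hg _ (List.getElem_mem _)).2]
    simp only at h1
    rw [h1, map_one]
  · apply hf
    rw [map_one, ← hp, wprod, wprod, map_list_prod, List.map_map, List.map_map]
    congr 1
    apply List.map_congr_left
    intro y hy
    simp only [Function.comp, map_mul, (hg y hy).2]
    cases y.1 <;> simp

lemma LRF.conj {G : Type*} [Group G] {C : Subgroup G} {x : G} (h : LRF C x) (u : G) :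
    LRF (C.map (MulAut.conj u).toMonoidHom) (u * x * u⁻¹) :=
  h.map (MulAut.conj u).toMonoidHom (MulAut.conj u).injective

end Kly

namespace Kly

/-- Membership in the associated subgroup attached to a letter. -/
def inC {H : Type*} [Group H] (t : H) (CN : Subgroup H) (b : Bool) (h : H) : Prop :=
  if b then t * h * t⁻¹ ∈ CN else h ∈ CN

@[simp] lemma inC_true {H : Type*} [Group H] (t : H) (CN : Subgroup H) (h : H) :
    inC t CN true h ↔ t * h * t⁻¹ ∈ CN := by simp [inC]
@[simp] lemma inC_false {H : Type*} [Group H] (t : H) (CN : Subgroup H) (h : H) :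
    inC t CN false h ↔ h ∈ CN := by simp [inC]

/-- `H` is an HNN extension of `A` with associated subgroups `t⁻¹ CN t` and `CN`, and relatively
free pairs. -/
structure Hyp {H : Type*} [Group H] (A CN : Subgroup H) (t : H) : Prop where
  cn_le : CN ≤ A
  cp_le : ∀ c ∈ CN, t⁻¹ * c * t ∈ A
  brit : ∀ L : List (Bool × H), L ≠ [] → (∀ x ∈ L, x.2 ∈ A) →
    L.IsChain (fun x y => x.1 ≠ y.1 → ¬ inC t CN x.1 x.2) → wprod t L ≠ 1
  rfN : ∀ a ∈ A, a ∉ CN → LRF CN a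
  rfP : ∀ a ∈ A, t * a * t⁻¹ ∉ CN → LRF CN (t * a * t⁻¹)
  gen : Subgroup.closure ((A : Set H) ∪ {t}) = ⊤

open HNNExtension in
lemma hyp_init {C A : Type} [Group C] [Group A] (iP iN : C →* A)
    (hiP : Function.Injective iP) (hiN : Function.Injective iN)
    (hP : ∀ a : A, a ∉ iP.range → IsRF iP.range ⊤ a)
    (hN : ∀ a : A, a ∉ iN.range → IsRF iN.range ⊤ a) :
    Hyp (of : A →* HNNExtension A iP.range iN.range (hnnφ iP iN hiP hiN)).range
      (iN.range.map (of : A →* HNNExtension A iP.range iN.range (hnnφ iP iN hiP hiN))) t := by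
  set φ := hnnφ iP iN hiP hiN with hφ
  have hinj : Function.Injective (of : A →* HNNExtension A iP.range iN.range φ) := of_injective φ
  have key : ∀ c : C, (t : HNNExtension A iP.range iN.range φ) * of (iP c) * t⁻¹ = of (iN c) := by
    intro c
    have h1 := t_mul_of (φ := φ) ⟨iP c, c, rfl⟩
    have h2 : φ ⟨iP c, c, rfl⟩ = ⟨iN c, c, rfl⟩ := by
      have : (⟨iP c, c, rfl⟩ : iP.range) = MonoidHom.ofInjective hiP c := rfl
      rw [this, hφ, hnnφ]
      simp only [MulEquiv.trans_apply, MulEquiv.symm_apply_apply]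
      rfl
    rw [h2] at h1
    simp only at h1
    rw [h1]; group
  have keyP : ∀ a : A, (t : HNNExtension A iP.range iN.range φ) * of a * t⁻¹ ∈ iN.range.map of →
      a ∈ iP.range := by
    intro a ha
    obtain ⟨_, ⟨c, rfl⟩, hc⟩ := Subgroup.mem_map.1 ha
    rw [← key] at hc
    have := mul_left_cancel (mul_right_cancel hc)
    exact ⟨c, hinj this⟩
  have keyN : ∀ a : A, (of a : HNNExtension A iP.range iN.range φ) ∈ iN.range.map of →
      a ∈ iN.range := by
    intro a ha
    obtain ⟨x, hx, hc⟩ := Subgroup.mem_map.1 ha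
    rwa [← hinj hc]
  refine ⟨?_, ?_, ?_, ?_, ?_, ?_⟩
  · rintro _ ⟨a, -, rfl⟩; exact ⟨a, rfl⟩
  · rintro _ ⟨_, ⟨c, rfl⟩, rfl⟩
    refine ⟨iP c, ?_⟩
    rw [← key]; group
  · intro L hne hL hch hp
    choose! g hg using fun (y : Bool × HNNExtension A iP.range iN.range φ) (hy : y ∈ L) => hL y hy
    let W : NormalWord.ReducedWord A iP.range iN.range :=
      ⟨1, L.map fun y => ((if y.1 then 1 else -1 : ℤˣ), g y), by
        rw [List.isChain_map]
        rw [List.isChain_iff_getElem] at hch ⊢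
        intro i hi hm
        have h1 := hch i hi
        have h2 := hg _ (List.getElem_mem (show i < L.length by omega))
        by_contra hcon
        have h3 : L[i].1 ≠ L[i+1].1 := by
          intro h; apply hcon; simp [h]
        apply h1 h3
        rw [← h2]
        simp only at hm
        cases hb : L[i].1
        · rw [hb] at hm
          simp at hm
          obtain ⟨c, hc⟩ := hm
          simp
          exact ⟨c, by rw [hc]⟩
        · rw [hb] at hm
          simp at hm
          obtain ⟨c, hc⟩ := hm
          simp
          exact ⟨c, by rw [← hc, key]⟩⟩
    have h1 := ReducedWord.toList_eq_nil_of_mem_of_range φ W (by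
      refine ⟨1, ?_⟩
      rw [map_one, ← hp]
      simp only [NormalWord.ReducedWord.prod, W, map_one, one_mul, List.map_map, wprod]
      congr 1
      apply List.map_congr_left
      intro y hy
      simp only [Function.comp]
      rw [hg y hy]
      cases y.1 <;> simp)
    simp [W] at h1
    exact hne h1
  · rintro _ ⟨a, rfl⟩ ha
    exact (lrf_of_isRF _ _ (hN a (fun h => ha ⟨a, h, rfl⟩))).map of hinj
  · rintro _ ⟨a, rfl⟩ ha
    have h1 : a ∉ iP.range := by
      rintro ⟨c, rfl⟩
      apply ha
      rw [key]
      exact ⟨_, ⟨c, rfl⟩, rfl⟩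
    have h2 := ((lrf_of_isRF _ _ (hP a h1)).map of hinj).conj t
    convert h2 using 1
    ext x
    constructor
    · rintro ⟨_, ⟨c, rfl⟩, rfl⟩
      exact ⟨_, ⟨_, ⟨c, rfl⟩, rfl⟩, by simp [key]⟩
    · rintro ⟨_, ⟨_, ⟨c, rfl⟩, rfl⟩, rfl⟩
      exact ⟨_, ⟨c, rfl⟩, by simp [key]⟩
  · rw [eq_top_iff]
    intro x _
    refine induction_on (motive := fun x => x ∈ _) x ?_ ?_ ?_ ?_
    · intro a; exact Subgroup.subset_closure (Or.inl ⟨a, rfl⟩)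
    · exact Subgroup.subset_closure (Or.inr rfl)
    · intro a b; exact Subgroup.mul_mem _
    · intro a; exact Subgroup.inv_mem _

end Kly

namespace Kly

section LRFtools
variable {H : Type*} [Group H]

lemma LRF.not_mem {C : Subgroup H} {x : H} (h : LRF C x) (L : List (Bool × H)) (hne : L ≠ [])
    (hC : ∀ y ∈ L, y.2 ∈ C) (hch : L.IsChain (fun y z => y.1 ≠ z.1 → y.2 ≠ 1)) :
    wprod x L ∉ C := by
  intro hmem
  rcases List.eq_nil_or_concat L with rfl | ⟨M, m, rfl⟩
  · exact hne rfl
  simp only [List.concat_eq_append] at *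
  refine h (M ++ [(m.1, m.2 * (wprod x (M ++ [m]))⁻¹)]) (by simp) ?_ ?_ ?_
  · intro z hz
    simp only [List.mem_append, List.mem_singleton] at hz
    rcases hz with hz | rfl
    · exact hC _ (by simp [hz])
    · exact C.mul_mem (hC _ (by simp)) (C.inv_mem hmem)
  · rw [List.isChain_append] at hch ⊢
    refine ⟨hch.1, by simp, ?_⟩
    intro a ha b hb
    simp at hb
    subst hb
    exact hch.2.2 a ha m (by simp)
  · simp only [wprod_append, wprod_cons, wprod_nil, mul_one]
    group

/-- An induction principle for proving `LRF`. -/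
lemma lrf_of_inv {C : Subgroup H} {x : H} (Q : Bool → H → Prop)
    (base : ∀ e, ∀ c ∈ C, Q e (sg x e * c))
    (step : ∀ e e', ∀ c ∈ C, ∀ g, (e ≠ e' → c ≠ 1) → Q e' g → Q e (sg x e * c * g))
    (ne : ∀ e g, Q e g → g ≠ 1) : LRF C x := by
  have main : ∀ L : List (Bool × H), ∀ y, (∀ z ∈ y :: L, z.2 ∈ C) →
      (y :: L).IsChain (fun y z => y.1 ≠ z.1 → y.2 ≠ 1) → Q y.1 (wprod x (y :: L)) := by
    intro L
    induction L with
    | nil =>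
      intro y hy _
      simpa using base y.1 y.2 (hy y (by simp))
    | cons y' L ih =>
      intro y hy hch
      rw [wprod_cons]
      rw [List.isChain_cons_cons] at hch
      exact step _ y'.1 _ (hy y (by simp)) _ hch.1
        (ih y' (fun z hz => hy z (List.mem_cons_of_mem _ hz)) hch.2)
  intro L hne hC hch
  obtain ⟨y, L', rfl⟩ := List.exists_cons_of_ne_nil hne
  exact ne _ _ (main L' y hC hch)

lemma LRF.mul_right {C : Subgroup H} {x c : H} (h : LRF C x) (hc : c ∈ C) : LRF C (x * c) := by
  refine lrf_of_inv (fun e g => ∃ y L, y.1 = e ∧ (∀ z ∈ y :: L, z.2 ∈ C) ∧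
    (y :: L).IsChain (fun y z => y.1 ≠ z.1 → y.2 ≠ 1) ∧
    g = (if e then 1 else c⁻¹) * wprod x (y :: L)) ?_ ?_ ?_
  · intro e d hd
    refine ⟨(e, (if e then c else 1) * d), [], rfl, ?_, by simp, ?_⟩
    · simp only [List.mem_singleton, forall_eq]
      cases e <;> simp [hd, C.mul_mem hc hd]
    · cases e <;> simp [mul_assoc]
  · rintro e e' d hd g hne ⟨y, L, rfl, hyC, hch, rfl⟩
    refine ⟨(e, (if e then c else 1) * d * (if y.1 then 1 else c⁻¹)), y :: L, rfl, ?_, ?_, ?_⟩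
    · intro z hz
      rcases List.mem_cons.1 hz with rfl | hz
      · refine C.mul_mem (C.mul_mem ?_ hd) ?_ <;> split_ifs <;> simp [hc]
      · exact hyC z hz
    · rw [List.isChain_cons_cons]
      refine ⟨?_, hch⟩
      intro h1
      have h2 := hne h1
      simp only at h1 ⊢
      revert h1
      cases e <;> cases y.1 <;> simp [h2]
    · rw [wprod_cons x (_, _)]
      cases e <;> simp [mul_assoc]
  · rintro e g ⟨y, L, rfl, hyC, hch, rfl⟩ h1
    refine h.not_mem (y :: L) (by simp) hyC hch ?_
    rw [mul_eq_one_iff_eq_inv'] at h1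
    rw [h1]
    split_ifs <;> simp [hc]

lemma LRF.conj_mem {C : Subgroup H} {x c : H} (h : LRF C x) (hc : c ∈ C) :
    LRF C (c * x * c⁻¹) := by
  have h1 := h.conj c
  convert h1 using 1
  ext y
  constructor
  · intro hy
    exact ⟨c⁻¹ * y * c, C.mul_mem (C.mul_mem (C.inv_mem hc) hy) hc, by simp; group⟩
  · rintro ⟨z, hz, rfl⟩
    simp
    exact C.mul_mem (C.mul_mem hc hz) (C.inv_mem hc)

lemma LRF.two_sided {C : Subgroup H} {x c d : H} (h : LRF C x) (hc : c ∈ C) (hd : d ∈ C) :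
    LRF C (c * x * d) := by
  have := (h.conj_mem hc).mul_right (C.mul_mem hc hd)
  convert this using 1
  group

/-- Malnormality. -/
lemma LRF.malnormal {C : Subgroup H} {x c : H} (h : LRF C x) (hc : c ∈ C) (h1 : c ≠ 1) :
    x * c * x⁻¹ ∉ C := by
  have := h.not_mem [(true, c), (false, 1)] (by simp) (by simp [hc]) (by simp [h1])
  simpa using this

lemma LRF.malnormal' {C : Subgroup H} {x c : H} (h : LRF C x) (hc : c ∈ C) (h1 : c ≠ 1) :
    x⁻¹ * c * x ∉ C := by
  have := h.not_mem [(false, c), (true, 1)] (by simp) (by simp [hc]) (by simp [h1])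
  simpa using this

lemma LRF.pow_not_mem {C : Subgroup H} {x : H} (h : LRF C x) (n : ℕ) : x ^ (n + 1) ∉ C := by
  have := h.not_mem (List.replicate (n+1) (true, 1)) (by simp)
    (by intro y hy; rw [List.eq_of_mem_replicate hy]; exact C.one_mem)
    (List.isChain_iff_getElem.2 (by intro i hi; simp))
  simpa [wprod] using this

end LRFtools

section Amalgam
variable {H : Type*} [Group H]

/-- Reduced elements of an amalgam with first and last syllable types. -/
inductive D (S : Bool → Subgroup H) (C : Subgroup H) : Bool → Bool → H → Prop
  | single (s : Bool) (g : H) (hg : g ∈ S s) (hc : g ∉ C) : D S C s s g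
  | cons (s b : Bool) (g h : H) (hg : g ∈ S s) (hc : g ∉ C) (hh : D S C (!s) b h) :
      D S C s b (g * h)

/-- Two sided version. -/
inductive D' (S : Bool → Subgroup H) (C : Subgroup H) : Bool → H → Prop
  | single (s : Bool) (g : H) (hg : g ∈ S s) (hc : g ∉ C) : D' S C s g
  | wrap (s : Bool) (g k h : H) (hg : g ∈ S s) (hgc : g ∉ C) (hh : h ∈ S s) (hhc : h ∉ C)
      (hk : D' S C (!s) k) : D' S C s (g * k * h)

structure Amal (S : Bool → Subgroup H) (C : Subgroup H) : Prop where
  le : ∀ b, C ≤ S b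
  nf : ∀ s b g, D S C s b g → g ≠ 1
  lrf : ∀ b, ∀ z ∈ S b, z ∉ C → LRF C z

variable {S : Bool → Subgroup H} {C : Subgroup H}

lemma D.append {s b b' : Bool} {g h : H} (hg : D S C s b g) (hh : D S C (!b) b' h) :
    D S C s b' (g * h) := by
  induction hg with
  | single s g hg hc => exact D.cons s b' g h hg hc hh
  | cons s b g k hg hc _ ih => rw [mul_assoc]; exact D.cons s b' g _ hg hc (ih hh)

lemma D.inv {s b : Bool} {g : H} (hg : D S C s b g) : D S C b s g⁻¹ := by
  induction hg with
  | single s g hg hc => exact D.single s _ ((S s).inv_mem hg) (by simpa using hc)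
  | cons s b g k hg hc _ ih =>
    rw [mul_inv_rev]
    refine ih.append ?_
    rw [Bool.not_not]
    exact D.single s _ ((S s).inv_mem hg) (by simpa using hc)

lemma D.mulL (hle : ∀ b, C ≤ S b) {s b : Bool} {g c : H} (hg : D S C s b g) (hc : c ∈ C) :
    D S C s b (c * g) := by
  cases hg with
  | single _ _ hg hgc =>
    exact D.single s _ ((S s).mul_mem (hle s hc) hg) (fun h => hgc ((C.mul_mem_cancel_left hc).1 h))
  | cons _ _ g h hg hgc hh =>
    rw [← mul_assoc]
    exact D.cons s _ _ _ ((S s).mul_mem (hle s hc) hg)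
      (fun h => hgc ((C.mul_mem_cancel_left hc).1 h)) hh

lemma D.mulR (hle : ∀ b, C ≤ S b) {s b : Bool} {g c : H} (hg : D S C s b g) (hc : c ∈ C) :
    D S C s b (g * c) := by
  have := (hg.inv.mulL hle (C.inv_mem hc)).inv
  simpa using this

lemma D'.toD {s : Bool} {g : H} (hg : D' S C s g) : D S C s s g := by
  induction hg with
  | single s g hg hc => exact D.single s g hg hc
  | wrap s g k h hg hgc hh hhc _ ih =>
    rw [mul_assoc]
    refine D.cons s _ _ _ hg hgc (ih.append ?_)
    rw [Bool.not_not]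
    exact D.single s h hh hhc

lemma D'.shift {s : Bool} {k : H} (hk : D' S C s k) : ∀ y ∈ S (!s), y ∉ C →
    ∃ k2 y2, D' S C (!s) k2 ∧ y2 ∈ S s ∧ y2 ∉ C ∧ y * k = k2 * y2 := by
  induction hk with
  | single s g hg hc => intro y hy hyc; exact ⟨y, g, D'.single _ _ hy hyc, hg, hc, rfl⟩
  | wrap s g k h hg hgc hh hhc _ ih =>
    intro y hy hyc
    obtain ⟨k2, y2, h1, h2, h3, h4⟩ := ih g (by simpa using hg) hgc
    refine ⟨y * k2 * y2, h, D'.wrap _ _ _ _ hy hyc h2 h3 h1, hh, hhc, ?_⟩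
    rw [h4]; group

lemma D.toD' {s b : Bool} {g : H} (hg : D S C s b g) :
    (b = s → D' S C s g) ∧
    (b = !s → ∃ k y, D' S C s k ∧ y ∈ S (!s) ∧ y ∉ C ∧ g = k * y) := by
  induction hg with
  | single s g hg hc => exact ⟨fun _ => D'.single s g hg hc, fun h => by simp at h⟩
  | cons s b g h hg hc _ ih =>
    constructor
    · intro hb
      obtain ⟨k, y, h1, h2, h3, rfl⟩ := ih.2 (by simp [hb])
      rw [← mul_assoc]
      exact D'.wrap _ _ _ _ hg hc (by simpa using h2) h3 h1
    · intro hb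
      obtain ⟨k, y, h1, h2, h3, h4⟩ := (ih.1 hb).shift g (by simpa using hg) hc
      exact ⟨k, y, by simpa using h1, h2, h3, h4⟩

lemma not_mem_mul_right {c z : H} (hc : c ∈ C) (hz : z ∉ C) : z * c ∉ C :=
  fun h => hz ((C.mul_mem_cancel_right hc).1 h)

lemma D'.pow (hA : Amal S C) {s : Bool} {g : H} (hg : D' S C s g) (n : ℕ) : ∀ c ∈ C,
    D S C s s ((g * c) ^ (n + 1)) := by
  induction hg with
  | single s g hg hc =>
    intro c hcC
    have h1 : g * c ∈ S s := (S s).mul_mem hg (hA.le s hcC)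
    exact D.single s _ ((S s).pow_mem h1 _)
      ((hA.lrf s _ h1 (not_mem_mul_right hcC hc)).pow_not_mem n)
  | wrap s y k z' hy hyc hz' hzc' hk ih =>
    intro c hcC
    rw [mul_assoc (y * k)]
    have hz : z' * c ∈ S s := (S s).mul_mem hz' (hA.le s hcC)
    have hzc : z' * c ∉ C := not_mem_mul_right hcC hzc'
    generalize z' * c = z at *
    by_cases hzy : z * y ∈ C
    · have key : (y * k * z) ^ (n+1) = y * ((k * (z * y)) ^ (n+1) * y⁻¹) := by
        rw [← mul_assoc, ← conj_pow]
        congr 1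
        group
      rw [key]
      refine D.cons _ _ _ _ hy hyc ((ih _ hzy).append ?_)
      rw [Bool.not_not]
      exact D.single _ _ ((S s).inv_mem hy) (by simpa using hyc)
    · have key : ∀ m, ∃ R, D S C (!s) s R ∧ (y * k * z) ^ (m+1) = y * R := by
        intro m
        induction m with
        | zero =>
          refine ⟨k * z, hk.toD.append ?_, by group⟩
          rw [Bool.not_not]
          exact D.single _ _ hz hzc
        | succ m ihm =>
          obtain ⟨R, hR, h1⟩ := ihm
          refine ⟨k * ((z * y) * R), hk.toD.append ?_, ?_⟩
          · rw [Bool.not_not]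
            exact D.cons _ _ _ _ ((S s).mul_mem hz hy) hzy hR
          · rw [pow_succ', h1]; group
      obtain ⟨R, hR, h1⟩ := key n
      rw [h1]
      exact D.cons _ _ _ _ hy hyc hR

lemma D.pow (hA : Amal S C) {s : Bool} {g : H} (hg : D S C s s g) (n : ℕ) :
    D S C s s (g ^ (n + 1)) := by
  have := (hg.toD'.1 rfl).pow hA n 1 C.one_mem
  simpa using this

/-- Elements of the join are in `C` or reduced. -/
lemma join_cases (hA : Amal S C) {x : H} (hx : x ∈ S true ⊔ S false) :
    x ∈ C ∨ ∃ s b, D S C s b x := by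
  have step : ∀ s', ∀ y ∈ S s', ∀ g, (g ∈ C ∨ ∃ s b, D S C s b g) →
      (y * g ∈ C ∨ ∃ s b, D S C s b (y * g)) := by
    intro s' y hy g hg
    have hS : ∀ z ∈ S s', z ∈ C ∨ ∃ s b, D S C s b z := by
      intro z hz
      by_cases h : z ∈ C
      · exact Or.inl h
      · exact Or.inr ⟨s', s', D.single _ _ hz h⟩
    by_cases hyC : y ∈ C
    · rcases hg with hg | ⟨s, b, hg⟩
      · exact Or.inl (C.mul_mem hyC hg)
      · exact Or.inr ⟨s, b, hg.mulL hA.le hyC⟩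
    · rcases hg with hg | ⟨s, b, hg⟩
      · exact hS _ ((S s').mul_mem hy (hA.le _ hg))
      · by_cases hs : s = s'
        · subst hs
          cases hg with
          | single _ _ hg hgc => exact hS _ ((S s).mul_mem hy hg)
          | cons _ _ g h hg hgc hh =>
            rw [← mul_assoc]
            by_cases h1 : y * g ∈ C
            · exact Or.inr ⟨_, _, hh.mulL hA.le h1⟩
            · exact Or.inr ⟨_, _, D.cons _ _ _ _ ((S s).mul_mem hy hg) h1 hh⟩
        · have : s = !s' := by revert hs; cases s <;> cases s' <;> simp
          subst this
          exact Or.inr ⟨_, _, D.cons _ _ _ _ hy hyC hg⟩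
  have hx' : x ∈ Subgroup.closure ((S true : Set H) ∪ (S false : Set H)) := by
    rwa [Subgroup.closure_union, Subgroup.closure_eq, Subgroup.closure_eq]
  induction hx' using Subgroup.closure_induction_left with
  | one => exact Or.inl C.one_mem
  | mul_left y hy g hg ih =>
    have hg' : g ∈ S true ⊔ S false := by
      rwa [Subgroup.closure_union, Subgroup.closure_eq, Subgroup.closure_eq] at hg
    rcases hy with hy | hy
    · exact step true y hy _ (ih hg')
    · exact step false y hy _ (ih hg')
  | inv_mul_cancel y hy g hg ih =>
    have hg' : g ∈ S true ⊔ S false := by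
      rwa [Subgroup.closure_union, Subgroup.closure_eq, Subgroup.closure_eq] at hg
    rcases hy with hy | hy
    · exact step true y⁻¹ ((S true).inv_mem hy) _ (ih hg')
    · exact step false y⁻¹ ((S false).inv_mem hy) _ (ih hg')

lemma D.stripL {s b y : Bool} {x : H} (hx : D S C s b x) (hy : x ∉ S y) :
    ∃ y1 ∈ S y, ∃ z, D S C (!y) b z ∧ x = y1 * z := by
  by_cases hs : s = !y
  · subst hs
    exact ⟨1, (S y).one_mem, x, hx, by simp⟩
  · have : s = y := by revert hs; cases s <;> cases y <;> simp
    subst this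
    cases hx with
    | single _ _ hg hgc => exact absurd hg hy
    | cons _ _ g h hg hgc hh => exact ⟨g, hg, h, hh, rfl⟩

lemma D.strip {s b y : Bool} {x : H} (hx : D S C s b x) (hy : x ∉ S y) :
    ∃ y1 ∈ S y, ∃ y2 ∈ S y, ∃ z, D S C (!y) (!y) z ∧ x = y1 * z * y2 := by
  obtain ⟨y1, hy1, z, hz, rfl⟩ := hx.stripL hy
  have hz2 : z ∉ S y := fun h => hy ((S y).mul_mem hy1 h)
  obtain ⟨y2, hy2, z', hz', h1⟩ := hz.inv.stripL (fun h => hz2 (by simpa using h))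
  refine ⟨y1, hy1, y2⁻¹, (S y).inv_mem hy2, z'⁻¹, hz'.inv, ?_⟩
  have : z = z'⁻¹ * y2⁻¹ := by rw [← mul_inv_rev, ← h1, inv_inv]
  rw [this]; group

/-- Case of a single syllable. -/
lemma amal_lrf_single (hA : Amal S C) {y : Bool} {z : H} (hz : z ∈ S (!y)) (hzC : z ∉ C) :
    LRF (S y) z := by
  have hU : ∀ L : List (Bool × H), (∀ v ∈ L, v.2 ∈ C) → wprod z L ∈ S (!y) := by
    intro L hL
    induction L with
    | nil => simpa using (S (!y)).one_mem
    | cons v L ih =>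
      rw [wprod_cons]
      refine (S (!y)).mul_mem ((S (!y)).mul_mem ?_ (hA.le _ (hL v (by simp))))
        (ih (fun v hv => hL v (by simp [hv])))
      cases v.1 <;> simp [hz]
  refine lrf_of_inv (fun e g => ∃ v L R, v.1 = e ∧ (∀ u ∈ v :: L, u.2 ∈ C) ∧
    (v :: L).IsChain (fun y z => y.1 ≠ z.1 → y.2 ≠ 1) ∧ (R = 1 ∨ ∃ b, D S C y b R) ∧
    g = wprod z (v :: L) * R) ?_ ?_ ?_
  · intro e c hc
    by_cases hcC : c ∈ C
    · exact ⟨(e, c), [], 1, rfl, by simpa using hcC, by simp, Or.inl rfl, by simp⟩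
    · exact ⟨(e, 1), [], c, rfl, by simpa using C.one_mem, by simp,
        Or.inr ⟨y, D.single _ _ hc hcC⟩, by simp⟩
  · rintro e e' c hc g hne ⟨v, L, R, rfl, hL, hch, hR, rfl⟩
    by_cases hcC : c ∈ C
    · refine ⟨(e, c), v :: L, R, rfl, ?_, ?_, hR, ?_⟩
      · intro u hu
        rcases List.mem_cons.1 hu with rfl | hu
        · exact hcC
        · exact hL u hu
      · rw [List.isChain_cons_cons]
        exact ⟨hne, hch⟩
      · rw [wprod_cons z (e, c)]; group
    · have h1 : wprod z (v :: L) ∈ S (!y) := hU _ hL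
      have h2 := (hA.lrf _ z hz hzC).not_mem (v :: L) (by simp) hL hch
      refine ⟨(e, 1), [], c * (wprod z (v :: L) * R), rfl, by simpa using C.one_mem, by simp,
        Or.inr ?_, ?_⟩
      · rcases hR with rfl | ⟨b, hR⟩
        · exact ⟨!y, D.cons _ _ _ _ hc hcC (by rw [mul_one]; exact D.single _ _ h1 h2)⟩
        · exact ⟨b, D.cons _ _ _ _ hc hcC (D.cons _ _ _ _ h1 h2 (by simpa using hR))⟩
      · simp [mul_assoc]
  · rintro e g ⟨v, L, R, rfl, hL, hch, hR, rfl⟩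
    have h1 : wprod z (v :: L) ∈ S (!y) := hU _ hL
    have h2 := (hA.lrf _ z hz hzC).not_mem (v :: L) (by simp) hL hch
    rcases hR with rfl | ⟨b, hR⟩
    · rw [mul_one]
      exact hA.nf _ _ _ (D.single _ _ h1 h2)
    · exact hA.nf _ _ _ (D.cons _ _ _ _ h1 h2 (by simpa using hR))

/-- Case where the two ends do not cancel. -/
lemma amal_lrf_long (hA : Amal S C) {y : Bool} {z1 m zr : H} (hz1 : z1 ∈ S (!y)) (hz1C : z1 ∉ C)
    (hzr : zr ∈ S (!y)) (hzrC : zr ∉ C) (hm : D S C y y m)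
    (hnc : ∀ c ∈ C, zr * c * z1 ∉ C) :
    LRF (S y) (z1 * m * zr) := by
  -- `ζ e` is the initial syllable of `x^e`, `η e` the final one
  let ζ : Bool → H := fun e => if e then z1 else zr⁻¹
  let η : Bool → H := fun e => if e then zr else z1⁻¹
  let μ : Bool → H := fun e => if e then m else m⁻¹
  have hx : ∀ e, sg (z1 * m * zr) e = ζ e * μ e * η e := by
    intro e; cases e <;> simp [ζ, η, μ, mul_assoc]
  have hζ : ∀ e, ζ e ∈ S (!y) := by intro e; cases e <;> simp [ζ, hz1, hzr]
  have hη : ∀ e, η e ∈ S (!y) := by intro e; cases e <;> simp [η, hz1, hzr]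
  have hζC : ∀ e, ζ e ∉ C := by intro e; cases e <;> simp [ζ, hz1C, hzrC]
  have hηC : ∀ e, η e ∉ C := by intro e; cases e <;> simp [η, hz1C, hzrC]
  have hμ : ∀ e, D S C y y (μ e) := by
    intro e; cases e
    · exact hm.inv
    · exact hm
  have hbr : ∀ e e', ∀ c ∈ S y, (e ≠ e' → c ≠ 1) → D S C (!y) (!y) (η e * c * ζ e') := by
    intro e e' c hc hne
    by_cases hcC : c ∈ C
    · refine D.single _ _ ((S (!y)).mul_mem ((S (!y)).mul_mem (hη e) (hA.le _ hcC)) (hζ e')) ?_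
      cases e <;> cases e'
      · intro h
        apply hnc _ (C.inv_mem hcC)
        have := C.inv_mem h
        simpa [ζ, η, mul_assoc] using this
      · exact (hA.lrf _ z1 hz1 hz1C).malnormal' hcC (hne (by simp))
      · exact (hA.lrf _ zr hzr hzrC).malnormal hcC (hne (by simp))
      · exact hnc c hcC
    · rw [mul_assoc]
      refine D.cons _ _ _ _ (hη e) (hηC e) (D.cons _ _ _ _ (by simpa using hc) hcC ?_)
      rw [Bool.not_not]
      exact D.single _ _ (hζ e') (hζC e')
  refine lrf_of_inv (fun e g => ∃ b R, D S C y b R ∧ g = ζ e * R) ?_ ?_ ?_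
  · intro e c hc
    rw [hx]
    have h1 : D S C y (!y) (μ e * η e) := (hμ e).append (D.single _ _ (hη e) (hηC e))
    by_cases hcC : c ∈ C
    · exact ⟨!y, μ e * η e * c, h1.mulR hA.le hcC, by group⟩
    · refine ⟨y, μ e * η e * c, h1.append ?_, by group⟩
      rw [Bool.not_not]
      exact D.single _ _ hc hcC
  · rintro e e' c hc g hne ⟨b, R, hR, rfl⟩
    rw [hx]
    refine ⟨b, μ e * (η e * c * ζ e' * R), (hμ e).append ((hbr e e' c hc hne).append ?_), by group⟩
    rw [Bool.not_not]
    exact hR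
  · rintro e g ⟨b, R, hR, rfl⟩
    refine hA.nf (!y) b _ (D.cons _ _ _ _ (hζ e) (hζC e) ?_)
    rw [Bool.not_not]; exact hR

/-- Conjugate case. -/
lemma amal_lrf_conj (hA : Amal S C) {y : Bool} {z m : H} (hz : z ∈ S (!y)) (hzC : z ∉ C)
    (hm : D S C y y m) : LRF (S y) (z * m * z⁻¹) := by
  have hpow : ∀ e n, D S C y y ((sg m e) ^ (n+1)) := by
    intro e n
    cases e
    · exact hm.inv.pow hA n
    · exact hm.pow hA n
  have hx : ∀ e, sg (z * m * z⁻¹) e = z * sg m e * z⁻¹ := by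
    intro e; cases e <;> simp [mul_assoc]
  have hz' : z⁻¹ ∈ S (!y) := (S (!y)).inv_mem hz
  have hzC' : z⁻¹ ∉ C := by simpa using hzC
  refine lrf_of_inv (fun e g => ∃ n b R, D S C (!y) b R ∧ g = z * (sg m e) ^ (n+1) * R) ?_ ?_ ?_
  · intro e c hc
    rw [hx]
    by_cases hcC : c ∈ C
    · exact ⟨0, !y, z⁻¹ * c, (D.single _ _ hz' hzC').mulR hA.le hcC, by simp [mul_assoc]⟩
    · refine ⟨0, y, z⁻¹ * c, D.cons _ _ _ _ hz' hzC' ?_, by simp [mul_assoc]⟩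
      rw [Bool.not_not]
      exact D.single _ _ hc hcC
  · rintro e e' c hc g hne ⟨n, b, R, hR, rfl⟩
    rw [hx]
    by_cases hc1 : c = 1
    · have : e = e' := by by_contra h; exact hne h hc1
      subst this
      subst hc1
      refine ⟨n+1, b, R, hR, ?_⟩
      rw [pow_succ' _ (n+1)]; group
    · refine ⟨0, b, (z⁻¹ * c * z) * ((sg m e')^(n+1) * R), ?_, by simp [mul_assoc]⟩
      have h1 : D S C (!y) (!y) (z⁻¹ * c * z) := by
        by_cases hcC : c ∈ C
        · exact D.single _ _ ((S (!y)).mul_mem ((S (!y)).mul_mem hz' (hA.le _ hcC)) hz)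
            ((hA.lrf _ z hz hzC).malnormal' hcC hc1)
        · rw [mul_assoc]
          refine D.cons _ _ _ _ hz' hzC' (D.cons _ _ _ _ (by simpa using hc) hcC ?_)
          rw [Bool.not_not]
          exact D.single _ _ hz hzC
      refine h1.append ?_
      rw [Bool.not_not]
      exact (hpow e' n).append hR
  · rintro e g ⟨n, b, R, hR, rfl⟩
    rw [mul_assoc]
    refine hA.nf (!y) b _ (D.cons _ _ _ _ hz hzC ?_)
    rw [Bool.not_not]
    exact (hpow e n).append hR

theorem amal_lrf (hA : Amal S C) {y : Bool} {x : H} (hx : x ∈ S true ⊔ S false) (hxy : x ∉ S y) :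
    LRF (S y) x := by
  rcases join_cases hA hx with h | ⟨s, b, h⟩
  · exact absurd (hA.le y h) hxy
  obtain ⟨y1, hy1, y2, hy2, z, hz, rfl⟩ := h.strip hxy
  refine LRF.two_sided ?_ hy1 hy2
  have hz' := hz.toD'.1 rfl
  cases hz' with
  | single _ _ hg hc => exact amal_lrf_single hA hg hc
  | wrap _ z1 m zr hg hgc hh hhc hk =>
    have hm : D S C y y m := by simpa using hk.toD
    by_cases hnc : ∀ c ∈ C, zr * c * z1 ∉ C
    · exact amal_lrf_long hA hg hgc hh hhc hm hnc
    · push Not at hnc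
      obtain ⟨c, hc, hcc⟩ := hnc
      have h1 := amal_lrf_conj hA hg hgc (hm.mulR hA.le hcc)
      have h2 := h1.mul_right (hA.le y (C.inv_mem hc))
      convert h2 using 1
      group

end Amalgam
end Kly

namespace Kly

variable {H : Type*} [Group H]

/-- Reduced `t`-words with prescribed first and last letter. -/
inductive E (A CN : Subgroup H) (t : H) : Bool → Bool → H → Prop
  | single (s : Bool) (a : H) (ha : a ∈ A) : E A CN t s s (sg t s * a)
  | cons (s s' b : Bool) (a h : H) (ha : a ∈ A) (hs : s ≠ s' → ¬ inC t CN s a)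
      (hh : E A CN t s' b h) : E A CN t s b (sg t s * a * h)

/-- Same, with a left coefficient. -/
def Dir (A CN : Subgroup H) (t : H) (s b : Bool) (g : H) : Prop :=
  ∃ a ∈ A, ∃ h, E A CN t s b h ∧ g = a * h

variable {A CN : Subgroup H} {t : H}

lemma E.mulR {s b : Bool} {g a : H} (hg : E A CN t s b g) (ha : a ∈ A) :
    E A CN t s b (g * a) := by
  induction hg with
  | single s a' ha' => rw [mul_assoc]; exact E.single _ _ (A.mul_mem ha' ha)
  | cons s s' b a' h ha' hs _ ih => rw [mul_assoc]; exact E.cons _ _ _ _ _ ha' hs ih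

lemma E.append {s b b' : Bool} {g h : H} (hg : E A CN t s b g) (hh : E A CN t b b' h) :
    E A CN t s b' (g * h) := by
  induction hg with
  | single s a' ha' => exact E.cons _ _ _ _ _ ha' (fun h => absurd rfl h) hh
  | cons s s' b a' k ha' hs _ ih => rw [mul_assoc]; exact E.cons _ _ _ _ _ ha' hs (ih hh)

lemma E.toList {s b : Bool} {g : H} (hg : E A CN t s b g) :
    ∃ x L, x.1 = s ∧ (∀ y ∈ x :: L, y.2 ∈ A) ∧
      (x :: L).IsChain (fun x y => x.1 ≠ y.1 → ¬ inC t CN x.1 x.2) ∧ g = wprod t (x :: L) := by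
  induction hg with
  | single s a ha => exact ⟨(s, a), [], rfl, by simpa using ha, by simp, by simp⟩
  | cons s s' b a h ha hs _ ih =>
    obtain ⟨x, L, rfl, h1, h2, rfl⟩ := ih
    refine ⟨(s, a), x :: L, rfl, ?_, ?_, by simp⟩
    · intro y hy
      rcases List.mem_cons.1 hy with rfl | hy
      · exact ha
      · exact h1 y hy
    · rw [List.isChain_cons_cons]
      exact ⟨hs, h2⟩

lemma E.ne_one (hyp : Hyp A CN t) {s b : Bool} {g : H} (hg : E A CN t s b g) : g ≠ 1 := by
  obtain ⟨x, L, -, h1, h2, rfl⟩ := hg.toList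
  exact hyp.brit _ (by simp) h1 h2

lemma E.not_mem (hyp : Hyp A CN t) {s b : Bool} {g : H} (hg : E A CN t s b g) : g ∉ A := by
  intro h
  have := (hg.mulR (A.inv_mem h)).ne_one hyp
  simp at this

lemma E.toDir {s b : Bool} {g : H} (hg : E A CN t s b g) : Dir A CN t s b g :=
  ⟨1, A.one_mem, g, hg, by simp⟩

lemma Dir.mulL {s b : Bool} {g a : H} (hg : Dir A CN t s b g) (ha : a ∈ A) :
    Dir A CN t s b (a * g) := by
  obtain ⟨a', ha', h, hh, rfl⟩ := hg
  exact ⟨a * a', A.mul_mem ha ha', h, hh, by group⟩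

lemma Dir.mulR {s b : Bool} {g a : H} (hg : Dir A CN t s b g) (ha : a ∈ A) :
    Dir A CN t s b (g * a) := by
  obtain ⟨a', ha', h, hh, rfl⟩ := hg
  exact ⟨a', ha', h * a, hh.mulR ha, by group⟩

lemma Dir.append {s b b' : Bool} {g h : H} (hg : Dir A CN t s b g) (hh : Dir A CN t b b' h) :
    Dir A CN t s b' (g * h) := by
  obtain ⟨a', ha', g', hg', rfl⟩ := hg
  obtain ⟨a, ha, h', hh', rfl⟩ := hh
  exact ⟨a', ha', g' * a * h', (hg'.mulR ha).append hh', by group⟩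

lemma Dir.not_mem (hyp : Hyp A CN t) {s b : Bool} {g : H} (hg : Dir A CN t s b g) : g ∉ A := by
  obtain ⟨a', ha', g', hg', rfl⟩ := hg
  intro h
  exact hg'.not_mem hyp ((A.mul_mem_cancel_left ha').1 h)

/-- The conjugate `t A t⁻¹`. -/
def cj (t : H) (A : Subgroup H) : Subgroup H := A.map (MulAut.conj t).toMonoidHom

lemma mem_cj {x : H} : x ∈ cj t A ↔ t⁻¹ * x * t ∈ A := by
  constructor
  · rintro ⟨a, ha, rfl⟩
    simpa [mul_assoc] using ha
  · intro h
    exact ⟨_, h, by simp [mul_assoc]⟩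

lemma conj_mem_cj {x : H} : t * x * t⁻¹ ∈ cj t A ↔ x ∈ A := by
  rw [mem_cj]; simp [mul_assoc]

/-- The two factors. -/
def SS (A : Subgroup H) (t : H) (b : Bool) : Subgroup H := if b then A else cj t A

lemma D_dir (hyp : Hyp A CN t) {s b : Bool} {g : H} (hg : D (SS A t) CN s b g) :
    (s = true → E A CN t false false (t⁻¹ * g) ∧ E A CN t false true (t⁻¹ * g * t) ∧
      Dir A CN t true true (g * t) ∧ (g ∈ A ∨ Dir A CN t true false g)) ∧
    (s = false → E A CN t true true (g * t) ∧ E A CN t true false g ∧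
      Dir A CN t false false (t⁻¹ * g) ∧
      (t⁻¹ * g * t ∈ A ∨ Dir A CN t false true (t⁻¹ * g * t))) := by
  have e1 : E A CN t true true t := by simpa using E.single (CN := CN) (t := t) true 1 A.one_mem
  have e2 : E A CN t false false t⁻¹ := by
    simpa using E.single (CN := CN) (t := t) false 1 A.one_mem
  induction hg with
  | single s g hg hc =>
    constructor
    · rintro rfl
      have hgA : g ∈ A := hg
      refine ⟨E.single false g hgA, ?_, ?_, Or.inl hgA⟩
      · exact E.cons false true true g t hgA (fun _ => by simpa using hc) e1
      · exact e1.toDir.mulL hgA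
    · rintro rfl
      have hgA : t⁻¹ * g * t ∈ A := mem_cj.1 hg
      refine ⟨?_, ?_, ?_, Or.inl hgA⟩
      · have := E.single (CN := CN) (t := t) true _ hgA
        simpa [mul_assoc] using this
      · have := E.cons true false false _ _ hgA (fun _ => by simpa [mul_assoc] using hc) e2
        simpa [mul_assoc] using this
      · have := e2.toDir.mulL hgA
        simpa [mul_assoc] using this
  | cons s b g h hg hc hh ih =>
    constructor
    · rintro rfl
      have hgA : g ∈ A := hg
      obtain ⟨h1, h2, h3, h4⟩ := ih.2 rfl
      refine ⟨?_, ?_, ?_, Or.inr (h2.toDir.mulL hgA)⟩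
      · rw [← mul_assoc]
        exact E.cons false true false g h hgA (fun _ => by simpa using hc) h2
      · have := E.cons false true true g _ hgA (fun _ => by simpa using hc) h1
        simpa [mul_assoc] using this
      · rw [mul_assoc]; exact h1.toDir.mulL hgA
    · rintro rfl
      have hgA : t⁻¹ * g * t ∈ A := mem_cj.1 hg
      obtain ⟨h1, h2, h3, h4⟩ := ih.1 rfl
      refine ⟨?_, ?_, ?_, Or.inr ?_⟩
      · have := E.cons true false true _ _ hgA (fun _ => by simpa [mul_assoc] using hc) h2
        simpa [mul_assoc] using this
      · have := E.cons true false false _ _ hgA (fun _ => by simpa [mul_assoc] using hc) h1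
        simpa [mul_assoc] using this
      · have := h1.toDir.mulL hgA
        simpa [mul_assoc] using this
      · have := h2.toDir.mulL hgA
        simpa [mul_assoc] using this

lemma amal_of_hyp (hyp : Hyp A CN t) : Amal (SS A t) CN := by
  refine ⟨?_, ?_, ?_⟩
  · intro b
    cases b
    · intro c hc; exact mem_cj.2 (hyp.cp_le c hc)
    · exact hyp.cn_le
  · intro s b g hg h1
    subst h1
    cases s
    · have := ((D_dir hyp hg).2 rfl).2.1.ne_one hyp
      simp at this
    · have := ((D_dir hyp hg).1 rfl).2.1.ne_one hyp
      simp at this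
  · intro b z hz hzC
    cases b
    · have hgA : t⁻¹ * z * t ∈ A := mem_cj.1 hz
      have := hyp.rfP _ hgA (by simpa [mul_assoc] using hzC)
      simpa [mul_assoc] using this
    · exact hyp.rfN z hz hzC

lemma join_dir (hyp : Hyp A CN t) {g : H} (hg : g ∈ A ⊔ cj t A) :
    Dir A CN t true true (g * t) ∧ Dir A CN t false false (t⁻¹ * g) ∧
    (g ∈ A ∨ Dir A CN t true false g) ∧ (g ∈ cj t A ∨ Dir A CN t false true (t⁻¹ * g * t)) := by
  rcases join_cases (amal_of_hyp hyp) hg with h | ⟨s, b, h⟩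
  · have e1 : E A CN t true true t := by simpa using E.single (CN := CN) (t := t) true 1 A.one_mem
    exact ⟨e1.toDir.mulL (hyp.cn_le h), (E.single false g (hyp.cn_le h)).toDir,
      Or.inl (hyp.cn_le h), Or.inl (mem_cj.2 (hyp.cp_le _ h))⟩
  · cases s
    · obtain ⟨h1, h2, h3, h4⟩ := (D_dir hyp h).2 rfl
      exact ⟨h1.toDir, h3, Or.inr h2.toDir, h4.imp mem_cj.2 id⟩
    · obtain ⟨h1, h2, h3, h4⟩ := (D_dir hyp h).1 rfl
      exact ⟨h3, h1.toDir, h4, Or.inr h2.toDir⟩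

theorem Hyp.step (hyp : Hyp A CN t) : Hyp (A ⊔ cj t A) (cj t A) t := by
  have e1 : E A CN t true true t := by simpa using E.single (CN := CN) (t := t) true 1 A.one_mem
  have e2 : E A CN t false false t⁻¹ := by
    simpa using E.single (CN := CN) (t := t) false 1 A.one_mem
  refine ⟨le_sup_right, ?_, ?_, ?_, ?_, ?_⟩
  · intro c hc
    exact Subgroup.mem_sup_left (mem_cj.1 hc)
  · have claim : ∀ L : List (Bool × H), ∀ x, (∀ y ∈ x :: L, y.2 ∈ A ⊔ cj t A) →
        (x :: L).IsChain (fun x y => x.1 ≠ y.1 → ¬ inC t (cj t A) x.1 x.2) →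
        (x.1 = false → ∃ b, Dir A CN t false b (wprod t (x :: L))) ∧
        (x.1 = true → t⁻¹ * wprod t (x :: L) ∈ A ∨
          ∃ b, Dir A CN t true b (t⁻¹ * wprod t (x :: L))) := by
      intro L
      induction L with
      | nil =>
        rintro ⟨s, h⟩ hx _
        obtain ⟨h1, h2, h3, h4⟩ := join_dir hyp (hx (s, h) (by simp))
        constructor
        · intro hs
          simp only at hs; subst hs
          exact ⟨false, by simpa using h2⟩
        · intro hs
          simp only at hs; subst hs
          have e3 : t⁻¹ * wprod t [(true, h)] = h := by simp
          rw [e3]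
          exact h3.imp id (fun h => ⟨false, h⟩)
      | cons y L ih =>
        rintro ⟨s, h⟩ hx hch
        obtain ⟨h1, h2, h3, h4⟩ := join_dir hyp (hx (s, h) (by simp))
        rw [List.isChain_cons_cons] at hch
        obtain ⟨ih1, ih2⟩ := ih y (fun z hz => hx z (List.mem_cons_of_mem _ hz)) hch.2
        have hin := hch.1
        rw [wprod_cons _ (s, h)]
        generalize wprod t (y :: L) = g' at *
        obtain ⟨s', h'⟩ := y
        simp only at *
        constructor
        · rintro rfl
          cases s'
          · obtain ⟨b, hb⟩ := ih1 rfl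
            exact ⟨b, h2.append hb⟩
          · have h5 : Dir A CN t false true (t⁻¹ * h * t) := by
              rcases h4 with h4 | h4
              · exact absurd h4 (by simpa using hin (by simp))
              · exact h4
            have : sg t false * h * g' = (t⁻¹ * h * t) * (t⁻¹ * g') := by simp [mul_assoc]
            rw [this]
            rcases ih2 rfl with h6 | ⟨b, h6⟩
            · exact ⟨true, h5.mulR h6⟩
            · exact ⟨b, h5.append h6⟩
        · rintro rfl
          right
          cases s'
          · have h5 : Dir A CN t true false h := by
              rcases h3 with h3 | h3
              · refine absurd h3 ?_
                have := hin (by simp)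
                rwa [inC_true, conj_mem_cj] at this
              · exact h3
            obtain ⟨b, hb⟩ := ih1 rfl
            refine ⟨b, ?_⟩
            have := h5.append hb
            simpa [mul_assoc] using this
          · have : t⁻¹ * (sg t true * h * g') = (h * t) * (t⁻¹ * g') := by simp [mul_assoc]
            rw [this]
            rcases ih2 rfl with h6 | ⟨b, h6⟩
            · exact ⟨true, h1.mulR h6⟩
            · exact ⟨b, h1.append h6⟩
    intro L hne hL hch h1
    obtain ⟨x, L, rfl⟩ := List.exists_cons_of_ne_nil hne
    obtain ⟨c1, c2⟩ := claim L x hL hch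
    rw [h1] at c1 c2
    cases hx : x.1
    · obtain ⟨b, hb⟩ := c1 hx
      exact hb.not_mem hyp A.one_mem
    · rw [mul_one] at c2
      rcases c2 hx with h2 | ⟨b, a, ha, h, hh, h3⟩
      · exact e2.not_mem hyp h2
      · have := ((e1.mulR ha).append hh).ne_one hyp
        apply this
        rw [mul_assoc, ← h3]; simp
  · intro a ha hna
    exact amal_lrf (amal_of_hyp hyp) (y := false) ha hna
  · intro a ha hna
    rw [conj_mem_cj] at hna
    exact (amal_lrf (amal_of_hyp hyp) (y := true) ha hna).conj t
  · rw [eq_top_iff, ← hyp.gen]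
    apply Subgroup.closure_mono
    rintro x (hx | hx)
    · exact Or.inl (Subgroup.mem_sup_left hx)
    · exact Or.inr hx

end Kly

namespace Kly

variable {H : Type*} [Group H] {A CN : Subgroup H} {t : H}

/-- The ascending chain of subgroups. -/
def Am (t : H) (A : Subgroup H) : ℕ → Subgroup H
  | 0 => A
  | m + 1 => Am t A m ⊔ cj t (Am t A m)

lemma Am_mono_succ (m : ℕ) : Am t A m ≤ Am t A (m+1) := le_sup_left

lemma Am_mono {m n : ℕ} (h : m ≤ n) : Am t A m ≤ Am t A n :=
  monotone_nat_of_le_succ (fun m => Am_mono_succ m) h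

lemma Am_conj {m : ℕ} {x : H} (hx : x ∈ Am t A m) : t * x * t⁻¹ ∈ Am t A (m+1) :=
  Subgroup.mem_sup_right (conj_mem_cj.2 hx)

lemma Am_conj_pow {x : H} (hx : x ∈ A) (i : ℕ) : t ^ i * x * (t ^ i)⁻¹ ∈ Am t A i := by
  induction i with
  | zero => simpa [Am] using hx
  | succ i ih =>
    have := Am_conj ih
    convert this using 1
    rw [pow_succ']; group

lemma hyp_Am (hyp : Hyp A CN t) : ∀ m, ∃ CN', Hyp (Am t A m) CN' t
  | 0 => ⟨CN, hyp⟩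
  | m + 1 => by
    obtain ⟨CN', h⟩ := hyp_Am hyp m
    exact ⟨_, h.step⟩

lemma form_ij (hyp : Hyp A CN t) (h : H) :
    ∃ i j m : ℕ, ∃ x ∈ Am t A m, h = (t ^ i)⁻¹ * x * t ^ j := by
  have hh : h ∈ Subgroup.closure ((A : Set H) ∪ {t}) := by rw [hyp.gen]; trivial
  have stepA : ∀ a ∈ A, ∀ g, (∃ i j m : ℕ, ∃ x ∈ Am t A m, g = (t ^ i)⁻¹ * x * t ^ j) →
      (∃ i j m : ℕ, ∃ x ∈ Am t A m, a * g = (t ^ i)⁻¹ * x * t ^ j) := by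
    rintro a ha g ⟨i, j, m, x, hx, rfl⟩
    refine ⟨i, j, max i m, (t ^ i * a * (t ^ i)⁻¹) * x, Subgroup.mul_mem _
      (Am_mono (le_max_left _ _) (Am_conj_pow ha i)) (Am_mono (le_max_right _ _) hx), by group⟩
  induction hh using Subgroup.closure_induction_left with
  | one => exact ⟨0, 0, 0, 1, Subgroup.one_mem _, by simp⟩
  | mul_left y hy g hg ih =>
    rcases hy with hy | hy
    · exact stepA y hy g ih
    · rw [Set.mem_singleton_iff] at hy
      subst hy
      obtain ⟨i, j, m, x, hx, rfl⟩ := ih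
      cases i with
      | zero =>
        refine ⟨0, j + 1, m + 1, y * x * y⁻¹, Am_conj hx, ?_⟩
        rw [pow_succ']; simp [mul_assoc]
      | succ i => exact ⟨i, j, m, x, hx, by rw [pow_succ]; simp [mul_assoc]⟩
  | inv_mul_cancel y hy g hg ih =>
    rcases hy with hy | hy
    · exact stepA y⁻¹ (A.inv_mem hy) g ih
    · rw [Set.mem_singleton_iff] at hy
      subst hy
      obtain ⟨i, j, m, x, hx, rfl⟩ := ih
      exact ⟨i+1, j, m, x, hx, by rw [pow_succ]; simp [mul_assoc]⟩

lemma isConj_of_mul (u g h : H) (e : u * g * u⁻¹ = h) : IsConj g h := isConj_iff.2 ⟨u, e⟩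

lemma conj_xt (hyp : Hyp A CN t) (p : H →* Multiplicative ℤ) (hpt : p t = Multiplicative.ofAdd 1)
    (hpA : ∀ a ∈ A, p a = 1) (w : H) (hw : p w = Multiplicative.ofAdd 1) :
    ∃ m, ∃ x ∈ Am t A m, IsConj (x * t) w := by
  obtain ⟨i, j, m, x, hx, rfl⟩ := form_ij hyp w
  have hpx : ∀ m, Am t A m ≤ p.ker := by
    intro m
    induction m with
    | zero => intro a ha; exact hpA a ha
    | succ m ih =>
      refine sup_le ih ?_
      rintro _ ⟨a, ha, rfl⟩
      have := MonoidHom.mem_ker.1 (ih ha)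
      rw [MonoidHom.mem_ker]
      simp [this]
  have hx1 : p x = 1 := hpx m hx
  simp only [map_mul, map_inv, map_pow, hpt, hx1] at hw
  have hij : j = i + 1 := by
    have h2 := congrArg Multiplicative.toAdd hw
    simp at h2
    omega
  subst hij
  exact ⟨m, x, hx, isConj_of_mul (t^i)⁻¹ _ _ (by rw [pow_succ']; group)⟩

lemma word_form1 (hyp : Hyp A CN t) {x : H} (hx : x ∈ A ⊔ cj t A)
    (hno : ∀ b ∈ A, ¬ IsConj (b * t) (x * t)) :
    ∃ y b, D (SS A t) CN false true y ∧ b ∈ A ∧ IsConj (x * t) (y * (t * b)) := by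
  have hfalse : ∀ z c b, D (SS A t) CN false c z → b ∈ A → IsConj (x * t) (z * (t * b)) →
      ∃ y b, D (SS A t) CN false true y ∧ b ∈ A ∧ IsConj (x * t) (y * (t * b)) := by
    intro z c b hz hb hc
    cases c
    · cases hz.toD'.1 rfl with
      | single _ _ hg hgc =>
        exfalso
        have h1 : t⁻¹ * z * t ∈ A := mem_cj.1 hg
        refine hno ((t⁻¹ * z * t) * b) (A.mul_mem h1 hb) ?_
        refine IsConj.trans (isConj_of_mul t _ _ ?_) hc.symm
        group
      | wrap _ g k h hg hgc hh hhc hk =>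
        have h1 : t⁻¹ * h * t ∈ A := mem_cj.1 hh
        refine ⟨g * k, (t⁻¹ * h * t) * b, D.cons _ _ _ _ hg hgc hk.toD, A.mul_mem h1 hb, ?_⟩
        convert hc using 1
        group
    · exact ⟨z, b, hz, hb, hc⟩
  rcases join_cases (amal_of_hyp hyp) hx with h | ⟨s, c, h⟩
  · exact absurd (IsConj.refl _) (hno x (hyp.cn_le h))
  cases s
  · exact hfalse x c 1 h A.one_mem (by rw [mul_one])
  · cases h with
    | single _ _ hg hgc => exact absurd (IsConj.refl _) (hno x hg)
    | cons _ _ g h hg hgc hh =>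
      refine hfalse h c g hh hg (isConj_of_mul g⁻¹ _ _ (by group))

lemma D_tau {S : Bool → Subgroup H} {s b : Bool} {y : H} (hy : D S CN s b y) :
    ∃ n, ∃ τ : ℕ → H, y = ((List.range (n+1)).map τ).prod ∧
      (∀ i ≤ n, τ i ∈ S (xor s (decide (i % 2 = 1))) ∧ τ i ∉ CN) ∧
      b = xor s (decide (n % 2 = 1)) := by
  induction hy with
  | single s g hg hc =>
    refine ⟨0, fun _ => g, by simp, ?_, by simp⟩
    intro i hi
    obtain rfl : i = 0 := by omega
    simpa using ⟨hg, hc⟩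
  | cons s b g h hg hc _ ih =>
    obtain ⟨n, τ, rfl, h1, rfl⟩ := ih
    refine ⟨n+1, fun i => Nat.casesOn i g τ, ?_, ?_, ?_⟩
    · rw [List.range_succ_eq_map (n := n+1), List.map_cons, List.prod_cons, List.map_map]
      rfl
    · intro i hi
      cases i with
      | zero => simpa using ⟨hg, hc⟩
      | succ i =>
        have := h1 i (by omega)
        convert this using 3
        rcases Nat.mod_two_eq_zero_or_one i with h | h
        · have : (i+1) % 2 = 1 := by omega
          simp [h, this]
        · have : (i+1) % 2 = 0 := by omega
          simp [h, this]
    · rcases Nat.mod_two_eq_zero_or_one n with h | h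
      · have : (n+1) % 2 = 1 := by omega
        simp [h, this]
      · have : (n+1) % 2 = 0 := by omega
        simp [h, this]

/-- The data for the core argument. -/
structure Tau (A CN : Subgroup H) (t : H) (k : ℕ) (τ : ℕ → H) : Prop where
  hk : 1 ≤ k
  even : ∀ i < 2 * k, i % 2 = 0 → τ i ∈ cj t A
  odd : ∀ i < 2 * k, i % 2 = 1 → τ i ∈ A
  nc : ∀ i < 2 * k, τ i ∉ CN
  last : t⁻¹ * τ (2 * k) ∈ A

lemma Tau.lrf (hyp : Hyp A CN t) {k : ℕ} {τ : ℕ → H} (h : Tau A CN t k τ) {i : ℕ}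
    (hi : i < 2 * k) : LRF CN (τ i) := by
  rcases Nat.mod_two_eq_zero_or_one i with h1 | h1
  · exact (amal_of_hyp hyp).lrf false _ (h.even i hi h1) (h.nc i hi)
  · exact (amal_of_hyp hyp).lrf true _ (h.odd i hi h1) (h.nc i hi)

lemma word_form2 (hyp : Hyp A CN t) {x : H} (hx : x ∈ A ⊔ cj t A)
    (hno : ∀ b ∈ A, ¬ IsConj (b * t) (x * t)) :
    ∃ k τ, Tau A CN t k τ ∧ IsConj (x * t) (((List.range (2 * k + 1)).map τ).prod) := by
  obtain ⟨y, b, hy, hb, hc⟩ := word_form1 hyp hx hno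
  obtain ⟨n, τ, rfl, h1, h2⟩ := D_tau hy
  simp at h2
  obtain ⟨k, hk⟩ : ∃ k, n + 1 = 2 * k := ⟨(n+1)/2, by omega⟩
  refine ⟨k, fun i => if i = 2 * k then t * b else τ i, ⟨by omega, ?_, ?_, ?_, ?_⟩, ?_⟩
  · intro i hi he
    have := (h1 i (by omega)).1
    simp only [he] at this
    simp only [if_neg (show i ≠ 2 * k by omega)]
    exact this
  · intro i hi he
    have := (h1 i (by omega)).1
    simp only [he] at this
    simp only [if_neg (show i ≠ 2 * k by omega)]
    exact this
  · intro i hi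
    simp only [if_neg (show i ≠ 2 * k by omega)]
    exact (h1 i (by omega)).2
  · simpa using hb
  · convert hc using 1
    rw [List.range_succ, List.map_append, List.prod_append, hk]
    congr 1
    · congr 1
      apply List.map_congr_left
      intro i hi
      rw [List.mem_range] at hi
      simp only [if_neg (show i ≠ 2 * k by omega)]
    · simp

/-- Reduction of a general word to the standard form. -/
theorem word_form (hyp : Hyp A CN t) (p : H →* Multiplicative ℤ)
    (hpt : p t = Multiplicative.ofAdd 1)
    (hpA : ∀ a ∈ A, p a = 1) (w : H) (hw : p w = Multiplicative.ofAdd 1)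
    (hno : ∀ a ∈ A, ¬ IsConj (a * t) w) :
    ∃ (B CB : Subgroup H) (k : ℕ) (τ : ℕ → H), A ≤ B ∧ Hyp B CB t ∧ Tau B CB t k τ ∧
      IsConj w (((List.range (2 * k + 1)).map τ).prod) := by
  classical
  have hex := conj_xt hyp p hpt hpA w hw
  obtain ⟨x, hx, hc⟩ := Nat.find_spec hex
  have hmin := fun m => Nat.find_min hex (m := m)
  generalize Nat.find hex = m at *
  cases m with
  | zero => exact absurd hc (hno x hx)
  | succ m =>
    obtain ⟨CB, hB⟩ := hyp_Am hyp m
    obtain ⟨k, τ, h1, h2⟩ := word_form2 hB hx (by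
      intro b hb hcb
      exact hmin m (by omega) ⟨b, hb, hcb.trans hc⟩)
    exact ⟨Am t A m, CB, k, τ, Am_mono (Nat.zero_le m), hB, h1, hc.symm.trans h2⟩

end Kly

namespace Kly

variable {H : Type*} [Group H]

/-- A dart: a frame, a sign and an index. -/
@[ext] structure Dart (H : Type*) where
  f : H
  s : Bool
  i : ℕ

/-- Cyclic successor of an index. -/
def nxt (k i : ℕ) : ℕ := if i = 2 * k then 0 else i + 1
/-- Cyclic predecessor of an index. -/
def prv (k i : ℕ) : ℕ := if i = 0 then 2 * k else i - 1

/-- Slot of a dart. -/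
def slot (k : ℕ) (l : Dart H) : ℕ :=
  if l.s = true then (if l.i = 4 * k - 2 then 0 else l.i)
  else (if l.i = 0 then 1 else if l.i = 1 then 0 else 4 * k - 1 - l.i)

/-- Direction of a dart. -/
def up (l : Dart H) : Bool := xor (decide (l.i % 2 = 1)) l.s

/-- Next dart around a cell. -/
def suc (k : ℕ) (τ : ℕ → H) (l : Dart H) : Dart H :=
  if l.s = true then ⟨l.f * τ l.i, true, nxt k l.i⟩
  else ⟨l.f * (τ (prv k l.i))⁻¹, false, prv k l.i⟩

/-- Corner weight. -/
def cw (k : ℕ) (τ : ℕ → H) (l : Dart H) : ℤ := if slot k (suc k τ l) < slot k l then -1 else 0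

/-- Edge weight. -/
def om (k : ℕ) (l l' : Dart H) : ℤ := if slot k l < slot k l' then 1 else 0

/-- Arrival potential. -/
def garr (k : ℕ) (l : Dart H) : ℤ :=
  if up l = true then (if 2 * k ≤ slot k l then 1 else 0) else 1
/-- Departure potential. -/
def gdep (k : ℕ) (l : Dart H) : ℤ :=
  if up l = true then (if 1 ≤ slot k l then 1 else 0) else (if 2 * k ≤ slot k l then 1 else 0)

lemma slot_parity {k : ℕ} (hk : 1 ≤ k) {l : Dart H} (hl : l.i ≤ 2 * k) :
    (up l = true → slot k l % 2 = 0) ∧ (up l = false → slot k l % 2 = 1) ∧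
    slot k l < 4 * k - 2 := by
  obtain ⟨f, s, i⟩ := l
  simp only [slot, up] at *
  cases s
  · simp only [Bool.xor_false, decide_eq_true_eq, decide_eq_false_iff_not]
    simp only [Bool.false_eq_true, if_false]
    split_ifs <;> refine ⟨fun h => ?_, fun h => ?_, ?_⟩ <;> omega
  · simp only [Bool.xor_true, Bool.not_eq_true', decide_eq_false_iff_not, Bool.not_eq_false',
      decide_eq_true_eq, if_true]
    split_ifs <;> refine ⟨fun h => ?_, fun h => ?_, ?_⟩ <;> omega

lemma om_bound {k : ℕ} (hk : 1 ≤ k) {l l' : Dart H} (hl : l.i ≤ 2 * k) (hl' : l'.i ≤ 2 * k)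
    (hd : up l ≠ up l') : garr k l' - gdep k l ≤ om k l l' := by
  obtain ⟨h1, h2, h3⟩ := slot_parity hk hl
  obtain ⟨h1', h2', h3'⟩ := slot_parity hk hl'
  unfold garr gdep om
  cases hu : up l <;> cases hu' : up l' <;> simp [hu, hu'] at *
  · split_ifs <;> omega
  · split_ifs <;> omega

lemma om_add {k : ℕ} (hk : 1 ≤ k) {l l' : Dart H} (hl : l.i ≤ 2 * k) (hl' : l'.i ≤ 2 * k)
    (hd : up l ≠ up l') : om k l l' + om k l' l = 1 := by
  obtain ⟨h1, h2, h3⟩ := slot_parity hk hl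
  obtain ⟨h1', h2', h3'⟩ := slot_parity hk hl'
  unfold om
  cases hu : up l <;> cases hu' : up l' <;> simp [hu, hu'] at *
  · split_ifs <;> omega
  · split_ifs <;> omega

lemma suc_le {k : ℕ} {τ : ℕ → H} {l : Dart H} (hl : l.i ≤ 2 * k) :
    (suc k τ l).i ≤ 2 * k := by
  unfold suc nxt prv
  split_ifs <;> simp <;> omega

/-- The corner at the dart has index `< 2k`. -/
def isAB (k : ℕ) (l : Dart H) : Prop := if l.s = true then l.i ≠ 2 * k else l.i ≠ 0

lemma up_suc_ab {k : ℕ} {τ : ℕ → H} {l : Dart H} (hl : l.i ≤ 2 * k) (h : isAB k l) :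
    up (suc k τ l) = !(up l) := by
  obtain ⟨f, s, i⟩ := l
  simp only at hl
  cases s
  · simp [isAB] at h
    simp only [suc, up, prv, h, if_false, Bool.false_eq_true]
    rcases Nat.mod_two_eq_zero_or_one i with h1 | h1
    · have : (i - 1) % 2 = 1 := by omega
      simp [h1, this]
    · have : (i - 1) % 2 = 0 := by omega
      simp [h1, this]
  · simp [isAB] at h
    simp only [suc, up, nxt, h, if_false, if_true]
    rcases Nat.mod_two_eq_zero_or_one i with h1 | h1
    · have : (i + 1) % 2 = 1 := by omega
      simp [h1, this]
    · have : (i + 1) % 2 = 0 := by omega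
      simp [h1, this]

lemma up_suc_c {k : ℕ} {τ : ℕ → H} {l : Dart H} (h : ¬ isAB k l) :
    up (suc k τ l) = up l ∧ up l = l.s := by
  obtain ⟨f, s, i⟩ := l
  cases s
  · simp [isAB] at h
    subst h
    simp [suc, up, prv]
  · simp [isAB] at h
    subst h
    simp [suc, up, nxt]

lemma cost {k : ℕ} (hk : 1 ≤ k) {τ : ℕ → H} {l : Dart H} (hl : l.i ≤ 2 * k) :
    0 ≤ cw k τ l + garr k l - gdep k (suc k τ l) ∧
    (¬ isAB k l → l.s = false → 1 ≤ cw k τ l + garr k l - gdep k (suc k τ l)) := by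
  obtain ⟨f, s, i⟩ := l
  by_cases hab : isAB k (⟨f, s, i⟩ : Dart H)
  · refine ⟨?_, fun h => absurd hab h⟩
    have hu := up_suc_ab (τ := τ) hl hab
    cases hu1 : up (⟨f, s, i⟩ : Dart H)
    · rw [hu1] at hu
      simp only [cw, garr, gdep, hu, hu1]
      cases s
      · simp [isAB] at hab
        simp [up] at hu1
        simp only [slot, suc, prv, hab, if_false, Bool.false_eq_true, if_true, Bool.not_false]
        simp only at hl
        split_ifs <;> omega
      · simp [isAB] at hab
        simp [up] at hu1
        simp only [slot, suc, nxt, hab, if_false, Bool.false_eq_true, if_true, Bool.not_false]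
        simp only at hl
        split_ifs <;> omega
    · rw [hu1] at hu
      simp only [cw, garr, gdep, hu, hu1]
      cases s
      · simp [isAB] at hab
        simp [up] at hu1
        simp only [slot, suc, prv, hab, if_false, Bool.false_eq_true, if_true, Bool.not_true]
        simp only at hl
        split_ifs <;> omega
      · simp [isAB] at hab
        simp [up] at hu1
        simp only [slot, suc, nxt, hab, if_false, Bool.false_eq_true, if_true, Bool.not_true]
        simp only at hl
        split_ifs <;> omega
  · obtain ⟨h1, h2⟩ := up_suc_c (τ := τ) hab
    simp only [cw, garr, gdep, h1, h2]
    cases s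
    · simp [isAB] at hab
      subst hab
      simp only [slot, suc, prv, if_false, Bool.false_eq_true, if_true]
      constructor
      · split_ifs <;> omega
      · intro _ _
        split_ifs <;> omega
    · simp [isAB] at hab
      subst hab
      simp only [slot, suc, nxt, if_true]
      constructor
      · split_ifs <;> omega
      · intro _ h; exact absurd h (by simp)

/-- For AB corners, the slot advances by one modulo `4k-2`. -/
lemma ab_weight {k : ℕ} (hk : 1 ≤ k) {τ : ℕ → H} {l z : Dart H} (hl : l.i ≤ 2 * k)
    (hz : z.i ≤ 2 * k) (hab : isAB k l) (hd : up (suc k τ l) ≠ up z) :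
    cw k τ l + om k (suc k τ l) z = if slot k l < slot k z then 1 else 0 := by
  obtain ⟨h1, h2, h3⟩ := slot_parity hk hl
  obtain ⟨h1', h2', h3'⟩ := slot_parity hk hz
  have hu := up_suc_ab (τ := τ) hl hab
  have hmod : slot k (suc k τ l) = if slot k l + 1 = 4 * k - 2 then 0 else slot k l + 1 := by
    obtain ⟨f, s, i⟩ := l
    cases s
    · simp [isAB] at hab
      simp only [slot, suc, prv, hab, if_false, Bool.false_eq_true]
      simp only at hl
      split_ifs <;> omega
    · simp [isAB] at hab
      simp only [slot, suc, nxt, hab, if_false, if_true]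
      simp only at hl
      split_ifs <;> omega
  have hpar : slot k l % 2 = slot k z % 2 := by
    rw [hu] at hd
    cases hul : up l <;> cases huz : up z <;> simp [hul, huz] at *
    · omega
    · omega
  unfold cw om
  rw [hmod]
  split_ifs <;> omega

/-- Corner index. -/
def kap (k : ℕ) (l : Dart H) : ℕ := if l.s = true then l.i else prv k l.i

lemma kap_eq_of_slot {k : ℕ} (hk : 1 ≤ k) {l z : Dart H} (hl : l.i ≤ 2 * k)
    (hz : z.i ≤ 2 * k) (hab : isAB k l) (habz : isAB k z) (hs : slot k l = slot k z) :
    kap k l = kap k z := by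
  obtain ⟨f, s, i⟩ := l
  obtain ⟨f', s', i'⟩ := z
  simp only [isAB, slot, kap, prv] at *
  cases s <;> cases s' <;> simp only [Bool.false_eq_true, if_false, if_true, ne_eq] at * <;>
    split_ifs at * <;> omega

end Kly

namespace Kly

variable {H : Type*} [Group H]

/-- The two darts are cancelling. -/
def canc (l l' : Dart H) : Prop := l.f = l'.f ∧ l.i = l'.i ∧ l.s ≠ l'.s

/-- The two darts lie on the same edge with opposite directions. -/
def rev (CN : Subgroup H) (l l' : Dart H) : Prop := up l ≠ up l' ∧ l.f⁻¹ * l'.f ∈ CN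

/-- Adjacency of darts across an edge. -/
def Adj (CN : Subgroup H) (l l' : Dart H) : Prop := rev CN l l' ∧ ¬ canc l l'

lemma rev.symm {CN : Subgroup H} {l l' : Dart H} (h : rev CN l l') : rev CN l' l :=
  ⟨h.1.symm, by simpa using CN.inv_mem h.2⟩

lemma Adj.symm {CN : Subgroup H} {l l' : Dart H} (h : Adj CN l l') : Adj CN l' l :=
  ⟨h.1.symm, fun hc => h.2 ⟨hc.1.symm, hc.2.1.symm, hc.2.2.symm⟩⟩

/-- Fans around a vertex, with total weight. -/
inductive Fan (CN : Subgroup H) (k : ℕ) (τ : ℕ → H) : ℤ → Dart H → Dart H → Prop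
  | one (l : Dart H) (hl : l.i ≤ 2 * k) : Fan CN k τ (cw k τ l) l (suc k τ l)
  | cons (l l2 l' : Dart H) (θ : ℤ) (hl : l.i ≤ 2 * k) (ha : Adj CN (suc k τ l) l2)
      (hf : Fan CN k τ θ l2 l') : Fan CN k τ (cw k τ l + om k (suc k τ l) l2 + θ) l l'

/-- Fans with only corners of index `< 2k`. -/
inductive ABF (CN : Subgroup H) (k : ℕ) (τ : ℕ → H) : ℤ → Dart H → Dart H → Prop
  | one (l : Dart H) (hl : l.i ≤ 2 * k) (hab : isAB k l) : ABF CN k τ (cw k τ l) l (suc k τ l)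
  | cons (l l2 l' : Dart H) (θ : ℤ) (hl : l.i ≤ 2 * k) (hab : isAB k l)
      (ha : Adj CN (suc k τ l) l2)
      (hf : ABF CN k τ θ l2 l') : ABF CN k τ (cw k τ l + om k (suc k τ l) l2 + θ) l l'

/-- Fans with only corners of a fixed index. -/
inductive CF (CN : Subgroup H) (k : ℕ) (τ : ℕ → H) (κ : ℕ) : Dart H → Dart H → Prop
  | one (l : Dart H) (hl : l.i ≤ 2 * k) (hk : kap k l = κ) : CF CN k τ κ l (suc k τ l)
  | cons (l l2 l' : Dart H) (hl : l.i ≤ 2 * k) (hk : kap k l = κ)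
      (ha : Adj CN (suc k τ l) l2) (hf : CF CN k τ κ l2 l') : CF CN k τ κ l l'

variable {CN : Subgroup H} {k : ℕ} {τ : ℕ → H}

lemma Fan.leL {θ : ℤ} {l l' : Dart H} (h : Fan CN k τ θ l l') : l.i ≤ 2 * k := by
  cases h <;> assumption

lemma Fan.leR {θ : ℤ} {l l' : Dart H} (h : Fan CN k τ θ l l') : l'.i ≤ 2 * k := by
  induction h with
  | one l hl => exact suc_le hl
  | cons l l2 l' θ hl ha _ ih => exact ih

lemma ABF.leL {θ : ℤ} {l l' : Dart H} (h : ABF CN k τ θ l l') : l.i ≤ 2 * k ∧ isAB k l := by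
  cases h <;> constructor <;> assumption

lemma ABF.up {θ : ℤ} {l l' : Dart H} (h : ABF CN k τ θ l l') : up l' = !(up l) := by
  induction h with
  | one l hl hab => exact up_suc_ab hl hab
  | cons l l2 l' θ hl hab ha _ ih =>
    rw [ih]
    have h1 := ha.1.1
    rw [up_suc_ab hl hab] at h1
    revert h1
    cases Kly.up l <;> cases Kly.up l2 <;> simp

lemma CF.leL {κ : ℕ} {l l' : Dart H} (h : CF CN k τ κ l l') : l.i ≤ 2 * k ∧ kap k l = κ := by
  cases h <;> constructor <;> assumption

lemma fan_W (hk : 1 ≤ k) {θ : ℤ} {l l' : Dart H} (h : Fan CN k τ θ l l') :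
    gdep k l' - garr k l + 1 ≤ θ ∨
    (gdep k l' - garr k l ≤ θ ∧ up l = true ∧ up l' = true) ∨
    (gdep k l' - garr k l ≤ θ ∧ ABF CN k τ θ l l') := by
  induction h with
  | one l hl =>
    obtain ⟨h1, h2⟩ := cost hk (τ := τ) hl
    by_cases hab : isAB k l
    · exact Or.inr (Or.inr ⟨by linarith, ABF.one l hl hab⟩)
    · obtain ⟨h3, h4⟩ := up_suc_c (τ := τ) hab
      cases hs : l.s
      · left; linarith [h2 hab hs]
      · right; left
        rw [h3, h4]
        exact ⟨by linarith, hs, hs⟩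
  | cons l l2 l' θ hl ha hf ih =>
    obtain ⟨h1, h2⟩ := cost hk (τ := τ) hl
    have h5 := om_bound hk (suc_le (τ := τ) hl) hf.leL ha.1.1
    rcases ih with ih | ih | ih
    · left; linarith
    · by_cases hab : isAB k l
      · right; left
        refine ⟨by linarith [ih.1], ?_, ih.2.2⟩
        have h1 := ha.1.1
        rw [up_suc_ab hl hab, ih.2.1] at h1
        revert h1
        cases Kly.up l <;> simp
      · obtain ⟨h3, h4⟩ := up_suc_c (τ := τ) hab
        cases hs : l.s
        · left; linarith [h2 hab hs, ih.1]
        · exfalso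
          apply ha.1.1
          rw [h3, h4, ih.2.1, hs]
    · by_cases hab : isAB k l
      · right; right
        exact ⟨by linarith [ih.1], ABF.cons l l2 l' θ hl hab ha ih.2⟩
      · obtain ⟨h3, h4⟩ := up_suc_c (τ := τ) hab
        cases hs : l.s
        · left; linarith [h2 hab hs, ih.1]
        · right; left
          refine ⟨by linarith [ih.1], by rw [h4, hs], ?_⟩
          rw [ih.2.up]
          have h1 := ha.1.1
          rw [h3, h4, hs] at h1
          revert h1
          cases Kly.up l2 <;> simp

lemma fan_bound (hk : 1 ≤ k) {θ : ℤ} {l l' : Dart H} (h : Fan CN k τ θ l l') :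
    gdep k l' - garr k l ≤ θ := by
  rcases fan_W hk h with h | h | h
  · linarith
  · exact h.1
  · exact h.1

lemma abf_eq (hk : 1 ≤ k) {θ : ℤ} {l l' z : Dart H} (h : ABF CN k τ θ l l') (hz : z.i ≤ 2 * k)
    (hd : up l' ≠ up z) : 0 ≤ θ + om k l' z ∧ (θ + om k l' z = 0 →
      slot k z ≤ slot k l ∧ (slot k z = slot k l → CF CN k τ (kap k l) l l')) := by
  induction h with
  | one l hl hab =>
    rw [ab_weight hk hl hz hab hd]
    refine ⟨by split_ifs <;> simp, ?_⟩
    intro h0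
    refine ⟨?_, fun _ => CF.one l hl rfl⟩
    by_contra hcon
    rw [if_pos (by omega)] at h0
    simp at h0
  | cons l l2 l' θ hl hab ha hf ih =>
    obtain ⟨i1, i2⟩ := ih hd
    have h1 := ab_weight hk hl hf.leL.1 hab ha.1.1
    have h2 : cw k τ l + om k (suc k τ l) l2 + θ + om k l' z =
      (if slot k l < slot k l2 then 1 else 0) + (θ + om k l' z) := by rw [← h1]; ring
    rw [h2]
    refine ⟨by split_ifs <;> linarith, ?_⟩
    intro h0
    have h3 : ¬ slot k l < slot k l2 := by
      intro h; rw [if_pos h] at h0; linarith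
    rw [if_neg h3, zero_add] at h0
    obtain ⟨i3, i4⟩ := i2 h0
    refine ⟨by omega, fun he => ?_⟩
    have h4 : slot k l = slot k l2 := by omega
    have h5 := kap_eq_of_slot hk hl hf.leL.1 hab hf.leL.2 h4
    refine CF.cons l l2 l' hl rfl ha ?_
    rw [h5]
    exact i4 (by omega)

lemma kap_lt (hk : 1 ≤ k) {l : Dart H} (hl : l.i ≤ 2 * k) (hab : isAB k l) : kap k l < 2 * k := by
  unfold isAB at hab
  unfold kap prv
  split_ifs at * <;> omega

lemma suc_f {l : Dart H} {κ : ℕ} (h : kap k l = κ) :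
    (suc k τ l).f = l.f * sg (τ κ) l.s := by
  subst h
  unfold suc kap
  cases l.s <;> simp

lemma suc_s (l : Dart H) : (suc k τ l).s = l.s := by
  unfold suc
  cases l.s <;> simp

lemma cf_word {κ : ℕ} {l l' : Dart H} (h : CF CN k τ κ l l') :
    ∃ y L, y.1 = l.s ∧ (∀ z ∈ y :: L, z.2 ∈ CN) ∧
      (y :: L).IsChain (fun y z => y.1 ≠ z.1 → y.2 ≠ 1) ∧
      l.f⁻¹ * l'.f = wprod (τ κ) (y :: L) := by
  induction h with
  | one l hl hk =>
    exact ⟨(l.s, 1), [], rfl, by simp [CN.one_mem], by simp, by rw [suc_f hk]; simp⟩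
  | cons l l2 l' hl hk ha hf ih =>
    obtain ⟨y, L, h1, h2, h3, h4⟩ := ih
    refine ⟨(l.s, (suc k τ l).f⁻¹ * l2.f), y :: L, rfl, ?_, ?_, ?_⟩
    · intro z hz
      rcases List.mem_cons.1 hz with rfl | hz
      · exact ha.1.2
      · exact h2 z hz
    · rw [List.isChain_cons_cons]
      refine ⟨?_, h3⟩
      simp only
      rw [h1]
      intro hs hc
      apply ha.2
      rw [inv_mul_eq_one] at hc
      refine ⟨hc, ?_, by rw [suc_s]; exact hs⟩
      have hk2 := hf.leL.2
      have hl2 := hf.leL.1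
      unfold kap at hk hk2
      unfold suc
      cases hls : l.s <;> cases hl2s : l2.s <;> simp [hls, hl2s] at *
      · omega
      · rw [hk]; unfold prv at hk2; unfold nxt
        split_ifs at * <;> omega
    · rw [wprod_cons, ← h4]
      simp only
      rw [suc_f hk]; group

lemma vertex_bound (hk : 1 ≤ k) (hlrf : ∀ i < 2 * k, LRF CN (τ i)) {θ : ℤ} {l l' : Dart H}
    (h : Fan CN k τ θ l l') (hr : rev CN l' l) : 1 ≤ θ + om k l' l := by
  have h1 := om_bound hk h.leR h.leL hr.1
  rcases fan_W hk h with h2 | ⟨h2, h3, h4⟩ | ⟨h2, h3⟩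
  · linarith
  · exact absurd (h4.trans h3.symm) hr.1
  · obtain ⟨h4, h5⟩ := abf_eq hk h3 h.leL hr.1
    rcases h4.lt_or_eq with h6 | h6
    · linarith
    · exfalso
      have h7 := (h5 h6.symm).2 rfl
      obtain ⟨y, L, -, h8, h9, h10⟩ := cf_word h7
      apply (hlrf _ (kap_lt hk h.leL h3.leL.2)).not_mem (y :: L) (by simp) h8 h9
      rw [← h10]
      exact hr.symm.2

lemma vertex_weak (hk : 1 ≤ k) {θ : ℤ} {l l' : Dart H}
    (h : Fan CN k τ θ l l') (hr : up l' ≠ up l) : 0 ≤ θ + om k l' l := by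
  have h1 := om_bound hk h.leR h.leL hr
  linarith [fan_bound hk h]

/-- Translation. -/
def tr (h : H) (l : Dart H) : Dart H := ⟨h * l.f, l.s, l.i⟩

@[simp] lemma tr_f (h : H) (l : Dart H) : (tr h l).f = h * l.f := rfl
@[simp] lemma tr_s (h : H) (l : Dart H) : (tr h l).s = l.s := rfl
@[simp] lemma tr_i (h : H) (l : Dart H) : (tr h l).i = l.i := rfl
@[simp] lemma tr_tr (h h' : H) (l : Dart H) : tr h (tr h' l) = tr (h * h') l := by
  ext <;> simp [mul_assoc]
@[simp] lemma tr_one (l : Dart H) : tr 1 l = l := by ext <;> simp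
@[simp] lemma slot_tr (h : H) (l : Dart H) : slot k (tr h l) = slot k l := rfl
@[simp] lemma up_tr (h : H) (l : Dart H) : up (tr h l) = up l := rfl
@[simp] lemma om_tr (h h' : H) (l l' : Dart H) : om k (tr h l) (tr h' l') = om k l l' := rfl
lemma suc_tr (h : H) (l : Dart H) : suc k τ (tr h l) = tr h (suc k τ l) := by
  unfold suc
  cases hs : l.s <;> simp [hs] <;> ext <;> simp [mul_assoc]
@[simp] lemma cw_tr (h : H) (l : Dart H) : cw k τ (tr h l) = cw k τ l := by
  unfold cw; rw [suc_tr]; rfl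

lemma rev.tr {l l' : Dart H} (hr : rev CN l l') (h : H) : rev CN (tr h l) (tr h l') :=
  ⟨hr.1, by simpa [mul_assoc] using hr.2⟩

lemma Adj.tr {l l' : Dart H} (hr : Adj CN l l') (h : H) : Adj CN (tr h l) (tr h l') :=
  ⟨hr.1.tr h, fun hc => hr.2 ⟨by simpa using hc.1, hc.2.1, hc.2.2⟩⟩

lemma Fan.tr {θ : ℤ} {l l' : Dart H} (hf : Fan CN k τ θ l l') (h : H) :
    Fan CN k τ θ (tr h l) (tr h l') := by
  induction hf with
  | one l hl =>
    rw [← suc_tr, ← cw_tr h]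
    exact Fan.one _ hl
  | cons l l2 l' θ hl ha _ ih =>
    have := Fan.cons (Kly.tr h l) (Kly.tr h l2) (Kly.tr h l') θ hl (by
      rw [suc_tr]; exact ha.tr h) ih
    simpa [suc_tr] using this

lemma Fan.join {θ θ' : ℤ} {l z z' y : Dart H} (hf : Fan CN k τ θ l z) (ha : Adj CN z z')
    (hf' : Fan CN k τ θ' z' y) : Fan CN k τ (θ + om k z z' + θ') l y := by
  induction hf with
  | one l hl => exact Fan.cons l z' y θ' hl ha hf'
  | cons l l2 l' θ hl ha' _ ih =>
    have := Fan.cons _ _ _ _ hl ha' (ih ha)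
    convert this using 1
    ring

/-- A sequence of fans. -/
def FP (CN : Subgroup H) (k : ℕ) (τ : ℕ → H) : ℤ → Dart H → List (Dart H) → Dart H → Prop
  | θ, l, [], z => Fan CN k τ θ l z
  | θ, l, y :: P, z => ∃ θ1 θ2, θ = θ1 + θ2 ∧ Fan CN k τ θ1 l y ∧ FP CN k τ θ2 y P z

lemma FP.leL {θ : ℤ} {l z : Dart H} {P : List (Dart H)} (h : FP CN k τ θ l P z) :
    l.i ≤ 2 * k := by
  cases P with
  | nil => exact Fan.leL h
  | cons y P => obtain ⟨θ1, θ2, -, h, -⟩ := h; exact h.leL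

lemma FP.leR {θ : ℤ} {l z : Dart H} {P : List (Dart H)} (h : FP CN k τ θ l P z) :
    z.i ≤ 2 * k := by
  induction P generalizing θ l with
  | nil => exact Fan.leR h
  | cons y P ih => obtain ⟨θ1, θ2, -, -, h⟩ := h; exact ih h

lemma FP.tr {θ : ℤ} {l z : Dart H} {P : List (Dart H)} (hf : FP CN k τ θ l P z) (h : H) :
    FP CN k τ θ (tr h l) (P.map (tr h)) (tr h z) := by
  induction P generalizing θ l with
  | nil => exact Fan.tr hf h
  | cons y P ih =>
    obtain ⟨θ1, θ2, h1, h2, h3⟩ := hf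
    exact ⟨θ1, θ2, h1, h2.tr h, ih h3⟩

lemma FP.join {θ θ' : ℤ} {l z y : Dart H} {P Q : List (Dart H)} (hf : FP CN k τ θ l P z)
    (hf' : FP CN k τ θ' z Q y) : FP CN k τ (θ + θ') l (P ++ z :: Q) y := by
  induction P generalizing θ l with
  | nil => exact ⟨θ, θ', rfl, hf, hf'⟩
  | cons x P ih =>
    obtain ⟨θ1, θ2, rfl, h2, h3⟩ := hf
    exact ⟨θ1, θ2 + θ', by ring, h2, ih h3⟩

lemma FP.split {θ : ℤ} {l z y : Dart H} {P Q : List (Dart H)}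
    (hf : FP CN k τ θ l (P ++ z :: Q) y) :
    ∃ θ1 θ2, θ = θ1 + θ2 ∧ FP CN k τ θ1 l P z ∧ FP CN k τ θ2 z Q y := by
  induction P generalizing θ l with
  | nil => exact hf
  | cons x P ih =>
    obtain ⟨θ1, θ2, rfl, h2, h3⟩ := hf
    obtain ⟨θ3, θ4, rfl, h4, h5⟩ := ih h3
    exact ⟨θ1 + θ3, θ4, by ring, ⟨θ1, θ3, rfl, h2, h4⟩, h5⟩

lemma FP.adj {θ θ' : ℤ} {l z z' y : Dart H} {P Q : List (Dart H)} (hf : FP CN k τ θ l P z)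
    (ha : Adj CN z z') (hf' : FP CN k τ θ' z' Q y) :
    FP CN k τ (θ + om k z z' + θ') l (P ++ Q) y := by
  induction P generalizing θ l with
  | nil =>
    cases Q with
    | nil => exact Fan.join hf ha hf'
    | cons x Q =>
      obtain ⟨θ1, θ2, rfl, h2, h3⟩ := hf'
      exact ⟨θ + om k z z' + θ1, θ2, by ring, Fan.join hf ha h2, h3⟩
  | cons x P ih =>
    obtain ⟨θ1, θ2, rfl, h2, h3⟩ := hf
    exact ⟨θ1, θ2 + om k z z' + θ', by ring, h2, ih h3⟩

end Kly

namespace Kly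

variable {H : Type*} [Group H]

/-- Products of at most the given number of conjugates of `w` and its inverse. -/
inductive Len (w : H) : H → ℕ → Prop
  | one : Len w 1 0
  | mul (u g : H) (s : Bool) (n : ℕ) (h : Len w g n) : Len w (u * sg w s * u⁻¹ * g) (n + 1)

lemma Len.comp {w g h : H} {n m : ℕ} (hg : Len w g n) (hh : Len w h m) :
    Len w (g * h) (n + m) := by
  induction hg with
  | one => simpa using hh
  | mul u g s n _ ih =>
    have := Len.mul u _ s _ ih
    rw [show n + 1 + m = n + m + 1 by omega, mul_assoc (u * sg w s * u⁻¹)]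
    exact this

lemma Len.conj {w g : H} {n : ℕ} (hg : Len w g n) (v : H) : Len w (v * g * v⁻¹) n := by
  induction hg with
  | one => simpa using Len.one
  | mul u g s n _ ih =>
    have := Len.mul (v * u) _ s _ ih
    convert this using 1
    group

lemma Len.single (w u : H) (s : Bool) : Len w (u * sg w s * u⁻¹) 1 := by
  simpa using Len.mul u 1 s 0 Len.one

/-- Partial products. -/
def Pi (τ : ℕ → H) (i : ℕ) : H := ((List.range i).map τ).prod

lemma Pi_succ (τ : ℕ → H) (i : ℕ) : Pi τ (i + 1) = Pi τ i * τ i := by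
  simp [Pi, List.range_succ]

lemma Pi_zero (τ : ℕ → H) : Pi τ 0 = 1 := by simp [Pi]

/-- The relator. -/
def ww (k : ℕ) (τ : ℕ → H) : H := Pi τ (2 * k + 1)

/-- Base frame of the cell. -/
def fr (τ : ℕ → H) (l : Dart H) : H := l.f * (Pi τ l.i)⁻¹

/-- Holonomy of the cell. -/
def cel (k : ℕ) (τ : ℕ → H) (l : Dart H) : H := fr τ l * sg (ww k τ) l.s * (fr τ l)⁻¹

variable {CN : Subgroup H} {k : ℕ} {τ : ℕ → H}

lemma cel_tr (h : H) (l : Dart H) : cel k τ (tr h l) = h * cel k τ l * h⁻¹ := by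
  simp [cel, fr, mul_assoc]

lemma cel_canc {l l' : Dart H} (h : canc l l') : cel k τ l' = (cel k τ l)⁻¹ := by
  obtain ⟨h1, h2, h3⟩ := h
  have : l'.s = !l.s := by revert h3; cases l.s <;> cases l'.s <;> simp
  simp only [cel, fr, h1, h2, this]
  cases l.s <;> simp [mul_assoc]

lemma cel_len (l : Dart H) : Len (ww k τ) (cel k τ l) 1 := Len.single _ _ _

lemma fr_suc_ab (l : Dart H) (h : isAB k l) : fr τ (suc k τ l) = fr τ l := by
  obtain ⟨f, s, i⟩ := l
  cases s
  · simp [isAB] at h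
    obtain ⟨j, rfl⟩ : ∃ j, i = j + 1 := ⟨i - 1, by omega⟩
    simp [fr, suc, prv, Pi_succ, mul_assoc]
  · simp [isAB] at h
    simp [fr, suc, nxt, Pi_succ, h]

lemma fr_suc_c (l : Dart H) (h : ¬ isAB k l) :
    fr τ (suc k τ l) = fr τ l * sg (ww k τ) l.s := by
  obtain ⟨f, s, i⟩ := l
  cases s
  · simp [isAB] at h
    subst h
    simp [fr, suc, prv, ww, Pi_succ, Pi_zero, mul_assoc]
  · simp [isAB] at h
    subst h
    simp [fr, suc, nxt, ww, Pi_succ, Pi_zero, mul_assoc]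

lemma cel_suc (l : Dart H) : cel k τ (suc k τ l) = cel k τ l := by
  unfold cel
  rw [suc_s]
  by_cases h : isAB k l
  · rw [fr_suc_ab l h]
  · rw [fr_suc_c l h]; group

/-- Good polygons. -/
structure Good (CN : Subgroup H) (k : ℕ) (τ : ℕ → H) (P : List (Dart H)) (q : H) (n : ℕ) :
    Prop where
  fp : ∃ l P' θ, P = l :: P' ∧ FP CN k τ θ l P' (tr q l) ∧ θ ≤ -1
  S : ∀ l ∈ P, ∃ n', n = n' + 1 ∧ Len (ww k τ) ((cel k τ l)⁻¹ * q) n'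
  R : P.Pairwise (fun l l' => l.s ≠ l'.s →
    ∃ n', n = n' + 2 ∧ Len (ww k τ) ((cel k τ l)⁻¹ * (cel k τ l')⁻¹ * q) n')

/-- Minimality. -/
def Min (w g : H) (n : ℕ) : Prop := ∀ m, Len w g m → n ≤ m

lemma Good.len {P : List (Dart H)} {q : H} {n : ℕ} (h : Good CN k τ P q n) :
    Len (ww k τ) q n := by
  obtain ⟨l, P', θ, rfl, -, -⟩ := h.fp
  obtain ⟨n', rfl, h2⟩ := h.S l (by simp)
  have := (cel_len (k := k) (τ := τ) l).comp h2
  rw [add_comm]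
  simpa using this

lemma Good.tr {P : List (Dart H)} {q : H} {n : ℕ} (h : Good CN k τ P q n) (g : H) :
    Good CN k τ (P.map (tr g)) (g * q * g⁻¹) n := by
  refine ⟨?_, ?_, ?_⟩
  · obtain ⟨l, P', θ, rfl, h1, h2⟩ := h.fp
    refine ⟨Kly.tr g l, P'.map (Kly.tr g), θ, rfl, ?_, h2⟩
    simpa [mul_assoc] using h1.tr g
  · intro l hl
    obtain ⟨l0, hl0, rfl⟩ := List.mem_map.1 hl
    obtain ⟨n', h1, h2⟩ := h.S l0 hl0
    refine ⟨n', h1, ?_⟩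
    convert h2.conj g using 1
    rw [cel_tr]; group
  · rw [List.pairwise_map]
    refine h.R.imp ?_
    intro a b hab hs
    obtain ⟨n', h1, h2⟩ := hab hs
    refine ⟨n', h1, ?_⟩
    convert h2.conj g using 1
    rw [cel_tr, cel_tr]; group

lemma Good.rot {P : List (Dart H)} {l : Dart H} {q : H} {n : ℕ} (h : Good CN k τ (l :: P) q n) :
    Good CN k τ (P ++ [Kly.tr q l]) q n := by
  refine ⟨?_, ?_, ?_⟩
  · obtain ⟨l', P', θ, h0, h1, h2⟩ := h.fp
    obtain ⟨rfl, rfl⟩ := List.cons.inj h0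
    cases P with
    | nil => exact ⟨_, [], θ, rfl, FP.tr h1 q, h2⟩
    | cons y P =>
      obtain ⟨θ1, θ2, rfl, h3, h4⟩ := h1
      refine ⟨y, P ++ [Kly.tr q l], θ2 + θ1, rfl, ?_, by linarith⟩
      exact FP.join h4 (Q := []) (h3.tr q)
  · intro x hx
    rcases List.mem_append.1 hx with hx | hx
    · exact h.S x (by simp [hx])
    · simp at hx
      subst hx
      obtain ⟨n', h1, h2⟩ := h.S l (by simp)
      refine ⟨n', h1, ?_⟩
      convert h2.conj (cel k τ l) using 1
      rw [cel_tr]; group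
  · have hR := List.pairwise_cons.1 h.R
    rw [List.pairwise_append]
    refine ⟨hR.2, by simp, ?_⟩
    intro a ha b hb hs
    simp at hb
    subst hb
    obtain ⟨n', h1, h2⟩ := hR.1 a ha (by simpa using hs.symm)
    refine ⟨n', h1, ?_⟩
    convert h2.conj (cel k τ l) using 1
    rw [cel_tr]; group

lemma Good.rotate {X Y : List (Dart H)} {q : H} {n : ℕ} (h : Good CN k τ (X ++ Y) q n) :
    Good CN k τ (Y ++ X.map (Kly.tr q)) q n := by
  induction X generalizing Y with
  | nil => simpa using h
  | cons x X ih =>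
    have := ih (Y := Y ++ [Kly.tr q x]) (by simpa using Good.rot h)
    simpa using this

lemma map_tr_tr (g h : H) (X : List (Dart H)) : (X.map (tr h)).map (tr g) = X.map (tr (g * h)) := by
  simp

lemma map_tr_one (X : List (Dart H)) : X.map (tr 1) = X := by
  have : (tr 1 : Dart H → Dart H) = id := by funext l; simp
  rw [this]; simp

lemma Good.unrotate {X Y : List (Dart H)} {q : H} {n : ℕ}
    (h : Good CN k τ (Y ++ X.map (Kly.tr q)) q n) : Good CN k τ (X ++ Y) q n := by
  have := h.rotate.tr q⁻¹
  rw [List.map_append, map_tr_tr, map_tr_tr, inv_mul_cancel, map_tr_one, map_tr_one] at this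
  simpa using this

lemma garr_le (l : Dart H) : garr k l ≤ 1 := by
  unfold garr; split_ifs <;> simp

lemma gdep_nonneg (l : Dart H) : 0 ≤ gdep k l := by
  unfold gdep; split_ifs <;> simp

lemma Good.two (hk : 1 ≤ k) {P : List (Dart H)} {l : Dart H} {q : H} {n : ℕ}
    (h : Good CN k τ (l :: P) q n) : P ≠ [] := by
  rintro rfl
  obtain ⟨l', P', θ, h0, h1, h2⟩ := h.fp
  obtain ⟨rfl, rfl⟩ := List.cons.inj h0
  have h1' : Fan CN k τ θ l (Kly.tr q l) := h1
  have e : gdep k (Kly.tr q l) = gdep k l := rfl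
  rcases fan_W hk h1' with h3 | ⟨h3, h4, -⟩ | ⟨h3, h4⟩
  · linarith [garr_le (k := k) l, gdep_nonneg (k := k) (Kly.tr q l)]
  · have : garr k l ≤ gdep k l := by
      unfold garr gdep
      rw [h4]
      simp only [if_true]
      split_ifs <;> omega
    linarith
  · have := h4.up
    simp at this

lemma Good.glue (hk : 1 ≤ k) {Y W : List (Dart H)} {l l' : Dart H} {q q' : H} {n n' : ℕ}
    (h : Good CN k τ (l :: Y) q n) (h' : Good CN k τ (l' :: W) q' n') (hr : rev CN l l')
    (hm : Min (ww k τ) (q' * q) (n + n')) :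
    Good CN k τ (W ++ Y.map (Kly.tr q')) (q' * q) (n + n') := by
  have hnc : ¬ canc l l' := by
    intro hc
    obtain ⟨m, rfl, h2⟩ := h.S l (by simp)
    obtain ⟨m', rfl, h2'⟩ := h'.S l' (by simp)
    have h3 := (h2'.conj (cel k τ l')).comp h2
    have := hm _ (by
      convert h3 using 1
      rw [cel_canc hc]; group)
    omega
  have ha : Adj CN l l' := ⟨hr, hnc⟩
  refine ⟨?_, ?_, ?_⟩
  · obtain ⟨l1, Y1, θ, h0, h1, h2⟩ := h.fp
    obtain ⟨rfl, rfl⟩ := List.cons.inj h0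
    obtain ⟨l1', W1, θ', h0', h1', h2'⟩ := h'.fp
    obtain ⟨rfl, rfl⟩ := List.cons.inj h0'
    obtain ⟨v, W2, rfl⟩ := List.exists_cons_of_ne_nil (h'.two hk)
    obtain ⟨θ1, θ2, rfl, h3, h4⟩ := h1'
    have f1 := FP.adj h4 (ha.symm.tr q') (h1.tr q')
    rw [tr_tr] at f1
    have f2 := FP.adj f1 (ha.tr (q' * q)) (Q := []) (h3.tr (q' * q))
    refine ⟨v, _, _, rfl, by simpa using f2, ?_⟩
    have := om_add hk h1.leL h3.leL hr.1
    linarith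
  · intro x hx
    rcases List.mem_append.1 hx with hx | hx
    · obtain ⟨m, rfl, h2⟩ := h'.S x (by simp [hx])
      refine ⟨m + n, by omega, ?_⟩
      convert h2.comp h.len using 1
      group
    · obtain ⟨y, hy, rfl⟩ := List.mem_map.1 hx
      obtain ⟨m, rfl, h2⟩ := h.S y (by simp [hy])
      refine ⟨n' + m, by omega, ?_⟩
      convert h'.len.comp h2 using 1
      rw [cel_tr]; group
  · rw [List.pairwise_append]
    have hR := (List.pairwise_cons.1 h.R).2
    have hR' := (List.pairwise_cons.1 h'.R).2
    refine ⟨?_, ?_, ?_⟩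
    · refine hR'.imp ?_
      intro a b hab hs
      obtain ⟨m, rfl, h2⟩ := hab hs
      refine ⟨m + n, by omega, ?_⟩
      convert h2.comp h.len using 1
      group
    · rw [List.pairwise_map]
      refine hR.imp ?_
      intro a b hab hs
      obtain ⟨m, rfl, h2⟩ := hab hs
      refine ⟨n' + m, by omega, ?_⟩
      convert h'.len.comp h2 using 1
      rw [cel_tr, cel_tr]; group
    · intro a ha b hb hs
      obtain ⟨y, hy, rfl⟩ := List.mem_map.1 hb
      obtain ⟨m, rfl, h2⟩ := h.S y (by simp [hy])
      obtain ⟨m', rfl, h2'⟩ := h'.S a (by simp [ha])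
      refine ⟨m' + m, by omega, ?_⟩
      convert h2'.comp h2 using 1
      rw [cel_tr]; group

lemma Good.glue_gen (hk : 1 ≤ k) {X Y W : List (Dart H)} {l l' : Dart H} {q q' : H} {n n' : ℕ}
    (h : Good CN k τ (X ++ l :: Y) q n) (h' : Good CN k τ (l' :: W) q' n') (hr : rev CN l l')
    (hm : Min (ww k τ) (q' * q) (n + n')) :
    Good CN k τ (X ++ W ++ Y.map (Kly.tr q')) (q' * q) (n + n') := by
  have h1 := h.rotate
  have h2 := Good.glue hk (by simpa using h1) h' hr hm
  rw [List.map_append, map_tr_tr, ← List.append_assoc] at h2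
  have := h2.unrotate
  simpa using this

lemma Good.fold2 (hk : 1 ≤ k) (hlrf : ∀ i < 2 * k, LRF CN (τ i)) {l l' : Dart H} {q : H} {n : ℕ}
    (h : Good CN k τ [l, l'] q n) (hr : rev CN l l') : False := by
  obtain ⟨l1, Y1, θ, h0, h1, h2⟩ := h.fp
  obtain ⟨h01, rfl⟩ := List.cons.inj h0
  subst h01
  obtain ⟨θ1, θ2, rfl, h3, h4⟩ := h1
  have h4' : Fan CN k τ θ2 l' (Kly.tr q l) := h4
  have e1 := vertex_bound hk hlrf h3 hr.symm
  have e2 := vertex_weak hk h4' hr.1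
  have e3 := om_add hk h3.leL h3.leR hr.1
  have e4 : om k (Kly.tr q l) l' = om k l l' := rfl
  linarith

lemma Good.fold3 (hk : 1 ≤ k) (hlrf : ∀ i < 2 * k, LRF CN (τ i)) {l0 l l' : Dart H} {q : H} {n : ℕ}
    {P : List (Dart H)} (h : Good CN k τ (l0 :: l :: l' :: P) q n) (hr : rev CN l l')
    (hm : Min (ww k τ) q n) : Good CN k τ (l0 :: P) q n := by
  have hnc : ¬ canc l l' := by
    intro hc
    have h1 := (List.pairwise_cons.1 (List.pairwise_cons.1 h.R).2).1 l' (by simp) hc.2.2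
    obtain ⟨m, rfl, h2⟩ := h1
    have := hm m (by
      convert h2 using 1
      rw [cel_canc hc]; group)
    omega
  have hsub : (l0 :: P).Sublist (l0 :: l :: l' :: P) := by
    apply List.Sublist.cons_cons
    exact List.Sublist.cons _ (List.Sublist.cons _ (List.Sublist.refl _))
  refine ⟨?_, fun x hx => h.S x (hsub.subset hx), h.R.sublist hsub⟩
  obtain ⟨l1, Y1, θ, h0, h1, h2⟩ := h.fp
  obtain ⟨h01, rfl⟩ := List.cons.inj h0
  subst h01
  obtain ⟨θ1, θ2, rfl, h3, θ3, θ4, rfl, h4, h5⟩ := h1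
  have f : FP CN k τ _ l0 ([] ++ P) _ := FP.adj (P := []) h3 ⟨hr, hnc⟩ h5
  refine ⟨l0, P, _, rfl, f, ?_⟩
  have e1 := vertex_bound hk hlrf h4 hr.symm
  have e3 := om_add hk h4.leL h4.leR hr.1
  linarith

lemma Good.fold (hk : 1 ≤ k) (hlrf : ∀ i < 2 * k, LRF CN (τ i)) {l l' : Dart H} {q : H} {n : ℕ}
    {X P : List (Dart H)} (h : Good CN k τ (X ++ l :: l' :: P) q n) (hr : rev CN l l')
    (hm : Min (ww k τ) q n) : Good CN k τ (X ++ P) q n := by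
  rcases List.eq_nil_or_concat X with rfl | ⟨X3, l0, rfl⟩
  · rcases List.eq_nil_or_concat P with rfl | ⟨P3, l0, rfl⟩
    · exact (Good.fold2 hk hlrf h hr).elim
    · have h1 : Good CN k τ ([Kly.tr q⁻¹ l0] ++ (l :: l' :: P3)) q n := by
        apply Good.unrotate
        simpa using h
      have h2 := (Good.fold3 hk hlrf h1 hr hm).rot
      simpa using h2
  · have h1 : Good CN k τ ([l0] ++ l :: l' :: P ++ X3.map (Kly.tr q)) q n := by
      apply Good.rotate
      simpa using h
    have h2 := Good.fold3 hk hlrf (P := P ++ X3.map (Kly.tr q)) (by simpa using h1) hr hm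
    have h3 := Good.unrotate (X := X3) (Y := l0 :: P) (by simpa using h2)
    simpa using h3

end Kly

namespace Kly

variable {H : Type*} [Group H]

/-- The orbit of a dart. -/
def orb (k : ℕ) (τ : ℕ → H) : ℕ → Dart H → List (Dart H)
  | 0, _ => []
  | m + 1, l => suc k τ l :: orb k τ m (suc k τ l)

variable {CN : Subgroup H} {k : ℕ} {τ : ℕ → H}

lemma cw_nonpos (l : Dart H) : cw k τ l ≤ 0 := by
  unfold cw; split_ifs <;> simp

lemma orb_fp (m : ℕ) (l : Dart H) (hl : l.i ≤ 2 * k) :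
    ∃ θ, FP CN k τ θ l (orb k τ m l) ((suc k τ)^[m + 1] l) ∧ θ ≤ 0 ∧
      ∀ j ≤ m, θ ≤ cw k τ ((suc k τ)^[j] l) := by
  induction m generalizing l with
  | zero =>
    refine ⟨_, Fan.one l hl, cw_nonpos _, ?_⟩
    intro j hj
    obtain rfl : j = 0 := by omega
    exact le_refl _
  | succ m ih =>
    obtain ⟨θ, h1, h2, h3⟩ := ih (suc k τ l) (suc_le hl)
    refine ⟨cw k τ l + θ, ⟨_, _, rfl, Fan.one l hl, h1⟩, ?_, ?_⟩
    · linarith [cw_nonpos (k := k) (τ := τ) l]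
    · intro j hj
      cases j with
      | zero => simp only [Function.iterate_zero, id]; linarith
      | succ j =>
        have := h3 j (by omega)
        rw [Function.iterate_succ_apply]
        linarith [cw_nonpos (k := k) (τ := τ) l]

lemma orb_mem (m : ℕ) (l x : Dart H) (h : x ∈ l :: orb k τ m l) :
    x.s = l.s ∧ cel k τ x = cel k τ l := by
  induction m generalizing l with
  | zero => simp [orb] at h; subst h; simp
  | succ m ih =>
    rcases List.mem_cons.1 h with rfl | h
    · simp
    · have := ih (suc k τ l) h
      rw [suc_s, cel_suc] at this
      exact this

lemma iter_true (f : H) (j : ℕ) (hj : j ≤ 2 * k) :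
    (suc k τ)^[j] ⟨f, true, 0⟩ = ⟨f * Pi τ j, true, j⟩ := by
  induction j with
  | zero => simp [Pi_zero]
  | succ j ih =>
    rw [Function.iterate_succ_apply', ih (by omega)]
    have : j ≠ 2 * k := by omega
    simp [suc, nxt, this, Pi_succ, mul_assoc]

lemma iter_true_last (f : H) :
    (suc k τ)^[2 * k + 1] ⟨f, true, 0⟩ = ⟨f * ww k τ, true, 0⟩ := by
  rw [Function.iterate_succ_apply', iter_true f _ le_rfl]
  simp [suc, nxt, ww, Pi_succ, mul_assoc]

lemma iter_false (f : H) (j : ℕ) (hj : j ≤ 2 * k) :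
    (suc k τ)^[j + 1] ⟨f, false, 0⟩ =
      ⟨f * (ww k τ)⁻¹ * Pi τ (2 * k - j), false, 2 * k - j⟩ := by
  induction j with
  | zero => simp [suc, prv, ww, Pi_succ, mul_assoc]
  | succ j ih =>
    rw [Function.iterate_succ_apply', ih (by omega)]
    obtain ⟨m, hm⟩ : ∃ m, 2 * k - j = m + 1 := ⟨2 * k - j - 1, by omega⟩
    have h2 : 2 * k - (j + 1) = m := by omega
    rw [hm, h2]
    simp [suc, prv, Pi_succ, mul_assoc]

lemma cell_good (hk : 1 ≤ k) (f : H) (s : Bool) :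
    Good CN k τ (⟨f, s, 0⟩ :: orb k τ (2 * k) ⟨f, s, 0⟩) (f * sg (ww k τ) s * f⁻¹) 1 := by
  have hc : cel k τ (⟨f, s, 0⟩ : Dart H) = f * sg (ww k τ) s * f⁻¹ := by simp [cel, fr, Pi_zero]
  refine ⟨?_, ?_, ?_⟩
  · obtain ⟨θ, h1, -, h3⟩ := orb_fp (CN := CN) (k := k) (τ := τ) (2 * k) ⟨f, s, 0⟩ (by simp)
    refine ⟨_, _, θ, rfl, ?_, ?_⟩
    · convert h1 using 1
      cases s
      · rw [iter_false f (2 * k) le_rfl]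
        ext <;> simp [Pi_zero]
      · rw [iter_true_last]
        ext <;> simp
    · cases s
      · have := h3 (2 * k - 1) (by omega)
        obtain ⟨j, hj⟩ : ∃ j, 2 * k - 1 = j + 1 := ⟨2 * k - 2, by omega⟩
        rw [hj, iter_false f j (by omega)] at this
        have e : 2 * k - j = 2 := by omega
        rw [e] at this
        have hs : cw k τ (⟨f * (ww k τ)⁻¹ * Pi τ 2, false, 2⟩ : Dart H) = -1 := by
          unfold cw
          rw [if_pos]
          simp [slot, suc, prv]
          omega
        linarith
      · by_cases h1 : k = 1
        · subst h1
          have := h3 1 (by omega)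
          rw [iter_true f 1 (by omega)] at this
          have hs : cw 1 τ (⟨f * Pi τ 1, true, 1⟩ : Dart H) = -1 := by
            unfold cw
            rw [if_pos]
            simp [slot, suc, nxt]
          linarith
        · have := h3 (2 * k) le_rfl
          rw [iter_true f _ le_rfl] at this
          have hs : cw k τ (⟨f * Pi τ (2 * k), true, 2 * k⟩ : Dart H) = -1 := by
            unfold cw
            rw [if_pos]
            have : ¬ (2 * k = 4 * k - 2) := by omega
            simp only [slot, suc, nxt, this, if_true, if_false]
            split_ifs <;> omega
          linarith
  · intro x hx
    refine ⟨0, rfl, ?_⟩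
    rw [(orb_mem _ _ _ hx).2, hc]
    rw [inv_mul_cancel]; exact Len.one
  · have : ∀ x ∈ (⟨f, s, 0⟩ :: orb k τ (2 * k) ⟨f, s, 0⟩ : List (Dart H)), x.s = s :=
      fun x hx => (orb_mem (k := k) (τ := τ) _ _ _ hx).1
    refine List.Pairwise.imp_of_mem (R := fun _ _ => True) ?_ (List.pairwise_of_forall (by simp))
    intro a b ha hb _ hs
    exact absurd ((this a ha).trans (this b hb).symm) hs

end Kly

namespace Kly

variable {H : Type*} [Group H]

/-- Oriented edges of the tree. -/
abbrev Edge (CN : Subgroup H) := Bool × (H ⧸ CN)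

variable {CN : Subgroup H} {k : ℕ} {τ : ℕ → H}

/-- Reversal. -/
def bar (e : Edge CN) : Edge CN := (!e.1, e.2)
/-- Action. -/
def ac (h : H) (e : Edge CN) : Edge CN := (e.1, h • e.2)
/-- The edge of a dart. -/
def edge (CN : Subgroup H) (l : Dart H) : Edge CN := (up l, QuotientGroup.mk l.f)

@[simp] lemma bar_bar (e : Edge CN) : bar (bar e) = e := by simp [bar]
@[simp] lemma ac_ac (h h' : H) (e : Edge CN) : ac h (ac h' e) = ac (h * h') e := by
  simp [ac, mul_smul]
@[simp] lemma ac_one (e : Edge CN) : ac 1 e = e := by simp [ac]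
lemma ac_bar (h : H) (e : Edge CN) : ac h (bar e) = bar (ac h e) := rfl
lemma edge_tr (h : H) (l : Dart H) : edge CN (tr h l) = ac h (edge CN l) := rfl

lemma rev_of_edge {l l' : Dart H} (h : edge CN l' = bar (edge CN l)) : rev CN l l' := by
  simp only [edge, bar, Prod.mk.injEq] at h
  refine ⟨?_, QuotientGroup.eq.1 h.2.symm⟩
  rw [h.1]; cases up l <;> simp

lemma map_ac_ac (g h : H) (X : List (Edge CN)) :
    (X.map (ac h)).map (ac g) = X.map (ac (g * h)) := by simp
lemma map_ac_one (X : List (Edge CN)) : X.map (ac 1) = X := by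
  have : (ac 1 : Edge CN → Edge CN) = id := by funext l; simp
  rw [this]; simp
lemma map_edge_tr (h : H) (X : List (Dart H)) :
    (X.map (tr h)).map (edge CN) = (X.map (edge CN)).map (ac h) := by
  simp [edge_tr]

/-- Fillings of edge paths. -/
inductive Fill (CN : Subgroup H) (k : ℕ) (τ : ℕ → H) : List (Edge CN) → H → ℕ → Prop
  | nil : Fill CN k τ [] 1 0
  | ins (X Y : List (Edge CN)) (g : H) (n : ℕ) (P : List (Dart H)) (q : H) (m : ℕ)
      (h : Fill CN k τ (X ++ Y) g n) (hP : Good CN k τ P q m) :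
      Fill CN k τ (X ++ P.map (edge CN) ++ Y.map (ac q)) (q * g) (m + n)
  | stem (X Y : List (Edge CN)) (g : H) (n : ℕ) (e : Edge CN)
      (h : Fill CN k τ (X ++ Y) g n) : Fill CN k τ (X ++ e :: bar e :: Y) g n

lemma Fill.len {Z : List (Edge CN)} {g : H} {n : ℕ} (h : Fill CN k τ Z g n) :
    Len (ww k τ) g n := by
  induction h with
  | nil => exact Len.one
  | ins X Y g n P q m _ hP ih => exact hP.len.comp ih
  | stem X Y g n e _ ih => exact ih

/-- Position of an element in a concatenation. -/
lemma pos2 {α : Type*} {X Y A B : List α} {e : α} (h : A ++ B = X ++ e :: Y) :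
    (∃ X1, A = X ++ e :: X1 ∧ Y = X1 ++ B) ∨ (∃ B1, B = B1 ++ e :: Y ∧ X = A ++ B1) := by
  rcases List.append_eq_append_iff.1 h with ⟨a, h1, h2⟩ | ⟨c, h1, h2⟩
  · exact Or.inr ⟨a, h2, h1⟩
  · cases c with
    | nil => right; exact ⟨[], by simpa using h2.symm, by simpa using h1.symm⟩
    | cons x c =>
      simp at h2
      obtain ⟨rfl, rfl⟩ := h2
      exact Or.inl ⟨c, h1, rfl⟩

lemma Min.right {w g h : H} {n m : ℕ} (hm : Min w (g * h) (n + m)) (hg : Len w g n) :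
    Min w h m := by
  intro j hj
  have := hm _ (hg.comp hj)
  omega

lemma Min.left {w g h : H} {n m : ℕ} (hm : Min w (g * h) (n + m)) (hh : Len w h m) :
    Min w g n := by
  intro j hj
  have := hm _ (hj.comp hh)
  omega

lemma Fill.congr {Z Z' : List (Edge CN)} {g g' : H} {n n' : ℕ} (h : Fill CN k τ Z g n)
    (h1 : Z = Z') (h2 : g = g') (h3 : n = n') : Fill CN k τ Z' g' n' := by
  subst h1 h2 h3; exact h

lemma Fill.subst (hk : 1 ≤ k) {Z : List (Edge CN)} {g : H} {n : ℕ} (h : Fill CN k τ Z g n) :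
    ∀ (X Y : List (Edge CN)) (e : Edge CN), Z = X ++ e :: Y →
    ∀ (l' : Dart H) (W : List (Dart H)) (q' : H) (n' : ℕ), Good CN k τ (l' :: W) q' n' →
      edge CN l' = bar e → Min (ww k τ) (q' * g) (n + n') →
      Fill CN k τ (X ++ W.map (edge CN) ++ Y.map (ac q')) (q' * g) (n + n') := by
  induction h with
  | nil => intro X Y e h; simp at h
  | ins X0 Y0 g0 n0 P q m hF hP ih =>
    intro X Y e hZ l' W q' n' hG he hm
    rw [List.append_assoc] at hZ
    rcases pos2 hZ with ⟨X1, rfl, rfl⟩ | ⟨B1, hB, rfl⟩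
    · have hm' : Min (ww k τ) (q' * g0) (n0 + n') := by
        apply Min.right (g := q' * q * q'⁻¹) (n := m) _ (hP.len.conj q')
        convert hm using 1
        · group
        · omega
      have h1 := ih X (X1 ++ Y0) e (by simp) l' W q' n' hG he hm'
      have h2 := Fill.ins (X ++ W.map (edge CN) ++ X1.map (ac q')) (Y0.map (ac q')) _ _ _ _ _
        (by simpa using h1) (hP.tr q')
      refine h2.congr ?_ (by group) (by omega)
      rw [map_ac_ac, map_edge_tr]
      simp
    · rcases pos2 hB with ⟨X1, hX1, rfl⟩ | ⟨B2, hB2, rfl⟩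
      · obtain ⟨P1, P2', rfl, rfl, hP2⟩ := List.map_eq_append_iff.1 hX1
        obtain ⟨l, P2, rfl, rfl, rfl⟩ := List.map_eq_cons_iff.1 hP2
        have hm' : Min (ww k τ) (q' * q) (m + n') := by
          apply Min.left (h := g0) (m := n0) _ hF.len
          convert hm using 1
          · group
          · omega
        have h1 := hP.glue_gen hk hG (rev_of_edge he) hm'
        have h2 := Fill.ins X0 Y0 _ _ _ _ _ hF h1
        refine h2.congr ?_ (by group) (by omega)
        simp [edge_tr, Function.comp_def]
      · obtain ⟨Y1, Y2', rfl, rfl, hY2⟩ := List.map_eq_append_iff.1 hB2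
        obtain ⟨e0, Y2, rfl, rfl, rfl⟩ := List.map_eq_cons_iff.1 hY2
        have hm' : Min (ww k τ) (q⁻¹ * q' * q⁻¹⁻¹ * g0) (n0 + n') := by
          apply Min.right (g := q) (n := m) _ hP.len
          convert hm using 1
          · group
          · omega
        have h1 := ih (X0 ++ Y1) Y2 e0 (by simp) _ _ _ _ (hG.tr q⁻¹)
          (by rw [edge_tr, he, ← ac_bar]; simp) hm'
        have h2 := Fill.ins X0 _ _ _ _ _ _ (by rw [List.append_assoc, List.append_assoc] at h1; exact h1) hP
        refine h2.congr ?_ (by group) (by omega)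
        rw [map_edge_tr]
        simp [mul_assoc, Function.comp_def]
  | stem X0 Y0 g0 n0 f hF ih =>
    intro X Y e hZ l' W q' n' hG he hm
    rcases pos2 hZ with ⟨X1, rfl, rfl⟩ | ⟨B1, hB, rfl⟩
    · have h1 := ih X (X1 ++ Y0) e (by simp) l' W q' n' hG he hm
      have h2 := Fill.stem (X ++ W.map (edge CN) ++ X1.map (ac q')) (Y0.map (ac q')) _ _
        (ac q' f) (by simpa using h1)
      refine h2.congr ?_ rfl rfl
      simp [ac_bar]
    · cases B1 with
      | nil =>
        simp at hB
        obtain ⟨rfl, rfl⟩ := hB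
        have h2 := Fill.ins X0 Y0 _ _ _ _ _ hF hG.rot
        refine h2.congr ?_ rfl (by omega)
        simp [edge_tr, he]
      | cons x B1 =>
        simp at hB
        obtain ⟨rfl, hB⟩ := hB
        cases B1 with
        | nil =>
          simp at hB
          obtain ⟨rfl, rfl⟩ := hB
          have h2 := Fill.ins X0 Y0 _ _ _ _ _ hF hG
          refine h2.congr ?_ rfl (by omega)
          simp [he]
        | cons y B2 =>
          simp at hB
          obtain ⟨rfl, rfl⟩ := hB
          have h1 := ih (X0 ++ B2) Y e (by simp) l' W q' n' hG he hm
          have h2 := Fill.stem X0 _ _ _ f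
            (by rw [List.append_assoc, List.append_assoc] at h1; exact h1)
          refine h2.congr ?_ rfl rfl
          simp

/-- Position of two consecutive elements in a concatenation. -/
lemma pos3 {α : Type*} {X Y A B : List α} {e e' : α} (h : A ++ B = X ++ e :: e' :: Y) :
    (∃ X1, A = X ++ e :: e' :: X1 ∧ Y = X1 ++ B) ∨ (A = X ++ [e] ∧ B = e' :: Y) ∨
      (∃ B1, B = B1 ++ e :: e' :: Y ∧ X = A ++ B1) := by
  rcases pos2 h with ⟨X1, rfl, h2⟩ | h2
  · cases X1 with
    | nil => right; left; exact ⟨rfl, by simpa using h2.symm⟩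
    | cons x X1 =>
      simp at h2
      obtain ⟨rfl, rfl⟩ := h2
      exact Or.inl ⟨X1, rfl, rfl⟩
  · exact Or.inr (Or.inr h2)

lemma Fill.fold (hk : 1 ≤ k) (hlrf : ∀ i < 2 * k, LRF CN (τ i)) {Z : List (Edge CN)} {g : H}
    {n : ℕ} (h : Fill CN k τ Z g n) :
    ∀ (X Y : List (Edge CN)) (e : Edge CN), Z = X ++ e :: bar e :: Y →
      Min (ww k τ) g n → Fill CN k τ (X ++ Y) g n := by
  induction h with
  | nil => intro X Y e h; simp at h
  | ins X0 Y0 g0 n0 P q m hF hP ih =>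
    intro X Y e hZ hm
    have hm0 := hm.right hP.len
    rw [List.append_assoc] at hZ
    rcases pos3 hZ with ⟨X1, rfl, rfl⟩ | ⟨rfl, hB⟩ | ⟨B1, hB, rfl⟩
    · have h1 := ih X (X1 ++ Y0) e (by simp) hm0
      have h2 := Fill.ins (X ++ X1) Y0 _ _ _ _ _ (by simpa using h1) hP
      exact h2.congr (by simp) rfl rfl
    · obtain ⟨l, P', θ, rfl, -, -⟩ := hP.fp
      simp at hB
      obtain ⟨hB, rfl⟩ := hB
      have h1 := hF.subst hk X Y0 e (by simp) l P' q m hP hB (by rwa [add_comm])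
      exact h1.congr (by simp) rfl (by omega)
    · rcases pos3 hB with ⟨X1, hX1, rfl⟩ | ⟨hP1, hB1⟩ | ⟨B2, hB2, rfl⟩
      · obtain ⟨P1, P2', rfl, rfl, hP2⟩ := List.map_eq_append_iff.1 hX1
        obtain ⟨l, P3', rfl, rfl, hP3⟩ := List.map_eq_cons_iff.1 hP2
        obtain ⟨l', P3, rfl, he, rfl⟩ := List.map_eq_cons_iff.1 hP3
        have h1 := hP.fold hk hlrf (rev_of_edge he) (hm.left hF.len)
        have h2 := Fill.ins X0 Y0 _ _ _ _ _ hF h1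
        exact h2.congr (by simp) rfl rfl
      · obtain ⟨W, P2', rfl, rfl, hP2⟩ := List.map_eq_append_iff.1 hP1
        obtain ⟨l, P3, rfl, rfl, hP3⟩ := List.map_eq_cons_iff.1 hP2
        simp at hP3
        subst hP3
        obtain ⟨e0, Y2, rfl, he0, rfl⟩ := List.map_eq_cons_iff.1 hB1
        have hG : Good CN k τ ([tr q⁻¹ l] ++ W) q m := by
          apply Good.unrotate
          simpa using hP
        have h1 := hF.subst hk X0 Y2 e0 rfl _ _ q m hG (by
          have : edge CN l = bar (ac q e0) := by rw [he0]; simp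
          rw [edge_tr, this, ← ac_bar]; simp) (by rwa [add_comm])
        exact h1.congr (by simp) rfl (by omega)
      · obtain ⟨Y1, Y2', rfl, rfl, hY2⟩ := List.map_eq_append_iff.1 hB2
        obtain ⟨e0, Y3', rfl, rfl, hY3⟩ := List.map_eq_cons_iff.1 hY2
        obtain ⟨e1, Y3, rfl, he1, rfl⟩ := List.map_eq_cons_iff.1 hY3
        have he : e1 = bar e0 := by
          rw [← ac_bar] at he1
          have := congrArg (ac q⁻¹) he1
          simpa using this
        subst he
        have h1 := ih (X0 ++ Y1) Y3 e0 (by simp) hm0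
        have h2 := Fill.ins X0 (Y1 ++ Y3) _ _ _ _ _ (by simpa using h1) hP
        exact h2.congr (by simp) rfl rfl
  | stem X0 Y0 g0 n0 f hF ih =>
    intro X Y e hZ hm
    rcases pos3 hZ with ⟨X1, rfl, rfl⟩ | ⟨rfl, hB⟩ | ⟨B1, hB, rfl⟩
    · have h1 := ih X (X1 ++ Y0) e (by simp) hm
      have h2 := Fill.stem (X ++ X1) Y0 _ _ f (by simpa using h1)
      exact h2.congr (by simp) rfl rfl
    · simp at hB
      obtain ⟨rfl, rfl⟩ := hB
      exact hF.congr (by simp) rfl rfl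
    · cases B1 with
      | nil =>
        simp at hB
        obtain ⟨rfl, -, rfl⟩ := hB
        simpa using hF
      | cons x B1 =>
        simp at hB
        obtain ⟨rfl, hB⟩ := hB
        cases B1 with
        | nil =>
          simp at hB
          obtain ⟨rfl, rfl⟩ := hB
          exact hF.congr (by simp) rfl rfl
        | cons y B2 =>
          simp at hB
          obtain ⟨rfl, rfl⟩ := hB
          have h1 := ih (X0 ++ B2) Y e (by simp) hm
          have h2 := Fill.stem X0 (B2 ++ Y) _ _ f (by simpa using h1)
          exact h2.congr (by simp) rfl rfl

lemma Fill.nil_one {Z : List (Edge CN)} {g : H} {n : ℕ} (h : Fill CN k τ Z g n)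
    (hZ : Z = []) : g = 1 := by
  cases h with
  | nil => rfl
  | ins X Y g n P q m _ hP =>
    obtain ⟨l, P', θ, rfl, -, -⟩ := hP.fp
    simp at hZ
  | stem X Y g n e _ => simp at hZ

end Kly

namespace Kly

variable {H : Type*} [Group H]

/-- Offset of the origin of an edge. -/
def st (t : H) (b : Bool) : H := if b = true then 1 else t

@[simp] lemma st_true (t : H) : st t true = 1 := rfl
@[simp] lemma st_false (t : H) : st t false = t := rfl

/-- Edge paths in the tree. -/
def IsPath (A CN : Subgroup H) (t : H) : H → List (Edge CN) → H → Prop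
  | x, [], y => x⁻¹ * y ∈ A
  | x, e :: L, y => ∃ f : H, e.2 = QuotientGroup.mk f ∧ x⁻¹ * (f * st t e.1) ∈ A ∧
      IsPath A CN t (f * st t (!e.1)) L y

variable {A CN : Subgroup H} {t : H} {k : ℕ} {τ : ℕ → H}

lemma IsPath.left {x x' y : H} {L : List (Edge CN)} (h : IsPath A CN t x L y)
    (hx : x'⁻¹ * x ∈ A) : IsPath A CN t x' L y := by
  cases L with
  | nil =>
    have := A.mul_mem hx h
    simpa [IsPath, mul_assoc] using this
  | cons e L =>
    obtain ⟨f, h1, h2, h3⟩ := h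
    refine ⟨f, h1, ?_, h3⟩
    have := A.mul_mem hx h2
    simpa [mul_assoc] using this

lemma IsPath.right {x y y' : H} {L : List (Edge CN)} (h : IsPath A CN t x L y)
    (hy : y⁻¹ * y' ∈ A) : IsPath A CN t x L y' := by
  induction L generalizing x with
  | nil =>
    have := A.mul_mem h hy
    simpa [IsPath, mul_assoc] using this
  | cons e L ih =>
    obtain ⟨f, h1, h2, h3⟩ := h
    exact ⟨f, h1, h2, ih h3⟩

lemma isPath_append {x y : H} {L M : List (Edge CN)} :
    IsPath A CN t x (L ++ M) y ↔ ∃ z, IsPath A CN t x L z ∧ IsPath A CN t z M y := by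
  induction L generalizing x with
  | nil =>
    constructor
    · intro h; exact ⟨x, by simp [IsPath, A.one_mem], h⟩
    · rintro ⟨z, h1, h2⟩; exact h2.left h1
  | cons e L ih =>
    constructor
    · rintro ⟨f, h1, h2, h3⟩
      obtain ⟨z, h4, h5⟩ := ih.1 h3
      exact ⟨z, ⟨f, h1, h2, h4⟩, h5⟩
    · rintro ⟨z, ⟨f, h1, h2, h4⟩, h5⟩
      exact ⟨f, h1, h2, ih.2 ⟨z, h4, h5⟩⟩

lemma IsPath.act {x y : H} {L : List (Edge CN)} (h : IsPath A CN t x L y) (g : H) :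
    IsPath A CN t (g * x) (L.map (ac g)) (g * y) := by
  induction L generalizing x with
  | nil => simpa [IsPath, mul_assoc] using h
  | cons e L ih =>
    obtain ⟨f, h1, h2, h3⟩ := h
    refine ⟨g * f, ?_, ?_, ?_⟩
    · simp [ac, h1]
    · simpa [ac, mul_assoc] using h2
    · have := ih h3
      simpa [ac, mul_assoc] using this

/-- Reversed paths. -/
def brev (L : List (Edge CN)) : List (Edge CN) := (L.map bar).reverse

lemma IsPath.brev {x y : H} {L : List (Edge CN)} (h : IsPath A CN t x L y) :
    IsPath A CN t y (brev L) x := by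
  induction L generalizing x with
  | nil =>
    have := A.inv_mem h
    simpa [IsPath, Kly.brev] using this
  | cons e L ih =>
    obtain ⟨f, h1, h2, h3⟩ := h
    have e1 : Kly.brev (e :: L) = Kly.brev L ++ [bar e] := by simp [Kly.brev]
    rw [e1, isPath_append]
    refine ⟨_, ih h3, f, h1, ?_, ?_⟩
    · simp [bar, A.one_mem]
    · have := A.inv_mem h2
      simpa [IsPath, bar] using this

lemma IsPath.fold (hyp : Hyp A CN t) {x y : H} {X Y : List (Edge CN)} {e : Edge CN}
    (h : IsPath A CN t x (X ++ e :: bar e :: Y) y) : IsPath A CN t x (X ++ Y) y := by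
  rw [isPath_append] at h ⊢
  obtain ⟨z, h1, f, h2, h3, f', h4, h5, h6⟩ := h
  refine ⟨z, h1, h6.left ?_⟩
  simp only [bar, Bool.not_not] at *
  have hc : f⁻¹ * f' ∈ CN := QuotientGroup.eq.1 (h2.symm.trans h4)
  have : (st t e.1)⁻¹ * (f⁻¹ * f') * st t e.1 ∈ A := by
    cases e.1
    · exact hyp.cp_le _ hc
    · simpa using hyp.cn_le hc
  have := A.mul_mem h3 this
  convert this using 1
  group

lemma IsPath.word {f y : H} {L : List (Edge CN)} {e : Edge CN}
    (h1 : e.2 = QuotientGroup.mk f) (h3 : IsPath A CN t (f * st t (!e.1)) L y)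
    (hred : (e :: L).IsChain (fun e e' => e' ≠ bar e)) :
    ∃ a M, f * st t (!e.1) * a * wprod t M = y ∧ (∀ z ∈ (e.1, a) :: M, z.2 ∈ A) ∧
      ((e.1, a) :: M).IsChain (fun x y => x.1 ≠ y.1 → ¬ inC t CN x.1 x.2) := by
  induction L generalizing f e with
  | nil =>
    refine ⟨(f * st t (!e.1))⁻¹ * y, [], by rw [wprod_nil, mul_one, mul_inv_cancel_left], ?_,
      by simp⟩
    intro z hz
    simp at hz
    subst hz
    simpa [IsPath] using h3
  | cons e2 L ih =>
    obtain ⟨f2, g1, g2, g0⟩ := h3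
    rw [List.isChain_cons_cons] at hred
    obtain ⟨a2, M2, g3, g4, g5⟩ := ih g1 g0 hred.2
    refine ⟨(f * st t (!e.1))⁻¹ * (f2 * st t e2.1), (e2.1, a2) :: M2, ?_, ?_, ?_⟩
    · rw [← g3, wprod_cons]
      have : sg t e2.1 = (st t e2.1)⁻¹ * st t (!e2.1) := by cases e2.1 <;> simp
      simp only [this]
      group
    · intro z hz
      rcases List.mem_cons.1 hz with rfl | hz
      · exact g2
      · exact g4 z hz
    · rw [List.isChain_cons_cons]
      refine ⟨?_, g5⟩
      intro hne hin
      simp only at hne hin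
      apply hred.1
      have hb : e2.1 = !e.1 := by revert hne; cases e.1 <;> cases e2.1 <;> simp
      refine Prod.ext hb ?_
      rw [g1, bar, h1]
      apply Eq.symm
      apply QuotientGroup.eq.2
      rw [hb] at hin
      revert hin
      cases e.1
      · simp
      · simp [mul_assoc]

lemma exists_backtrack (hyp : Hyp A CN t) {x : H} {L : List (Edge CN)} (hL : L ≠ [])
    (h : IsPath A CN t x L x) : ∃ X e Y, L = X ++ e :: bar e :: Y := by
  by_contra hcon
  have hred : L.IsChain (fun e e' => e' ≠ bar e) := by
    rw [List.isChain_iff_forall_rel_of_append_cons_cons]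
    intro a b l1 l2 h1 h2
    subst h2
    exact hcon ⟨l1, a, l2, h1⟩
  obtain ⟨e, L, rfl⟩ := List.exists_cons_of_ne_nil hL
  obtain ⟨f, h1, h2, h3⟩ := h
  have h6 := h3.right h2
  obtain ⟨a, M, h7, h4, h5⟩ := IsPath.word h1 h6 hred
  apply hyp.brit _ (by simp) h4 h5
  rw [wprod_cons]
  have : sg t e.1 = (st t e.1)⁻¹ * st t (!e.1) := by cases e.1 <;> simp
  simp only [this]
  have e2 : f * (st t (!e.1) * a * wprod t M) = f * st t e.1 := by rw [← h7]; group
  rw [← mul_left_cancel e2]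
  group

lemma connected (hyp : Hyp A CN t) (x y : H) : ∃ L, IsPath A CN t x L y := by
  have key : ∀ h : H, ∀ x, ∃ L, IsPath A CN t x L (x * h) := by
    intro h
    have hh : h ∈ Subgroup.closure ((A : Set H) ∪ {t}) := by rw [hyp.gen]; trivial
    induction hh using Subgroup.closure_induction with
    | mem g hg =>
      intro x
      rcases hg with hg | hg
      · exact ⟨[], by simpa [IsPath] using hg⟩
      · have hg' : g = t := hg
        subst hg'
        exact ⟨[(true, QuotientGroup.mk x)], x, rfl, by simp [A.one_mem], by
          simp [IsPath, A.one_mem]⟩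
    | one => intro x; exact ⟨[], by simp [IsPath, A.one_mem]⟩
    | mul g h _ _ ig ih =>
      intro x
      obtain ⟨L, hL⟩ := ig x
      obtain ⟨M, hM⟩ := ih (x * g)
      exact ⟨L ++ M, isPath_append.2 ⟨_, hL, by simpa [mul_assoc] using hM⟩⟩
    | inv g _ ig =>
      intro x
      obtain ⟨L, hL⟩ := ig (x * g⁻¹)
      exact ⟨Kly.brev L, by simpa using hL.brev⟩
  obtain ⟨L, hL⟩ := key (x⁻¹ * y) x
  exact ⟨L, by simpa using hL⟩

/-- Origin of a dart. -/
def org (t : H) (l : Dart H) : H := l.f * st t (up l)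

lemma corner (hT : Tau A CN t k τ) (l : Dart H) (hl : l.i ≤ 2 * k) :
    (l.f * st t (!up l))⁻¹ * org t (suc k τ l) ∈ A := by
  obtain ⟨f, s, i⟩ := l
  simp only at hl
  unfold org
  cases s
  · by_cases h0 : i = 0
    · subst h0
      have := A.inv_mem hT.last
      simpa [up, suc, prv, mul_assoc] using this
    · obtain ⟨j, rfl⟩ : ∃ j, i = j + 1 := ⟨i - 1, by omega⟩
      rcases Nat.mod_two_eq_zero_or_one j with h1 | h1
      · have h2 : (j + 1) % 2 = 1 := by omega
        have := A.inv_mem (mem_cj.1 (hT.even j (by omega) h1))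
        simpa [up, suc, prv, mul_assoc, h1, h2] using this
      · have h2 : (j + 1) % 2 = 0 := by omega
        have := A.inv_mem (hT.odd j (by omega) h1)
        simpa [up, suc, prv, mul_assoc, h1, h2] using this
  · by_cases h0 : i = 2 * k
    · subst h0
      have := hT.last
      simpa [up, suc, nxt, mul_assoc] using this
    · rcases Nat.mod_two_eq_zero_or_one i with h1 | h1
      · have h2 : (i + 1) % 2 = 1 := by omega
        have := mem_cj.1 (hT.even i (by omega) h1)
        simpa [up, suc, nxt, mul_assoc, h1, h2, h0] using this
      · have h2 : (i + 1) % 2 = 0 := by omega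
        have := hT.odd i (by omega) h1
        simpa [up, suc, nxt, mul_assoc, h1, h2, h0] using this

lemma orb_path (hT : Tau A CN t k τ) (m : ℕ) (l : Dart H) (hl : l.i ≤ 2 * k) :
    IsPath A CN t (org t l) ((l :: orb k τ m l).map (edge CN))
      (org t ((suc k τ)^[m + 1] l)) := by
  induction m generalizing l with
  | zero =>
    exact ⟨l.f, rfl, by simp [org, edge, A.one_mem], corner hT l hl⟩
  | succ m ih =>
    refine ⟨l.f, rfl, by simp [org, edge, A.one_mem], ?_⟩
    exact (ih (suc k τ l) (suc_le hl)).left (corner hT l hl)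

lemma cell_path (hT : Tau A CN t k τ) (f : H) (s : Bool) : ∃ z,
    IsPath A CN t z ((⟨f, s, 0⟩ :: orb k τ (2 * k) ⟨f, s, 0⟩ : List (Dart H)).map (edge CN))
      (f * sg (ww k τ) s * f⁻¹ * z) := by
  refine ⟨org t ⟨f, s, 0⟩, ?_⟩
  have h := orb_path hT (2 * k) ⟨f, s, 0⟩ (by simp)
  convert h using 1
  cases s
  · rw [iter_false f (2 * k) le_rfl]
    simp [Pi_zero, org, up, mul_assoc]
  · rw [iter_true_last]
    simp [org, up, mul_assoc]

lemma Fill.stems {X Y : List (Edge CN)} {g : H} {n : ℕ} (S : List (Edge CN))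
    (h : Fill CN k τ (X ++ Y) g n) : Fill CN k τ (X ++ S ++ brev S ++ Y) g n := by
  induction S generalizing X Y with
  | nil => simpa [brev] using h
  | cons e S ih =>
    have h1 := Fill.stem X Y g n e h
    have h2 := ih (X := X ++ [e]) (Y := bar e :: Y) (by simpa using h1)
    simpa [brev] using h2

lemma exists_fill (hyp : Hyp A CN t) (hT : Tau A CN t k τ) {g : H} {n : ℕ}
    (h : Len (ww k τ) g n) : ∃ Z, Fill CN k τ Z g n ∧ IsPath A CN t 1 Z g := by
  induction h with
  | one => exact ⟨[], Fill.nil, by simp [IsPath, A.one_mem]⟩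
  | mul u g s n _ ih =>
    obtain ⟨Z, h1, h2⟩ := ih
    obtain ⟨z, hz⟩ := cell_path hT u s
    obtain ⟨S, hS⟩ := connected hyp 1 z
    have h3 := Fill.stems (X := []) S (by simpa using h1)
    have h4 := Fill.ins S (brev S ++ Z) _ _ _ _ _ (by simpa using h3)
      (cell_good (CN := CN) (τ := τ) hT.hk u s)
    refine ⟨_, by rw [add_comm]; exact h4, ?_⟩
    rw [isPath_append]
    refine ⟨_, isPath_append.2 ⟨_, hS, hz⟩, ?_⟩
    apply IsPath.act
    exact isPath_append.2 ⟨_, hS.brev, h2⟩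

lemma fill_trivial (hyp : Hyp A CN t) (hT : Tau A CN t k τ) (m : ℕ) :
    ∀ (Z : List (Edge CN)) (g : H) (n : ℕ), Z.length ≤ m → Fill CN k τ Z g n →
      IsPath A CN t 1 Z 1 → Min (ww k τ) g n → g = 1 := by
  induction m with
  | zero =>
    intro Z g n hZ h _ _
    exact h.nil_one (List.length_eq_zero_iff.1 (by omega))
  | succ m ih =>
    intro Z g n hZ h hp hm
    by_cases h0 : Z = []
    · exact h.nil_one h0
    · obtain ⟨X, e, Y, rfl⟩ := exists_backtrack hyp h0 hp
      refine ih (X ++ Y) g n ?_ (h.fold hT.hk (fun i hi => hT.lrf hyp hi) X Y e rfl hm)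
        (hp.fold hyp) hm
      simp at hZ ⊢
      omega

theorem core (hyp : Hyp A CN t) (hT : Tau A CN t k τ) {a : H} (ha : a ∈ A) {n : ℕ}
    (h : Len (ww k τ) a n) : a = 1 := by
  classical
  have hex : ∃ n, Len (ww k τ) a n := ⟨n, h⟩
  obtain ⟨Z, h1, h2⟩ := exists_fill hyp hT (Nat.find_spec hex)
  refine fill_trivial hyp hT _ Z a _ le_rfl h1 (h2.right (by simpa using A.inv_mem ha)) ?_
  intro m hm
  exact Nat.find_min' hex hm

end Kly

namespace Kly

variable {H : Type*} [Group H]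

lemma Len.inv {w g : H} {n : ℕ} (h : Len w g n) : Len w g⁻¹ n := by
  induction h with
  | one => simpa using Len.one
  | mul u g s n _ ih =>
    have h1 := ih.comp (Len.single w u (!s))
    convert h1 using 1
    rw [mul_inv_rev]
    congr 1
    cases s <;> simp [mul_assoc]

lemma len_of_mem {w v g : H} (hc : IsConj w v) (h : g ∈ Subgroup.normalClosure {w}) :
    ∃ n, Len v g n := by
  unfold Subgroup.normalClosure at h
  induction h using Subgroup.closure_induction with
  | mem x hx =>
    rw [Group.mem_conjugatesOfSet_iff] at hx
    obtain ⟨a, ha, hx⟩ := hx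
    have ha' : a = w := ha
    subst ha'
    obtain ⟨c, hc⟩ := isConj_iff.1 (hc.symm.trans hx)
    exact ⟨1, by simpa [hc] using Len.single v c true⟩
  | one => exact ⟨0, Len.one⟩
  | mul x y _ _ hx hy =>
    obtain ⟨n, hn⟩ := hx
    obtain ⟨m, hm⟩ := hy
    exact ⟨_, hn.comp hm⟩
  | inv x _ hx =>
    obtain ⟨n, hn⟩ := hx
    exact ⟨n, hn.inv⟩

lemma main_one {A CN : Subgroup H} {t : H} (hyp : Hyp A CN t) (p : H →* Multiplicative ℤ)
    (hpt : p t = Multiplicative.ofAdd 1) (hpA : ∀ a ∈ A, p a = 1) (w : H)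
    (hw : p w = Multiplicative.ofAdd 1) (hno : ∀ a ∈ A, ¬ IsConj (a * t) w)
    {a : H} (ha : a ∈ A) (h : a ∈ Subgroup.normalClosure {w}) : a = 1 := by
  obtain ⟨B, CB, k, τ, hAB, hB, hT, hc⟩ := word_form hyp p hpt hpA w hw hno
  obtain ⟨n, hn⟩ := len_of_mem hc h
  exact core hB hT (hAB ha) hn

lemma main_both {A CN : Subgroup H} {t : H} (hyp : Hyp A CN t) (p : H →* Multiplicative ℤ)
    (hpt : p t = Multiplicative.ofAdd 1) (hpA : ∀ a ∈ A, p a = 1) (w : H)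
    (hw : p w = Multiplicative.ofAdd 1 ∨ p w = Multiplicative.ofAdd (-1))
    (hno : ∀ a ∈ A, ¬ IsConj (a * t) w ∧ ¬ IsConj (a * t⁻¹) w)
    {a : H} (ha : a ∈ A) (h : a ∈ Subgroup.normalClosure {w}) : a = 1 := by
  rcases hw with hw | hw
  · exact main_one hyp p hpt hpA w hw (fun a ha => (hno a ha).1) ha h
  · refine main_one hyp p hpt hpA w⁻¹ (by rw [map_inv, hw]; rfl) ?_ ha ?_
    · intro b hb hc
      apply (hno b⁻¹ (A.inv_mem hb)).2
      obtain ⟨c, hc⟩ := isConj_iff.1 hc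
      refine isConj_of_mul (c * b) _ _ ?_
      rw [← inv_inv w, ← hc]
      group
    · have : Subgroup.normalClosure {w} ≤ Subgroup.normalClosure {w⁻¹} := by
        apply Subgroup.normalClosure_le_normal
        rintro x rfl
        have := Subgroup.inv_mem _ (Subgroup.subset_normalClosure (s := {x⁻¹}) rfl)
        simpa using this
      exact this h

end Kly

/-- Freiheitssatz for HNN extensions over `∞`-RF pairs: if both `(A, i_P(C))` and `(A, i_N(C))`
are `∞`-RF and `w ∈ A ∗_C` has `p w = ±1` and is not conjugate to `a·t^{±1}`, then the natural
map `A → (A ∗_C)/⟪w⟫` is injective. -/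
theorem stmt2 {C A : Type} [Group C] [Group A] (iP iN : C →* A)
    (hiP : Function.Injective iP) (hiN : Function.Injective iN)
    (hP : ∀ a : A, a ∉ iP.range → IsRF iP.range ⊤ a)
    (hN : ∀ a : A, a ∉ iN.range → IsRF iN.range ⊤ a)
    (w : HNNExtension A iP.range iN.range (hnnφ iP iN hiP hiN))
    (hpw : hnnProj iP iN hiP hiN w = Multiplicative.ofAdd 1 ∨
           hnnProj iP iN hiP hiN w = Multiplicative.ofAdd (-1))
    (hnotconj : ∀ a : A, ¬ IsConj (HNNExtension.of a * HNNExtension.t) w ∧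
                         ¬ IsConj (HNNExtension.of a * (HNNExtension.t)⁻¹) w) :
    Function.Injective ((QuotientGroup.mk' (Subgroup.normalClosure {w})).comp
      (HNNExtension.of :
        A →* HNNExtension A iP.range iN.range (hnnφ iP iN hiP hiN))) := by
  rw [injective_iff_map_eq_one]
  intro a ha
  have ha' : (HNNExtension.of a : HNNExtension A iP.range iN.range (hnnφ iP iN hiP hiN)) ∈
      Subgroup.normalClosure {w} := by
    rw [← QuotientGroup.eq_one_iff]; exact ha
  have h1 := Kly.main_both (Kly.hyp_init iP iN hiP hiN hP hN) (hnnProj iP iN hiP hiN)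
    (by simp [hnnProj]) (by rintro _ ⟨b, rfl⟩; simp [hnnProj]) w hpw
    (by rintro _ ⟨b, rfl⟩; exact hnotconj b) ⟨a, rfl⟩ ha'
  exact HNNExtension.of_injective _ (by simpa using h1)
end

section
/- Let H = A∗_C be the HNN extension associated to injections i_P, i_N : C → A whose images C_P, C_N are malnormal subgroups of A. Let w ∈ H with p(w) = 1 or p(w) = −1, suppose w is not conjugate in H to a·t or to a·t⁻¹ for any a ∈ A, and let m ≥ 2 be an integer. Then the natural homomorphism A → H/⟪w^m⟫ is injective. -/
/-- A subgroup `C ≤ A` is malnormal if `aCa⁻¹ ∩ C = {1}` for every `a ∈ A \ C`. -/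
def Malnormal {A : Type} [Group A] (C : Subgroup A) : Prop :=
  ∀ a : A, a ∉ C → ∀ c : A, c ∈ C → a * c * a⁻¹ ∈ C → c = 1

section Amalgam

open Monoid

/-- Amalgamated product of two copies of `G` along two maps `C → G`. -/
abbrev Am {C G : Type} [Group C] [Group G] (φ : Bool → C →* G) : Type :=
  PushoutI (G := fun _ : Bool => G) φ

/-- The two inclusions into the amalgamated product. -/
noncomputable abbrev am {C G : Type} [Group C] [Group G] (φ : Bool → C →* G) (i : Bool) :
    G →* Am φ := PushoutI.of (G := fun _ : Bool => G) (φ := φ) i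

/-- Elements with a reduced expression starting in factor `i` and ending in factor `j`. -/
inductive Red {C G : Type} [Group C] [Group G] (φ : Bool → C →* G) : Bool → Bool → Am φ → Prop
  | single (i : Bool) (x : G) (hx : x ∉ (φ i).range) : Red φ i i (am φ i x)
  | append {i j k l : Bool} {x y : Am φ} (hx : Red φ i j x) (hjk : j ≠ k) (hy : Red φ k l y) :
      Red φ i l (x * y)

variable {C G : Type} [Group C] [Group G] {φ : Bool → C →* G}

theorem Red.inv {i j : Bool} {x : Am φ} (h : Red φ i j x) : Red φ j i x⁻¹ := by
  induction h with
  | single i x hx => rw [← map_inv]; exact .single i _ (by simpa using hx)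
  | append hx hjk hy ihx ihy => rw [mul_inv_rev]; exact .append ihy hjk.symm ihx

theorem Red.exists_neWord {i j : Bool} {x : Am φ} (h : Red φ i j x) :
    ∃ w : CoprodI.NeWord (fun _ : Bool => G) i j,
      PushoutI.Reduced φ w.toWord ∧ PushoutI.ofCoprodI w.prod = x := by
  induction h with
  | single i x hx =>
    refine ⟨.singleton x (by rintro rfl; exact hx (one_mem _)), ?_, ?_⟩
    · intro g hg
      simp only [CoprodI.NeWord.toWord, CoprodI.NeWord.toList, List.mem_singleton] at hg
      subst hg; exact hx
    · simp
  | append hx hjk hy ihx ihy =>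
    obtain ⟨w1, h1, e1⟩ := ihx
    obtain ⟨w2, h2, e2⟩ := ihy
    refine ⟨.append w1 hjk w2, ?_, ?_⟩
    · intro g hg
      simp only [CoprodI.NeWord.toWord, CoprodI.NeWord.toList, List.mem_append] at hg
      rcases hg with hg | hg
      · exact h1 g hg
      · exact h2 g hg
    · simp [e1, e2]

theorem Red.ne_one (hφ : ∀ i, Function.Injective (φ i)) {i j : Bool} {x : Am φ}
    (h : Red φ i j x) : x ≠ 1 := by
  rintro rfl
  obtain ⟨w, hw, e⟩ := h.exists_neWord
  have := hw.eq_empty_of_mem_range hφ (by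
    change PushoutI.ofCoprodI w.prod ∈ _
    rw [e]; exact one_mem _)
  exact w.toList_ne_nil (congrArg CoprodI.Word.toList this)

theorem Red.peel {i j : Bool} {g : Am φ} (h : Red φ i j g) :
    ∃ x, x ∉ (φ i).range ∧ ((i = j ∧ g = am φ i x) ∨
      ∃ g', Red φ (!i) j g' ∧ g = am φ i x * g') := by
  induction h with
  | single i x hx => exact ⟨x, hx, .inl ⟨rfl, rfl⟩⟩
  | @append i j k l x y hx hjk hy ihx ihy =>
    obtain ⟨z, hz, ⟨rfl, rfl⟩ | ⟨g', hg', rfl⟩⟩ := ihx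
    · have : k = !i := by cases i <;> cases k <;> simp_all
      subst this
      exact ⟨z, hz, .inr ⟨y, hy, rfl⟩⟩
    · exact ⟨z, hz, .inr ⟨g' * y, .append hg' hjk hy, by rw [mul_assoc]⟩⟩

theorem Red.peelRight {i j : Bool} {g : Am φ} (h : Red φ i j g) :
    ∃ x, x ∉ (φ j).range ∧ ((i = j ∧ g = am φ j x) ∨
      ∃ g', Red φ i (!j) g' ∧ g = g' * am φ j x) := by
  obtain ⟨x, hx, ⟨rfl, e⟩ | ⟨g', hg', e⟩⟩ := h.inv.peel
  · exact ⟨x⁻¹, by simpa using hx, .inl ⟨rfl, by rw [map_inv, ← e, inv_inv]⟩⟩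
  · exact ⟨x⁻¹, by simpa using hx, .inr ⟨g'⁻¹, hg'.inv, by
      rw [map_inv, ← mul_inv_rev, ← e, inv_inv]⟩⟩

/-- Key lemma: conjugating a nontrivial letter by a reduced element. -/
theorem Red.conj (hφ : ∀ i, Function.Injective (φ i))
    {i j : Bool} (hM : Malnormal (φ j).range) {v : Am φ} (h : Red φ i j v)
    {x : G} (hx : x ≠ 1) : Red φ i i (v * am φ (!j) x * v⁻¹) := by
  by_cases hr : x ∈ (φ (!j)).range
  · obtain ⟨c, rfl⟩ := hr
    have hc : am φ (!j) (φ (!j) c) = am φ j (φ j c) := by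
      rw [am, am, PushoutI.of_apply_eq_base φ, PushoutI.of_apply_eq_base φ]
    have hc1 : φ j c ≠ 1 := by
      intro h1
      have : c = 1 := hφ j (by rw [h1, map_one])
      exact hx (by rw [this, map_one])
    rw [hc]
    have key : ∀ y, y ∉ (φ j).range → y * φ j c * y⁻¹ ∉ (φ j).range :=
      fun y hy hmem => hc1 (hM y hy _ ⟨c, rfl⟩ hmem)
    obtain ⟨y, hy, ⟨rfl, rfl⟩ | ⟨g', hg', rfl⟩⟩ := h.peelRight
    · have := Red.single (φ := φ) i _ (key y hy)
      simpa only [map_mul, map_inv] using this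
    · have h2 := Red.single (φ := φ) j _ (key y hy)
      have h3 := Red.append (Red.append hg' (by simp) h2) (by simp) hg'.inv
      have e : g' * am φ j y * am φ j (φ j c) * (g' * am φ j y)⁻¹
          = g' * am φ j (y * φ j c * y⁻¹) * g'⁻¹ := by
        simp only [map_mul, map_inv]; group
      rw [e]; exact h3
  · refine .append (.append h (by simp) (.single _ _ hr)) (by simp) h.inv

/-- Every element is a base element times a reduced element (or one). -/
theorem exists_red (hφ : ∀ i, Function.Injective (φ i)) (g : Am φ) :
    ∃ c : C, g = PushoutI.base φ c ∨ ∃ i j g', Red φ i j g' ∧ g = PushoutI.base φ c * g' := by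
  classical
  obtain ⟨d⟩ := PushoutI.NormalWord.transversal_nonempty φ hφ
  obtain ⟨w, rfl⟩ : ∃ w : PushoutI.NormalWord d, w.prod = g :=
    ⟨g • PushoutI.NormalWord.empty, by
      rw [PushoutI.NormalWord.prod_smul, PushoutI.NormalWord.prod_empty, mul_one]⟩
  refine ⟨w.head, ?_⟩
  have hred : PushoutI.Reduced φ w.toWord := by
    rintro ⟨i, x⟩ hx hr
    have h1 := w.normalized i x hx
    have h2 := w.ne_one ⟨i, x⟩ hx
    apply h2
    have h3 := d.compl i
    have := h3.1 (a₁ := (⟨⟨x, hr⟩, ⟨1, d.one_mem i⟩⟩ : (φ i).range × d.set i))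
      (a₂ := (⟨1, ⟨x, h1⟩⟩ : (φ i).range × d.set i)) (by simp)
    simpa using congrArg (fun z => (z.1 : G)) this
  by_cases he : w.toWord = CoprodI.Word.empty
  · left; simp [PushoutI.NormalWord.prod, he]
  · right
    obtain ⟨i, j, w', hw'⟩ := CoprodI.NeWord.of_word _ he
    refine ⟨i, j, PushoutI.ofCoprodI w'.prod, ?_, ?_⟩
    · rw [← hw'] at hred
      clear hw' he
      induction w' with
      | singleton x hx =>
        rw [CoprodI.NeWord.prod_singleton, PushoutI.ofCoprodI_of]
        exact .single _ _ (hred ⟨_, x⟩ (by simp [CoprodI.NeWord.toWord]))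
      | append w1 hne w2 ih1 ih2 =>
        rw [CoprodI.NeWord.append_prod, map_mul]
        refine .append (ih1 ?_) hne (ih2 ?_)
        · intro y hy; exact hred y (by
            simp only [CoprodI.NeWord.toWord, CoprodI.NeWord.toList, List.mem_append] at hy ⊢
            exact .inl hy)
        · intro y hy; exact hred y (by
            simp only [CoprodI.NeWord.toWord, CoprodI.NeWord.toList, List.mem_append] at hy ⊢
            exact .inr hy)
    · rw [PushoutI.NormalWord.prod, ← hw']; rfl

/-- Double coset decomposition. -/
theorem exists_decomp (hφ : ∀ i, Function.Injective (φ i)) (i j : Bool) (g : Am φ) :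
    (∃ a b, g = am φ i a * am φ j b) ∨
      ∃ a b g', Red φ (!i) (!j) g' ∧ g = am φ i a * g' * am φ j b := by
  obtain ⟨c, rfl | ⟨k, l, g0, h0, rfl⟩⟩ := exists_red hφ g
  · exact .inl ⟨φ i c, 1, by rw [map_one, mul_one, am, PushoutI.of_apply_eq_base φ]⟩
  rw [← PushoutI.of_apply_eq_base φ i]
  change (∃ a b, am φ i (φ i c) * g0 = _) ∨ ∃ a b g', _ ∧ am φ i (φ i c) * g0 = _
  generalize φ i c = z
  -- second step: fix the right-hand side
  have step : ∀ (z : G) (g1 : Am φ), Red φ (!i) l g1 →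
      (∃ a b, am φ i z * g1 = am φ i a * am φ j b) ∨
      ∃ a b g', Red φ (!i) (!j) g' ∧ am φ i z * g1 = am φ i a * g' * am φ j b := by
    intro z g1 h1
    by_cases hl : l = j
    · subst hl
      obtain ⟨y, hy, ⟨_, rfl⟩ | ⟨g', hg', rfl⟩⟩ := h1.peelRight
      · exact .inl ⟨z, y, rfl⟩
      · exact .inr ⟨z, y, g', hg', by rw [mul_assoc]⟩
    · have : l = !j := by cases l <;> cases j <;> simp_all
      subst this
      exact .inr ⟨z, 1, g1, h1, by simp⟩
  by_cases hk : k = i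
  · subst hk
    obtain ⟨y, hy, ⟨_, rfl⟩ | ⟨g', hg', rfl⟩⟩ := h0.peel
    · exact .inl ⟨z * y, 1, by simp⟩
    · have := step (z * y) g' hg'
      rwa [map_mul, mul_assoc] at this
  · have : k = !i := by cases k <;> cases i <;> simp_all
    subst this
    exact step z g0 h0

theorem Red.not_mem (hφ : ∀ i, Function.Injective (φ i)) {i : Bool} {x : Am φ}
    (h : Red φ (!i) (!i) x) (y : G) : x ≠ am φ i y := by
  rintro rfl
  by_cases hr : y ∈ (φ i).range
  · obtain ⟨c, rfl⟩ := hr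
    obtain ⟨w, hw, e⟩ := h.exists_neWord
    have := hw.eq_empty_of_mem_range hφ (by
      change PushoutI.ofCoprodI w.prod ∈ _
      rw [e, am, PushoutI.of_apply_eq_base φ]; exact ⟨c, rfl⟩)
    exact w.toList_ne_nil (congrArg CoprodI.Word.toList this)
  · have := Red.append h (by simp) (Red.single i y⁻¹ (by simpa using hr))
    exact this.ne_one hφ (by simp)

/-- The factors of an amalgam are malnormal if the amalgamated subgroup is malnormal in the
other factor. -/
theorem malnormal_factor (hφ : ∀ i, Function.Injective (φ i)) (i : Bool)
    (hM : Malnormal (φ (!i)).range) : Malnormal (am φ i).range := by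
  rintro g hg _ ⟨x, rfl⟩ ⟨y, hy⟩
  by_contra hx
  have hx : x ≠ 1 := by rintro rfl; exact hx (map_one _)
  rcases exists_decomp hφ i i g with ⟨a, b, rfl⟩ | ⟨a, b, g', hg', rfl⟩
  · exact hg ⟨a * b, map_mul _ _ _⟩
  have h1 := hg'.conj hφ hM (x := b * x * b⁻¹) (by
    intro h; apply hx; simpa using h)
  rw [Bool.not_not] at h1
  refine h1.not_mem hφ (a⁻¹ * y * a) ?_
  have e : am φ i (a⁻¹ * y * a) = (am φ i a)⁻¹ * am φ i y * am φ i a := by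
    simp only [map_mul, map_inv]
  rw [e, hy]
  simp only [map_mul, map_inv]; group

/-- A family of homs whose nontrivial values are reduced induces an injection of the free
product. -/
theorem lift_injective_of_red (hφ : ∀ i, Function.Injective (φ i)) {L : Type} [Group L]
    (e : Bool → Bool) (he : Function.Injective e) (f : Bool → L →* Am φ)
    (hf : ∀ i x, x ≠ 1 → Red φ (e i) (e i) (f i x)) :
    Function.Injective (CoprodI.lift (M := fun _ : Bool => L) f) := by
  classical
  rw [injective_iff_map_eq_one]
  intro x hx
  by_contra hne
  obtain ⟨w, rfl⟩ : ∃ w : CoprodI.Word (fun _ : Bool => L), w.prod = x :=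
    ⟨CoprodI.Word.equiv x, CoprodI.Word.equiv.left_inv x⟩
  have hw : w ≠ CoprodI.Word.empty := by rintro rfl; exact hne (by simp)
  obtain ⟨i, j, w', rfl⟩ := CoprodI.NeWord.of_word w hw
  have : ∀ {i j} (w : CoprodI.NeWord (fun _ : Bool => L) i j),
      Red φ (e i) (e j) (CoprodI.lift f w.prod) := by
    intro i j w
    induction w with
    | singleton x hx => simpa using hf _ x hx
    | append w1 hne w2 ih1 ih2 =>
      rw [CoprodI.NeWord.append_prod, map_mul]
      exact .append ih1 (he.ne hne) ih2
  exact (this w').ne_one hφ hx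

/-- The free product of a factor and a conjugate of the other factor. -/
theorem conj_factors_injective (hφ : ∀ i, Function.Injective (φ i))
    (hM : ∀ i, Malnormal (φ i).range) (u : Am φ)
    (hu : ∀ a b, u ≠ am φ false a * am φ true b) :
    Function.Injective (CoprodI.lift (M := fun _ : Bool => G)
      (fun i => bif i then (MulAut.conj u).toMonoidHom.comp (am φ true) else am φ false)) := by
  rcases exists_decomp hφ false true u with ⟨a, b, h⟩ | ⟨a, b, u', hu', rfl⟩
  · exact absurd h (hu a b)
  obtain ⟨z, hz, ⟨h, _⟩ | ⟨v, hv, rfl⟩⟩ := hu'.peel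
  · simp at h
  simp only [Bool.not_false, Bool.not_true] at hv hz
  set u := am φ false a * (am φ (!false) z * v) * am φ true b with hudef
  set g := am φ false a * am φ true z with hg
  have key := lift_injective_of_red hφ (L := G) (fun i => !i) Bool.not_injective
    (fun i => (MulAut.conj g⁻¹).toMonoidHom.comp
      (bif i then (MulAut.conj u).toMonoidHom.comp (am φ true) else am φ false)) (by
      intro i x hx
      cases i
      · have h1 := Red.conj hφ (hM true) (Red.single (φ := φ) true z hz).inv
          (x := a⁻¹ * x * a) (by
            intro h; apply hx
            have : x = a * (a⁻¹ * x * a) * a⁻¹ := by group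
            rw [this, h]; group)
        have e : ∀ y, ((MulAut.conj g⁻¹).toMonoidHom.comp (am φ false)) y
            = (am φ true z)⁻¹ * am φ false (a⁻¹ * y * a) * (am φ true z)⁻¹⁻¹ := by
          intro y
          simp [hg, mul_assoc]
        change Red φ true true (((MulAut.conj g⁻¹).toMonoidHom.comp (am φ false)) x)
        rw [e]; exact h1
      · have h1 := Red.conj hφ (hM false) hv (x := b * x * b⁻¹) (by
          intro h; apply hx; simpa using h)
        have e : ∀ y, ((MulAut.conj g⁻¹).toMonoidHom.comp
            ((MulAut.conj u).toMonoidHom.comp (am φ true))) y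
            = v * am φ true (b * y * b⁻¹) * v⁻¹ := by
          intro y
          simp [hg, hudef, mul_assoc]
        change Red φ false false (((MulAut.conj g⁻¹).toMonoidHom.comp
            ((MulAut.conj u).toMonoidHom.comp (am φ true))) x)
        rw [e]; exact h1)
  have hcomp : CoprodI.lift (M := fun _ : Bool => G) (fun i => (MulAut.conj g⁻¹).toMonoidHom.comp
      (bif i then (MulAut.conj u).toMonoidHom.comp (am φ true) else am φ false))
      = (MulAut.conj g⁻¹).toMonoidHom.comp (CoprodI.lift (M := fun _ : Bool => G)
      (fun i => bif i then (MulAut.conj u).toMonoidHom.comp (am φ true) else am φ false)) := by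
    apply CoprodI.ext_hom
    intro i
    ext x
    simp
  rw [hcomp] at key
  rw [MonoidHom.coe_comp] at key
  exact Function.Injective.of_comp key

/-- A group containing `A` and an element `s` with `s ^ m = 1` such that `A` and `s A s⁻¹`
generate their free product. -/
theorem exists_cyclic (A : Type) [Group A] (m : ℕ) (hm : 2 ≤ m) :
    ∃ (L : Type) (_ : Group L) (j : A →* L) (s : L), s ^ m = 1 ∧
      Function.Injective (CoprodI.lift (M := fun _ : Bool => A)
        (fun i => bif i then (MulAut.conj s).toMonoidHom.comp j else j)) := by
  let Z := Multiplicative (ZMod m)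
  let φ : Bool → Unit →* (A × Z) := fun _ => 1
  have hφ : ∀ i, Function.Injective (φ i) := fun i => Function.injective_of_subsingleton _
  have hM : ∀ i, Malnormal (φ i).range := by
    rintro i a - c ⟨_, rfl⟩ -
    rfl
  have hmem : ∀ i x, x ≠ 1 → x ∉ (φ i).range := by
    rintro i x hx ⟨_, rfl⟩
    exact hx rfl
  let σ : Z := Multiplicative.ofAdd 1
  have hσ : σ ≠ 1 := by
    have : Fact (1 < m) := ⟨hm⟩
    intro h
    exact one_ne_zero (α := ZMod m) (Multiplicative.ofAdd.injective h)
  have hσm : σ ^ m = 1 := by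
    rw [← ofAdd_nsmul]; simp
  refine ⟨Am φ, inferInstance, (am φ false).comp (MonoidHom.inl A Z), am φ true (1, σ), ?_, ?_⟩
  · rw [← map_pow, Prod.pow_mk, hσm, one_pow]
    exact map_one _
  · apply lift_injective_of_red hφ id Function.injective_id
    intro i x hx
    have hx' : ((x, 1) : A × Z) ≠ 1 := by
      intro h; exact hx (congrArg Prod.fst h)
    cases i
    · exact Red.single (φ := φ) false (x, 1) (hmem false _ hx')
    · have := Red.conj hφ (hM true) (Red.single (φ := φ) true (1, σ)
        (hmem true _ (fun h => hσ (congrArg Prod.snd h)))) hx'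
      simpa using this

/-- The amalgam of two groups along injective homs, in existential form. -/
theorem exists_amalgam {D K L : Type} [Group D] [Group K] [Group L] (f : D →* K) (g : D →* L)
    (hf : Function.Injective f) (hg : Function.Injective g) :
    ∃ (Q : Type) (_ : Group Q) (a : K →* Q) (b : L →* Q), Function.Injective a ∧
      ∀ d, a (f d) = b (g d) := by
  let φ : Bool → D →* K × L := fun i =>
    bif i then (MonoidHom.inr K L).comp g else (MonoidHom.inl K L).comp f
  have hφ : ∀ i, Function.Injective (φ i) := by
    rintro (_ | _)
    · exact (fun x y h => hf (congrArg Prod.fst h))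
    · exact (fun x y h => hg (congrArg Prod.snd h))
  refine ⟨Am φ, inferInstance, (am φ false).comp (MonoidHom.inl K L),
    (am φ true).comp (MonoidHom.inr K L), ?_, ?_⟩
  · exact (PushoutI.of_injective (φ := φ) hφ false).comp
      (fun x y h => congrArg Prod.fst h)
  · intro d
    exact (PushoutI.of_apply_eq_base φ false d).trans (PushoutI.of_apply_eq_base φ true d).symm

end Amalgam

section Main

open Monoid

/-- `H` with `α : A → H` and `t` is the HNN extension (universal property, existence part). -/
def IsHNN {C A H : Type} [Group C] [Group A] [Group H] (iP iN : C →* A) (α : A →* H) (t : H) :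
    Prop :=
  (∀ c, t * α (iP c) * t⁻¹ = α (iN c)) ∧
  ∀ (Q : Type) [Group Q] (f : A →* Q) (s : Q), (∀ c, s * f (iP c) * s⁻¹ = f (iN c)) →
    ∃ ψ : H →* Q, (∀ a, ψ (α a) = f a) ∧ ψ t = s

/-- Subgroup generated by `t^i A t^{-i}`, `0 ≤ i ≤ n`. -/
def Slab {A H : Type} [Group A] [Group H] (α : A →* H) (t : H) (n : ℕ) : Subgroup H :=
  Subgroup.closure {x | ∃ (i : ℕ) (a : A), i ≤ n ∧ x = t ^ i * α a * (t ^ i)⁻¹}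

/-- Amalgamation data for passing from `A` to `A *_C A`. -/
def stepφ {C A : Type} [Group C] [Group A] (iP iN : C →* A) : Bool → C →* A :=
  fun b => bif b then iP else iN

theorem final_step {C A H : Type} [Group C] [Group A] [Group H] {φ : Bool → C →* A}
    (hφ : ∀ i, Function.Injective (φ i)) (hM : ∀ i, Malnormal (φ i).range)
    (α : Am φ →* H) (t : H) (hH : IsHNN (am φ false) (am φ true) α t) (u : Am φ)
    (hu : ∀ a b, u ≠ am φ false a * am φ true b) (w : H) (hw : IsConj (α u * t) w)
    (m : ℕ) (hm : 2 ≤ m) (x : Am φ) (hx : α x ∈ Subgroup.normalClosure {w ^ m}) : x = 1 := by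
  obtain ⟨L, _, j, s, hs, hj⟩ := exists_cyclic A m hm
  obtain ⟨Q, _, a, b, ha, hab⟩ := exists_amalgam _ _ (conj_factors_injective hφ hM u hu) hj
  have h0 : ∀ y, a (am φ false y) = b (j y) := fun y => by
    simpa using hab (CoprodI.of (M := fun _ : Bool => A) (i := false) y)
  have h1 : ∀ y, a u * a (am φ true y) * (a u)⁻¹ = b s * b (j y) * (b s)⁻¹ := fun y => by
    simpa using hab (CoprodI.of (M := fun _ : Bool => A) (i := true) y)
  obtain ⟨ψ, hψ, hψt⟩ := hH.2 Q a ((a u)⁻¹ * b s) (by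
    intro y
    have := h1 y
    rw [h0]
    calc _ = (a u)⁻¹ * (b s * b (j y) * (b s)⁻¹) * a u := by group
      _ = _ := by rw [← this]; group)
  have hker : w ^ m ∈ ψ.ker := by
    rw [isConj_iff] at hw
    obtain ⟨c, rfl⟩ := hw
    rw [conj_pow, MonoidHom.mem_ker]
    have : ψ (α u * t) = b s := by rw [map_mul, hψ, hψt]; group
    rw [map_mul, map_mul, map_pow, this, ← map_pow, hs]; simp
  have := Subgroup.normalClosure_le_normal (Set.singleton_subset_iff.2 hker) hx
  rw [MonoidHom.mem_ker, hψ] at this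
  exact ha (by rw [this, map_one])

theorem main_induction (n : ℕ) : ∀ {C A H : Type} [Group C] [Group A] [Group H] (iP iN : C →* A)
    (_ : Function.Injective iP) (_ : Function.Injective iN)
    (_ : Malnormal iP.range) (_ : Malnormal iN.range) (α : A →* H) (t : H)
    (_ : IsHNN iP iN α t) (u : H) (_ : u ∈ Slab α t n) (w : H) (_ : IsConj (u * t) w)
    (_ : ∀ a, ¬ IsConj (α a * t) w) (m : ℕ) (_ : 2 ≤ m) (x : A)
    (_ : α x ∈ Subgroup.normalClosure {w ^ m}), x = 1 := by
  induction n with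
  | zero =>
    intro C A H _ _ _ iP iN hiP hiN hP hN α t hH u hu w hw hnot m hm x hx
    have : Slab α t 0 ≤ α.range := by
      rw [Slab, Subgroup.closure_le]
      rintro _ ⟨i, a, hi, rfl⟩
      obtain rfl : i = 0 := by omega
      exact ⟨a, by simp⟩
    obtain ⟨a, rfl⟩ := this hu
    exact absurd hw (hnot a)
  | succ n ih =>
    intro C A H _ _ _ iP iN hiP hiN hP hN α t hH u hu w hw hnot m hm x hx
    set φ := stepφ iP iN with hφdef
    have hφ : ∀ i, Function.Injective (φ i) := by
      rintro (_ | _)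
      · exact hiN
      · exact hiP
    have hM : ∀ i, Malnormal (φ i).range := by
      rintro (_ | _)
      · exact hN
      · exact hP
    let F : Bool → A →* H := fun b => bif b then (MulAut.conj t).toMonoidHom.comp α else α
    let α' : Am φ →* H := PushoutI.lift F (α.comp iN) (by
      rintro (_ | _)
      · rfl
      · ext c
        exact hH.1 c)
    have hα0 : ∀ a, α' (am φ false a) = α a := fun a => PushoutI.lift_of _ _ _ _
    have hα1 : ∀ a, α' (am φ true a) = t * α a * t⁻¹ := fun a => PushoutI.lift_of _ _ _ _
    have hH' : IsHNN (am φ false) (am φ true) α' t := by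
      refine ⟨fun a => by rw [hα0, hα1], ?_⟩
      intro Q _ f s hs
      obtain ⟨ψ, hψ, hψt⟩ := hH.2 Q (f.comp (am φ false)) s (by
        intro c
        change s * f (am φ false (iP c)) * s⁻¹ = f (am φ false (iN c))
        rw [hs]
        congr 1
        exact (PushoutI.of_apply_eq_base φ true c).trans
          (PushoutI.of_apply_eq_base φ false c).symm)
      refine ⟨ψ, ?_, hψt⟩
      have : ψ.comp α' = f := by
        apply PushoutI.hom_ext_nonempty
        rintro (_ | _)
        · ext a
          change ψ (α' (am φ false a)) = f (am φ false a)
          rw [hα0, hψ]; rfl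
        · ext a
          change ψ (α' (am φ true a)) = f (am φ true a)
          rw [hα1, map_mul, map_mul, map_inv, hψ, hψt]
          exact hs a
      exact fun a => DFunLike.congr_fun this a
    have hinj : Function.Injective (am φ false) := PushoutI.of_injective (φ := φ) hφ false
    have hinj1 : Function.Injective (am φ true) := PushoutI.of_injective (φ := φ) hφ true
    have hx' : α' (am φ false x) ∈ Subgroup.normalClosure {w ^ m} := by rwa [hα0]
    suffices am φ false x = 1 from hinj (by rw [this, map_one])
    by_cases hex : ∃ u', IsConj (α' u' * t) w
    · obtain ⟨u', hu'⟩ := hex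
      refine final_step hφ hM α' t hH' u' ?_ w hu' m hm _ hx'
      rintro a b rfl
      refine hnot (b * a) (IsConj.trans ?_ hu')
      rw [isConj_iff]
      refine ⟨α a * t * (α a * t)⁻¹ * (α b)⁻¹, ?_⟩
      rw [map_mul, map_mul, hα0, hα1]
      group
    · push Not at hex
      refine ih (am φ false) (am φ true) hinj hinj1 (malnormal_factor hφ false (hM true))
        (malnormal_factor hφ true (hM false)) α' t hH' u ?_ w hw hex m hm _ hx'
      have : Slab α t (n + 1) ≤ Slab α' t n := by
        rw [Slab, Subgroup.closure_le]
        rintro _ ⟨i, a, hi, rfl⟩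
        apply Subgroup.subset_closure
        rcases i with _ | i
        · exact ⟨0, am φ false a, by omega, by rw [hα0]⟩
        · refine ⟨i, am φ true a, by omega, ?_⟩
          rw [hα1, pow_succ]; group
      exact this hu

/-- Every element of exponent sum one is conjugate to `u t` with `u` in some slab. -/
theorem exists_slab {A H : Type} [Group A] [Group H] (α : A →* H) (t : H) (p : H →* Multiplicative ℤ)
    (hpα : ∀ a, p (α a) = 1) (hpt : p t = Multiplicative.ofAdd 1)
    (hgen : Subgroup.closure (Set.range α ∪ {t}) = ⊤) (w : H)
    (hw : p w = Multiplicative.ofAdd 1) :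
    ∃ n u, u ∈ Slab α t n ∧ IsConj (u * t) w := by
  have hmono : ∀ {n m : ℕ}, n ≤ m → Slab α t n ≤ Slab α t m := by
    intro n m h
    apply Subgroup.closure_mono
    rintro _ ⟨i, a, hi, rfl⟩
    exact ⟨i, a, hi.trans h, rfl⟩
  have hshift : ∀ {n : ℕ} (k : ℕ) {x}, x ∈ Slab α t n →
      t ^ k * x * (t ^ k)⁻¹ ∈ Slab α t (n + k) := by
    intro n k x hx
    have : Slab α t n ≤ (Slab α t (n + k)).comap (MulAut.conj (t ^ k)).toMonoidHom := by
      rw [Slab, Subgroup.closure_le]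
      rintro _ ⟨i, a, hi, rfl⟩
      apply Subgroup.subset_closure
      refine ⟨i + k, a, by omega, ?_⟩
      simp only [MulEquiv.coe_toMonoidHom, MulAut.conj_apply, add_comm i k, pow_add]
      group
    exact this hx
  -- the set of elements `x` such that `t^k x t^l` lies in a slab for some `k l`
  have key : ∀ x : H, ∃ (k n : ℕ) (z : ℤ), t ^ k * x * t ^ z ∈ Slab α t n := by
    intro x
    have hx : x ∈ Subgroup.closure (Set.range α ∪ {t}) := by rw [hgen]; trivial
    induction hx using Subgroup.closure_induction_left with
    | one => exact ⟨0, 0, 0, by simp [one_mem]⟩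
    | mul_left g hg y hy ih =>
      obtain ⟨k, n, z, h⟩ := ih
      rcases hg with ⟨a, rfl⟩ | rfl
      · refine ⟨k, n + k, z, ?_⟩
        have e : t ^ k * (α a * y) * t ^ z
            = (t ^ k * α a * (t ^ k)⁻¹) * (t ^ k * y * t ^ z) := by group
        rw [e]
        exact mul_mem (Subgroup.subset_closure ⟨k, a, by omega, rfl⟩) (hmono (by omega) h)
      · refine ⟨k, n + 1, z - 1, ?_⟩
        have := hshift 1 h
        convert this using 1
        simp only [pow_one, zpow_sub_one]
        simp only [← mul_assoc]
        rw [← pow_succ, ← pow_succ']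
    | inv_mul_cancel g hg y hy ih =>
      obtain ⟨k, n, z, h⟩ := ih
      rcases hg with ⟨a, rfl⟩ | rfl
      · refine ⟨k, n + k, z, ?_⟩
        have e : t ^ k * ((α a)⁻¹ * y) * t ^ z
            = (t ^ k * α a * (t ^ k)⁻¹)⁻¹ * (t ^ k * y * t ^ z) := by group
        rw [e]
        exact mul_mem (inv_mem (Subgroup.subset_closure ⟨k, a, by omega, rfl⟩))
          (hmono (by omega) h)
      · refine ⟨k + 1, n, z, ?_⟩
        convert h using 1
        rw [pow_succ]; group
  obtain ⟨k, n, z, h⟩ := key w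
  have hz : (k : ℤ) + 1 + z = 0 := by
    have hle : Slab α t n ≤ p.ker := by
      rw [Slab, Subgroup.closure_le]
      rintro _ ⟨i, a, hi, rfl⟩
      simp [hpα]
    have h1 := hle h
    rw [MonoidHom.mem_ker, map_mul, map_mul, map_pow, map_zpow, hw, hpt] at h1
    have := congrArg Multiplicative.toAdd h1
    simpa using this
  refine ⟨n, _, h, ?_⟩
  rw [isConj_iff]
  refine ⟨(t ^ k)⁻¹, ?_⟩
  obtain rfl : z = -k - 1 := by omega
  rw [zpow_sub_one, zpow_neg, zpow_natCast]
  group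

end Main

/-- If the images `i_P(C)` and `i_N(C)` are malnormal in `A`, `w ∈ A ∗_C` has `p w = ±1` and is
not conjugate to `a·t^{±1}`, then `A → (A ∗_C)/⟪w^m⟫` is injective for every `m ≥ 2`. -/
theorem stmt3 {C A : Type} [Group C] [Group A] (iP iN : C →* A)
    (hiP : Function.Injective iP) (hiN : Function.Injective iN)
    (hP : Malnormal iP.range) (hN : Malnormal iN.range)
    (w : HNNExtension A iP.range iN.range (hnnφ iP iN hiP hiN))
    (hpw : hnnProj iP iN hiP hiN w = Multiplicative.ofAdd 1 ∨
           hnnProj iP iN hiP hiN w = Multiplicative.ofAdd (-1))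
    (hnotconj : ∀ a : A, ¬ IsConj (HNNExtension.of a * HNNExtension.t) w ∧
                         ¬ IsConj (HNNExtension.of a * (HNNExtension.t)⁻¹) w)
    (m : ℕ) (hm : 2 ≤ m) :
    Function.Injective ((QuotientGroup.mk' (Subgroup.normalClosure {w ^ m})).comp
      (HNNExtension.of :
        A →* HNNExtension A iP.range iN.range (hnnφ iP iN hiP hiN))) := by
  have hH : IsHNN iP iN (HNNExtension.of :
      A →* HNNExtension A iP.range iN.range (hnnφ iP iN hiP hiN)) HNNExtension.t := by
    have hφ : ∀ c, ((hnnφ iP iN hiP hiN) ⟨iP c, c, rfl⟩ : A) = iN c := by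
      intro c
      have : (⟨iP c, c, rfl⟩ : iP.range) = MonoidHom.ofInjective hiP c := rfl
      rw [this, hnnφ, MulEquiv.trans_apply, MulEquiv.symm_apply_apply]
      rfl
    constructor
    · intro c
      have := HNNExtension.equiv_eq_conj (φ := hnnφ iP iN hiP hiN) ⟨iP c, c, rfl⟩
      rw [hφ] at this
      exact this.symm
    · intro Q _ f s hs
      refine ⟨HNNExtension.lift f s ?_, fun a => HNNExtension.lift_of _ _ _ _,
        HNNExtension.lift_t _ _ _⟩
      rintro ⟨_, c, rfl⟩
      rw [hφ, ← hs]; group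
  have hgen : Subgroup.closure (Set.range (HNNExtension.of :
      A →* HNNExtension A iP.range iN.range (hnnφ iP iN hiP hiN)) ∪ {HNNExtension.t}) = ⊤ := by
    rw [eq_top_iff]
    rintro x -
    induction x using HNNExtension.induction_on with
    | of g => exact Subgroup.subset_closure (.inl ⟨g, rfl⟩)
    | t => exact Subgroup.subset_closure (.inr rfl)
    | mul x y hx hy => exact mul_mem hx hy
    | inv x hx => exact inv_mem hx
  have main : ∀ v : HNNExtension A iP.range iN.range (hnnφ iP iN hiP hiN),
      hnnProj iP iN hiP hiN v = Multiplicative.ofAdd 1 →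
      (∀ a : A, ¬ IsConj (HNNExtension.of a * HNNExtension.t) v) →
      ∀ x : A, HNNExtension.of x ∈ Subgroup.normalClosure {v ^ m} → x = 1 := by
    intro v hv hnot x hx
    obtain ⟨n, u, hu, huv⟩ := exists_slab HNNExtension.of HNNExtension.t (hnnProj iP iN hiP hiN)
      (fun a => HNNExtension.lift_of _ _ _ _) (HNNExtension.lift_t _ _ _) hgen v hv
    exact main_induction n iP iN hiP hiN hP hN _ _ hH u hu v huv hnot m hm x hx
  rw [injective_iff_map_eq_one]
  intro x hx
  have hx : HNNExtension.of x ∈ Subgroup.normalClosure {w ^ m} := by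
    simpa using hx
  rcases hpw with h | h
  · exact main w h (fun a => (hnotconj a).1) x hx
  · refine main w⁻¹ (by rw [map_inv, h]; rfl) ?_ x ?_
    · intro a ha
      refine (hnotconj a⁻¹).2 ?_
      rw [isConj_iff] at ha ⊢
      obtain ⟨c, hc⟩ := ha
      refine ⟨c * HNNExtension.of a, ?_⟩
      rw [← inv_inv w, ← hc, map_inv]
      group
    · refine Subgroup.normalClosure_le_normal (Set.singleton_subset_iff.2 ?_) hx
      have : (w⁻¹ ^ m) ∈ Subgroup.normalClosure {w⁻¹ ^ m} :=
        Subgroup.subset_normalClosure rfl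
      have := inv_mem this
      simpa using this
end
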